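/- Every p-componentwise simply connected set S ⊆ ℝ² for which the Beer index b(S) is defined satisfies b(S) ≤ 180·c(S). -/

import Mathlib

open MeasureTheory
open scoped ENNReal

/-- `A` and `B` can be joined by a polygonal line inside `X`. -/
def PolyConn (X : Set (ℝ × ℝ)) (A B : ℝ × ℝ) : Prop :=
  A ∈ X ∧ B ∈ X ∧ ∃ n, ∃ f : Fin (n + 1) → ℝ × ℝ, f 0 = A ∧ f (Fin.last n) = B ∧
    ∀ i : Fin n, segment ℝ (f i.castSucc) (f i.succ) ⊆ X

namespace Beer

def cr (u v : ℝ × ℝ) : ℝ := u.1 * v.2 - u.2 * v.1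
def dt (u v : ℝ × ℝ) : ℝ := u.1 * v.1 + u.2 * v.2

noncomputable def ang (e A B : ℝ × ℝ) : ℝ :=
  Complex.arg ⟨dt (A - e) (B - e), cr (A - e) (B - e)⟩

/-- winding condition -/
def W2 (U : Set (ℝ × ℝ)) : Prop :=
  ∀ e, e ∉ U → ∃ θ : ℝ × ℝ → ℝ, ∀ A B, segment ℝ A B ⊆ U → θ B - θ A = ang e A B

theorem ang_pos {e A B : ℝ × ℝ} (h : 0 < cr (A - e) (B - e)) : 0 < ang e A B := by
  have h1 : 0 ≤ ang e A B := Complex.arg_nonneg_iff.2 h.le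
  rcases h1.lt_or_eq with h2 | h2
  · exact h2
  · have := (Complex.arg_eq_zero_iff.1 h2.symm).2
    simp at this; linarith

theorem ang_neg {e A B : ℝ × ℝ} (h : cr (A - e) (B - e) < 0) : ang e A B < 0 :=
  Complex.arg_neg_iff.2 h

theorem mem_seg {A B z : ℝ × ℝ} : z ∈ segment ℝ A B ↔
    ∃ t : ℝ, 0 ≤ t ∧ t ≤ 1 ∧ z = A + t • (B - A) := by
  rw [segment_eq_image']
  constructor
  · rintro ⟨t, ⟨h0, h1⟩, rfl⟩; exact ⟨t, h0, h1, rfl⟩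
  · rintro ⟨t, h0, h1, rfl⟩; exact ⟨t, ⟨h0, h1⟩, rfl⟩

theorem mem_oseg {A B z : ℝ × ℝ} : z ∈ openSegment ℝ A B ↔
    ∃ t : ℝ, 0 < t ∧ t < 1 ∧ z = A + t • (B - A) := by
  rw [openSegment_eq_image']
  constructor
  · rintro ⟨t, ⟨h0, h1⟩, rfl⟩; exact ⟨t, h0, h1, rfl⟩
  · rintro ⟨t, h0, h1, rfl⟩; exact ⟨t, ⟨h0, h1⟩, rfl⟩

theorem diag {U : Set (ℝ × ℝ)} (hW : W2 U) {A B a b : ℝ × ℝ}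
    (h1 : segment ℝ A a ⊆ U) (h2 : segment ℝ a b ⊆ U)
    (h3 : segment ℝ A B ⊆ U) (h4 : segment ℝ B b ⊆ U)
    (hs : cr (b - A) (a - A) * cr (b - A) (B - A) < 0) : segment ℝ A b ⊆ U := by
  intro w hw
  by_contra hwU
  obtain ⟨θ, hθ⟩ := hW w hwU
  have e1 := hθ _ _ h1
  have e2 := hθ _ _ h2
  have e3 := hθ _ _ h3
  have e4 := hθ _ _ h4
  obtain ⟨t, ht0, ht1, rfl⟩ := mem_seg.1 hw
  have hA : A ∈ U := h1 (left_mem_segment _ _ _)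
  have hb : b ∈ U := h2 (right_mem_segment _ _ _)
  have ht0' : 0 < t := by
    rcases ht0.lt_or_eq with h | h
    · exact h
    · subst h; simp at hwU; exact absurd hA hwU
  have ht1' : 0 < 1 - t := by
    rcases ht1.lt_or_eq with h | h
    · linarith
    · subst h; simp at hwU; exact absurd hb hwU
  set w := A + t • (b - A)
  have f1 : cr (A - w) (a - w) = - (t * cr (b - A) (a - A)) := by simp [w, cr]; ring
  have f2 : cr (a - w) (b - w) = - ((1 - t) * cr (b - A) (a - A)) := by simp [w, cr]; ring
  have f3 : cr (A - w) (B - w) = - (t * cr (b - A) (B - A)) := by simp [w, cr]; ring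
  have f4 : cr (B - w) (b - w) = - ((1 - t) * cr (b - A) (B - A)) := by simp [w, cr]; ring
  rcases mul_neg_iff.1 hs with ⟨p, q⟩ | ⟨p, q⟩
  · have g1 := ang_neg (e := w) (A := A) (B := a) (by rw [f1]; have := mul_pos ht0' p; linarith)
    have g2 := ang_neg (e := w) (A := a) (B := b) (by rw [f2]; have := mul_pos ht1' p; linarith)
    have g3 := ang_pos (e := w) (A := A) (B := B) (by rw [f3]; have := mul_neg_of_pos_of_neg ht0' q; linarith)
    have g4 := ang_pos (e := w) (A := B) (B := b) (by rw [f4]; have := mul_neg_of_pos_of_neg ht1' q; linarith)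
    linarith
  · have g1 := ang_pos (e := w) (A := A) (B := a) (by rw [f1]; have := mul_neg_of_pos_of_neg ht0' p; linarith)
    have g2 := ang_pos (e := w) (A := a) (B := b) (by rw [f2]; have := mul_neg_of_pos_of_neg ht1' p; linarith)
    have g3 := ang_neg (e := w) (A := A) (B := B) (by rw [f3]; have := mul_pos ht0' q; linarith)
    have g4 := ang_neg (e := w) (A := B) (B := b) (by rw [f4]; have := mul_pos ht1' q; linarith)
    linarith

theorem seg_sub {U : Set (ℝ × ℝ)} {A B C D : ℝ × ℝ} (h : segment ℝ A B ⊆ U)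
    (hC : C ∈ segment ℝ A B) (hD : D ∈ segment ℝ A B) : segment ℝ C D ⊆ U :=
  ((convex_segment A B).segment_subset hC hD).trans h

theorem seg_symm {U : Set (ℝ × ℝ)} {A B : ℝ × ℝ} (h : segment ℝ A B ⊆ U) :
    segment ℝ B A ⊆ U := by rwa [segment_symm]

theorem line_param {A B C : ℝ × ℝ} (h : cr (B - A) (C - A) = 0) (hBC : B ≠ C) :
    ∃ s : ℝ, A = B + s • (C - B) := by
  have hne : dt (C - B) (C - B) ≠ 0 := by
    intro h0
    apply hBC
    simp only [dt, Prod.fst_sub, Prod.snd_sub] at h0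
    have := add_eq_zero_iff_of_nonneg (mul_self_nonneg (C.1-B.1)) (mul_self_nonneg (C.2-B.2))
    have := this.1 h0
    simp at this
    ext <;> linarith
  refine ⟨dt (A - B) (C - B) / dt (C - B) (C - B), ?_⟩
  simp only [cr, dt, Prod.fst_sub, Prod.snd_sub] at h hne ⊢
  ext <;> simp only [Prod.fst_add, Prod.snd_add, Prod.smul_fst, Prod.smul_snd, Prod.fst_sub,
    Prod.snd_sub, smul_eq_mul] <;>
    rw [div_mul_eq_mul_div, ← sub_eq_iff_eq_add', eq_div_iff hne]
  · linear_combination (-(C.2 - B.2)) * h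
  · linear_combination (C.1 - B.1) * h

theorem seg_cover {A B C : ℝ × ℝ} (P Q : ℝ × ℝ)
    (hA : ∃ s : ℝ, A = P + s • (Q - P)) (hB : ∃ s : ℝ, B = P + s • (Q - P))
    (hC : ∃ s : ℝ, C = P + s • (Q - P)) :
    segment ℝ A C ⊆ segment ℝ A B ∪ segment ℝ B C := by
  obtain ⟨a, rfl⟩ := hA
  obtain ⟨b, rfl⟩ := hB
  obtain ⟨c, rfl⟩ := hC
  have key : ∀ s t : ℝ, segment ℝ (P + s • (Q - P)) (P + t • (Q - P)) =
      (fun r : ℝ => P + r • (Q - P)) '' Set.uIcc s t := by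
    intro s t
    have := image_segment ℝ (AffineMap.lineMap P Q : ℝ →ᵃ[ℝ] ℝ × ℝ) s t
    rw [segment_eq_uIcc] at this
    simp only [AffineMap.lineMap_apply, vsub_eq_sub, vadd_eq_add] at this
    simp only [add_comm P]
    exact this.symm
  simp only [key, ← Set.image_union]
  exact Set.image_mono Set.uIcc_subset_uIcc_union_uIcc

theorem tri {U : Set (ℝ × ℝ)} (hW : W2 U) {A B C X : ℝ × ℝ}
    (h1 : segment ℝ A B ⊆ U) (h2 : segment ℝ A C ⊆ U) (h3 : segment ℝ B C ⊆ U)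
    (hX : X ∈ segment ℝ B C) : segment ℝ A X ⊆ U := by
  by_cases hBC : B = C
  · subst hBC; simp at hX; subst hX; exact h1
  have hBX : segment ℝ B X ⊆ U := seg_sub h3 (left_mem_segment _ _ _) hX
  have hCX : segment ℝ C X ⊆ U := seg_sub h3 (right_mem_segment _ _ _) hX
  obtain ⟨t, ht0, ht1, rfl⟩ := mem_seg.1 hX
  by_cases hc : cr (B - A) (C - A) = 0
  · refine (seg_cover (A := A) (B := B) B C (line_param hc hBC) ⟨0, by simp⟩ ⟨t, rfl⟩).trans ?_
    exact Set.union_subset h1 hBX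
  rcases ht0.lt_or_eq with h0 | h0
  swap
  · subst h0; simpa using h1
  rcases ht1.lt_or_eq with h1' | h1'
  swap
  · subst h1'; simpa using h2
  refine diag hW h1 hBX h2 hCX ?_
  have e1 : cr (B + t • (C - B) - A) (B - A) = - (t * cr (B - A) (C - A)) := by simp [cr]; ring
  have e2 : cr (B + t • (C - B) - A) (C - A) = (1 - t) * cr (B - A) (C - A) := by simp [cr]; ring
  rw [e1, e2]
  have : 0 < t * (1 - t) := mul_pos h0 (by linarith)
  have := mul_pos this (mul_self_pos.2 hc)
  nlinarith

theorem tri_hull {U : Set (ℝ × ℝ)} (hW : W2 U) {A B C : ℝ × ℝ}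
    (h1 : segment ℝ A B ⊆ U) (h2 : segment ℝ A C ⊆ U) (h3 : segment ℝ B C ⊆ U) :
    convexHull ℝ {A, B, C} ⊆ U := by
  rw [convexHull_insert (by simp), convexHull_pair]
  intro z hz
  obtain ⟨a, ha, X, hX, hz'⟩ := mem_convexJoin.1 hz
  simp at ha; subst ha
  exact tri hW h1 h2 h3 hX hz'

end Beer

open MeasureTheory
open scoped ENNReal
namespace Beer

def os (q : (ℝ × ℝ) × (ℝ × ℝ)) : Set (ℝ × ℝ) := openSegment ℝ q.1 q.2
def yy (q : (ℝ × ℝ) × (ℝ × ℝ)) (z : ℝ × ℝ) : ℝ := cr (q.2 - q.1) (z - q.1)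
def IsChord (U : Set (ℝ × ℝ)) (q : (ℝ × ℝ) × (ℝ × ℝ)) : Prop :=
  q.1 ∉ U ∧ q.2 ∉ U ∧ os q ⊆ U
def RR (U : Set (ℝ × ℝ)) (q : (ℝ × ℝ) × (ℝ × ℝ)) : Set (ℝ × ℝ) :=
  {z | 0 < yy q z ∧ ∃ P ∈ os q, segment ℝ z P ⊆ U}

theorem IsChord.ne {U : Set (ℝ × ℝ)} {q : (ℝ × ℝ) × (ℝ × ℝ)} (h : IsChord U q) : q.1 ≠ q.2 := by
  intro e
  have := h.2.2
  rw [os, e, openSegment_same] at this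
  exact h.2.1 (this rfl)

theorem tube {U : Set (ℝ × ℝ)} (hU : IsOpen U) {A B : ℝ × ℝ} (h : segment ℝ A B ⊆ U) :
    ∃ T : Set (ℝ × ℝ), IsOpen T ∧ Convex ℝ T ∧ segment ℝ A B ⊆ T ∧ T ⊆ U := by
  have hc : IsCompact (segment ℝ A B) := by
    rw [segment_eq_image_lineMap]
    exact isCompact_Icc.image AffineMap.lineMap_continuous
  obtain ⟨δ, hδ, hs⟩ := hc.exists_thickening_subset_open hU h
  exact ⟨Metric.thickening δ (segment ℝ A B), Metric.isOpen_thickening,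
    (convex_segment A B).thickening δ, Metric.self_subset_thickening hδ _, hs⟩

theorem vis_open {U : Set (ℝ × ℝ)} (hU : IsOpen U) :
    IsOpen {p : (ℝ × ℝ) × (ℝ × ℝ) | segment ℝ p.1 p.2 ⊆ U} := by
  rw [isOpen_iff_mem_nhds]
  rintro ⟨A, B⟩ h
  obtain ⟨T, hT, hTc, hs, hTU⟩ := tube hU h
  have : T ×ˢ T ∈ nhds (A, B) :=
    (hT.prod hT).mem_nhds ⟨hs (left_mem_segment _ _ _), hs (right_mem_segment _ _ _)⟩
  filter_upwards [this] with p hp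
  exact (hTc.segment_subset hp.1 hp.2).trans hTU

theorem yy_line (q : (ℝ × ℝ) × (ℝ × ℝ)) (A B : ℝ × ℝ) (t : ℝ) :
    yy q (A + t • (B - A)) = yy q A + t * (yy q B - yy q A) := by
  simp [yy, cr]; ring

theorem yy_os {q : (ℝ × ℝ) × (ℝ × ℝ)} {P : ℝ × ℝ} (h : P ∈ os q) : yy q P = 0 := by
  obtain ⟨t, -, -, rfl⟩ := mem_oseg.1 h
  simp [yy, cr]; ring

theorem yy_seg {q : (ℝ × ℝ) × (ℝ × ℝ)} {P : ℝ × ℝ} (h : P ∈ segment ℝ q.1 q.2) : yy q P = 0 := by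
  obtain ⟨t, -, -, rfl⟩ := mem_seg.1 h
  simp [yy, cr]; ring

theorem continuous_yy (q : (ℝ × ℝ) × (ℝ × ℝ)) : Continuous (yy q) := by
  unfold yy cr; fun_prop

theorem os_conv (q : (ℝ × ℝ) × (ℝ × ℝ)) : Convex ℝ (os q) := convex_openSegment _ _

theorem line_lemma {U : Set (ℝ × ℝ)} {q : (ℝ × ℝ) × (ℝ × ℝ)} (hq : IsChord U q) {X P : ℝ × ℝ}
    (hX : yy q X = 0) (hP : P ∈ os q) (h : segment ℝ X P ⊆ U) : X ∈ os q := by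
  obtain ⟨s, hs⟩ : ∃ s : ℝ, X = q.1 + s • (q.2 - q.1) := by
    apply line_param _ hq.ne
    simp only [yy, cr] at hX ⊢
    simp at hX ⊢; linarith
  obtain ⟨t, ht0, ht1, rfl⟩ := mem_oseg.1 hP
  subst hs
  refine mem_oseg.2 ⟨s, ?_, ?_, rfl⟩
  · by_contra hs
    push Not at hs
    apply hq.1
    apply h
    refine mem_seg.2 ⟨-s / (t - s), ?_, ?_, ?_⟩
    · apply div_nonneg <;> linarith
    · rw [div_le_one] <;> linarith
    · have : t - s ≠ 0 := by linarith
      ext <;> simp <;> field_simp <;> ring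
  · by_contra hs
    push Not at hs
    apply hq.2.1
    apply h
    refine mem_seg.2 ⟨(s - 1) / (s - t), ?_, ?_, ?_⟩
    · apply div_nonneg <;> linarith
    · rw [div_le_one] <;> linarith
    · have : s - t ≠ 0 := by linarith
      ext <;> simp <;> field_simp <;> ring

theorem RR_open {U : Set (ℝ × ℝ)} (hU : IsOpen U) (q : (ℝ × ℝ) × (ℝ × ℝ)) : IsOpen (RR U q) := by
  have : RR U q = {z | 0 < yy q z} ∩ ⋃ P ∈ os q, {z | segment ℝ z P ⊆ U} := by
    ext z; simp [RR]
  rw [this]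
  refine (isOpen_lt continuous_const (continuous_yy q)).inter (isOpen_biUnion fun P _ => ?_)
  exact (vis_open hU).preimage (f := fun z => (z, P)) (by fun_prop)

theorem lemmaQ {U : Set (ℝ × ℝ)} (hW : W2 U) {q : (ℝ × ℝ) × (ℝ × ℝ)} (hq : IsChord U q)
    {A B a b : ℝ × ℝ} (hAB : segment ℝ A B ⊆ U) (ha : a ∈ os q) (hb : b ∈ os q)
    (hAa : segment ℝ A a ⊆ U) (hBb : segment ℝ B b ⊆ U) (hyA : 0 < yy q A)
    (hy : yy q A ≤ yy q B) : segment ℝ A b ⊆ U ∨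
      ∃ t τ : ℝ, 0 < t ∧ t < 1 ∧ 0 < τ ∧ τ < 1 ∧ t ≤ τ ∧ b + t • (B - b) = a + τ • (A - a) := by
  by_cases hab : a = b
  · left; rw [← hab]; exact hAa
  have habU : segment ℝ a b ⊆ U := ((os_conv q).segment_subset ha hb).trans hq.2.2
  obtain ⟨α, hα0, hα1, hα⟩ := mem_oseg.1 ha
  obtain ⟨β, hβ0, hβ1, hβ⟩ := mem_oseg.1 hb
  have hyB : 0 < yy q B := hyA.trans_le hy
  have hne : α - β ≠ 0 := by
    intro h; apply hab; rw [hα, hβ]; have : α = β := by linarith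
    rw [this]
  have k1 : ∀ z, cr (a - b) (z - b) = (α - β) * yy q z := by
    intro z; rw [hα, hβ]; simp [cr, yy]; ring
  have c1 : cr (b - A) (a - A) = (α - β) * yy q A := by
    rw [← k1]; simp [cr]; ring
  have c2 : cr (b - A) (B - A) = - cr (A - b) (B - b) := by
    simp [cr]; ring
  rcases lt_trichotomy (cr (b - A) (a - A) * cr (b - A) (B - A)) 0 with h | h | h
  · left; exact diag hW hAa habU hAB hBb h
  · rcases mul_eq_zero.1 h with h | h
    · rw [c1] at h
      rcases mul_eq_zero.1 h with h | h
      · exact absurd h hne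
      · linarith
    · left
      rw [c2] at h
      have hBb' : b ≠ B := by
        intro h; rw [← h, yy_os hb] at hyB; exact lt_irrefl _ hyB
      obtain ⟨s, hs⟩ := line_param (A := A) (B := b) (C := B) (by
        have : cr (b - A) (B - A) = - cr (A - b) (B - b) := c2
        rw [this, h]) hBb'
      have hyA' : yy q A = s * yy q B := by
        rw [hs, yy_line, yy_os hb]; ring
      have hs0 : 0 ≤ s := by
        by_contra hh; push Not at hh; nlinarith
      have hs1 : s ≤ 1 := by
        by_contra hh; push Not at hh; nlinarith
      exact seg_sub hBb (by rw [segment_symm]; exact mem_seg.2 ⟨s, hs0, hs1, hs⟩)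
        (right_mem_segment _ _ _)
  · right
    rw [c1, c2] at h
    set D := cr (A - b) (B - b) with hD
    have k2 := k1 B
    set E := cr (a - b) (B - b) with hE
    have hDE : D * E < 0 := by
      rw [k2]
      have h3 : ((α - β) * D) * yy q A < 0 := by nlinarith
      have h4 : (α - β) * D < 0 := by
        by_contra hh; push Not at hh; nlinarith [mul_nonneg hh hyA.le]
      nlinarith [mul_pos_of_neg_of_neg h4 (neg_neg_of_pos hyB)]
    have hD0 : D ≠ 0 := by rintro h0; rw [h0] at hDE; simp at hDE
    have hDE' : D - E ≠ 0 := by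
      intro h0; have : D = E := by linarith
      rw [this] at hDE; nlinarith [mul_self_nonneg E]
    have hσ0 : 0 < -E / (D - E) := by
      rw [show -E / (D - E) = (-(D*E)) * (D * (D - E))⁻¹ by field_simp]
      apply mul_pos (by linarith)
      apply inv_pos.2; nlinarith [mul_self_nonneg D]
    have hσ1 : 0 < D / (D - E) := by
      rw [show D / (D - E) = (D*D) * (D * (D - E))⁻¹ by field_simp]
      apply mul_pos (mul_self_pos.2 hD0)
      apply inv_pos.2; nlinarith [mul_self_nonneg D]
    have hsum : -E / (D - E) + D / (D - E) = 1 := by field_simp; ring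
    set τ := -E / (D - E) with hτ
    have hτt : τ * (yy q A / yy q B) ≤ τ := by
      have : yy q A / yy q B ≤ 1 := (div_le_one hyB).2 hy
      nlinarith
    refine ⟨τ * (yy q A / yy q B), τ, mul_pos hσ0 (div_pos hyA hyB), by linarith, hσ0,
      by linarith, hτt, ?_⟩
    have l1 : τ * (D - E) = - E := by rw [hτ]; field_simp
    have l2 : yy q A / yy q B * yy q B = yy q A := by field_simp
    set r := yy q A / yy q B
    have m1 : cr (a + τ • (A - a) - (b + (τ * r) • (B - b))) (B - b) = 0 := by
      have : cr (a + τ • (A - a) - (b + (τ * r) • (B - b))) (B - b) = E + τ * (D - E) := by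
        rw [hD, hE]; simp [cr]; ring
      rw [this, l1]; ring
    have m2 : cr (a - b) (a + τ • (A - a) - (b + (τ * r) • (B - b))) = 0 := by
      have : cr (a - b) (a + τ • (A - a) - (b + (τ * r) • (B - b))) =
          τ * cr (a - b) (A - b) - τ * r * cr (a - b) (B - b) := by
        simp [cr]; ring
      rw [this, k1, k1]
      linear_combination (- τ * (α - β)) * l2
    have hE0 : E ≠ 0 := by rintro h0; rw [h0] at hDE; simp at hDE
    set w := a + τ • (A - a) - (b + (τ * r) • (B - b)) with hw
    have w0 : w = 0 := by
      simp only [cr] at m1 m2 hE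
      ext
      · apply mul_left_cancel₀ hE0
        rw [hE]; simp only [Prod.fst_zero]
        linear_combination (a - b).1 * m1 + (B - b).1 * m2
      · apply mul_left_cancel₀ hE0
        rw [hE]; simp only [Prod.snd_zero]
        linear_combination (a - b).2 * m1 + (B - b).2 * m2
    exact (sub_eq_zero.1 w0).symm

theorem tri_area (A B C : ℝ × ℝ) :
    ENNReal.ofReal (|cr (B - A) (C - A)| / 2) ≤ volume (convexHull ℝ {A, B, C}) := by
  set u := B - A with hu
  set v := C - A with hv
  let T : Set (ℝ × ℝ) := {p | 0 ≤ p.1 ∧ 0 ≤ p.2 ∧ p.1 + p.2 ≤ 1}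
  have hTm : MeasurableSet T := by
    apply IsClosed.measurableSet
    exact (isClosed_le continuous_const continuous_fst).inter
      ((isClosed_le continuous_const continuous_snd).inter
      (isClosed_le (by fun_prop : Continuous fun p : ℝ × ℝ => p.1 + p.2) continuous_const))
  have hT : (2⁻¹ : ℝ≥0∞) ≤ volume T := by
    have h1 : volume (Set.Icc (0 : ℝ) 1 ×ˢ Set.Icc (0 : ℝ) 1) = 1 := by
      rw [Measure.volume_eq_prod, Measure.prod_prod]; simp
    have h2 : Set.Icc (0 : ℝ) 1 ×ˢ Set.Icc (0 : ℝ) 1 ⊆ T ∪ (fun x => ((1 : ℝ), (1 : ℝ)) - x) ⁻¹' T := by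
      rintro ⟨x, y⟩ ⟨⟨a, b⟩, ⟨c, d⟩⟩
      simp only at a b c d
      by_cases h : x + y ≤ 1
      · left; exact ⟨a, c, h⟩
      · right
        refine ⟨?_, ?_, ?_⟩ <;> simp <;> linarith
    have h3 : volume ((fun x => ((1 : ℝ), (1 : ℝ)) - x) ⁻¹' T) = volume T :=
      (Measure.measurePreserving_sub_left volume _).measure_preimage hTm.nullMeasurableSet
    have h4 : 1 ≤ 2 * volume T := by
      calc 1 = _ := h1.symm
        _ ≤ _ := measure_mono h2
        _ ≤ _ := measure_union_le _ _
        _ = 2 * volume T := by rw [h3, two_mul]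
    rw [ENNReal.inv_le_iff_le_mul (by simp) (by simp)]
    exact h4
  let L : (ℝ × ℝ) →ₗ[ℝ] (ℝ × ℝ) :=
    Matrix.toLin (Module.Basis.finTwoProd ℝ) (Module.Basis.finTwoProd ℝ) !![u.1, v.1; u.2, v.2]
  have hdet : LinearMap.det L = cr u v := by
    simp [L, LinearMap.det_toLin, Matrix.det_fin_two, cr]; ring
  have hL : ∀ p, L p = p.1 • u + p.2 • v := by
    intro p; simp [L, Matrix.toLin_finTwoProd_apply]
    ext <;> simp <;> ring
  have hsub : (fun x => A + x) '' (L '' T) ⊆ convexHull ℝ {A, B, C} := by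
    rintro _ ⟨_, ⟨p, ⟨hp1, hp2, hp3⟩, rfl⟩, rfl⟩
    have hA : A ∈ convexHull ℝ {A, B, C} := subset_convexHull _ _ (by simp)
    have hB : B ∈ convexHull ℝ {A, B, C} := subset_convexHull _ _ (by simp)
    have hC : C ∈ convexHull ℝ {A, B, C} := subset_convexHull _ _ (by simp)
    have := (convex_convexHull ℝ {A, B, C}).sum_mem (t := Finset.univ) (w := ![1 - p.1 - p.2, p.1, p.2])
      (z := ![A, B, C]) (by
        intro i _; fin_cases i <;> simp <;> linarith) (by simp [Fin.sum_univ_three]; ring) (by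
        intro i _; fin_cases i <;> simp [hA, hB, hC])
    convert this using 1
    rw [hL]
    simp [Fin.sum_univ_three, hu, hv]
    ext <;> simp <;> ring
  calc ENNReal.ofReal (|cr u v| / 2) = ENNReal.ofReal |cr u v| * 2⁻¹ := by
        rw [div_eq_mul_inv, ENNReal.ofReal_mul (abs_nonneg _), ENNReal.ofReal_inv_of_pos (by norm_num)]
        simp
    _ ≤ ENNReal.ofReal |LinearMap.det L| * volume T := by rw [hdet]; gcongr
    _ = volume (L '' T) := (Measure.addHaar_image_linearMap _ _ _).symm
    _ = volume ((fun x => A + x) '' (L '' T)) := by rw [Set.image_add_left, measure_preimage_add]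
    _ ≤ _ := measure_mono hsub

def MB (U : Set (ℝ × ℝ)) (m : ℝ) : Prop := ∀ K ⊆ U, Convex ℝ K → volume K ≤ ENNReal.ofReal m

theorem MB.tri {U : Set (ℝ × ℝ)} {m : ℝ} (hm : MB U m) (hm0 : 0 ≤ m) (hW : W2 U) {A B C : ℝ × ℝ}
    (h1 : segment ℝ A B ⊆ U) (h2 : segment ℝ A C ⊆ U) (h3 : segment ℝ B C ⊆ U) :
    |cr (B - A) (C - A)| ≤ 2 * m := by
  have := (tri_area A B C).trans (hm _ (tri_hull hW h1 h2 h3) (convex_convexHull _ _))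
  rw [ENNReal.ofReal_le_ofReal_iff hm0] at this
  linarith

theorem lemmaG {U : Set (ℝ × ℝ)} {m : ℝ} (hm : MB U m) (hm0 : 0 ≤ m)
    (hW : W2 U) {q : (ℝ × ℝ) × (ℝ × ℝ)} (hq : IsChord U q)
    {A B b : ℝ × ℝ} (hAB : segment ℝ A B ⊆ U) (hA : A ∈ RR U q) (hb : b ∈ os q)
    (hBb : segment ℝ B b ⊆ U)
    (hy : yy q A ≤ yy q B) : |cr (A - b) (B - b)| ≤ 4 * m := by
  obtain ⟨hyA, a, ha, hAa⟩ := hA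
  rcases lemmaQ hW hq hAB ha hb hAa hBb hyA hy with h | ⟨t, τ, ht0, ht1, hτ0, hτ1, htτ, hG⟩
  · have := hm.tri hm0 hW (A := b) (B := A) (C := B) (seg_symm h) (seg_symm hBb) hAB
    linarith
  · have habU : segment ℝ a b ⊆ U := ((os_conv q).segment_subset ha hb).trans hq.2.2
    set G := b + t • (B - b) with hGd
    have hG1 : G ∈ segment ℝ B b := by
      rw [segment_symm]; exact mem_seg.2 ⟨t, ht0.le, ht1.le, rfl⟩
    have hG2 : G ∈ segment ℝ A a := by
      rw [segment_symm]; exact mem_seg.2 ⟨τ, hτ0.le, hτ1.le, hG⟩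
    have t1 := hm.tri hm0 hW (A := G) (B := A) (C := B)
      (seg_sub hAa hG2 (left_mem_segment _ _ _)) (seg_sub hBb hG1 (left_mem_segment _ _ _)) hAB
    have t2 := hm.tri hm0 hW (A := G) (B := a) (C := b)
      (seg_sub hAa hG2 (right_mem_segment _ _ _)) (seg_sub hBb hG1 (right_mem_segment _ _ _)) habU
    have e1 : cr (A - G) (B - G) = (1 - t) * cr (A - b) (B - b) := by
      rw [hGd]; simp [cr]; ring
    have e2 : cr (a - G) (b - G) * (1 - τ) = τ * t * cr (A - b) (B - b) := by
      have x1 : (1 - τ) • (a - G) = - τ • (A - G) := by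
        rw [hG]; ext <;> simp <;> ring
      have x2 : cr (a - G) (b - G) * (1 - τ) = cr ((1 - τ) • (a - G)) (b - G) := by
        simp [cr]; ring
      rw [x2, x1, hGd]
      simp [cr]; ring
    rw [e1, abs_mul, abs_of_pos (by linarith : 0 < 1 - t)] at t1
    have e3 : |cr (a - G) (b - G)| * (1 - τ) = τ * t * |cr (A - b) (B - b)| := by
      rw [← abs_of_pos (by linarith : 0 < 1 - τ), ← abs_mul, e2, abs_mul, abs_mul, abs_of_pos hτ0,
        abs_of_pos ht0]
    set D := |cr (A - b) (B - b)|
    have hD : 0 ≤ D := abs_nonneg _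
    by_cases h : t ≤ 1 / 2
    · nlinarith
    · push Not at h
      have : τ * t * D ≤ 2 * m * (1 - τ) := by rw [← e3]; nlinarith
      have h5 : τ * (t * D) ≤ τ * (2 * m) := by nlinarith
      have h6 := le_of_mul_le_mul_left h5 hτ0
      nlinarith

theorem L3 {U : Set (ℝ × ℝ)}
    (hW : W2 U) {q : (ℝ × ℝ) × (ℝ × ℝ)} (hq : IsChord U q)
    {A B : ℝ × ℝ} (hAB : segment ℝ A B ⊆ U) (hA : A ∈ RR U q) (hB : B ∈ RR U q) :
    segment ℝ A B ⊆ RR U q := by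
  wlog hy : yy q A ≤ yy q B
  · have := this hW hq (seg_symm hAB) hB hA (le_of_not_ge hy)
    rwa [segment_symm] at this
  obtain ⟨hyA, a, ha, hAa⟩ := hA
  obtain ⟨hyB, b, hb, hBb⟩ := hB
  intro Z hZ
  obtain ⟨s, hs0, hs1, hZs⟩ := mem_seg.1 hZ
  refine ⟨by rw [hZs, yy_line]; nlinarith, ?_⟩
  rcases lemmaQ hW hq hAB ha hb hAa hBb hyA hy with h | ⟨t, τ, ht0, ht1, hτ0, hτ1, htτ, hG⟩
  · exact ⟨b, hb, seg_symm (tri hW (seg_symm h) (seg_symm hBb) hAB hZ)⟩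
  · have habU : segment ℝ a b ⊆ U := ((os_conv q).segment_subset ha hb).trans hq.2.2
    set G := b + t • (B - b) with hGd
    have hG1 : G ∈ segment ℝ B b := by
      rw [segment_symm]; exact mem_seg.2 ⟨t, ht0.le, ht1.le, rfl⟩
    have hG2 : G ∈ segment ℝ A a := by
      rw [segment_symm]; exact mem_seg.2 ⟨τ, hτ0.le, hτ1.le, hG⟩
    have hGZ : segment ℝ G Z ⊆ U := tri hW (seg_sub hAa hG2 (left_mem_segment _ _ _))
      (seg_sub hBb hG1 (left_mem_segment _ _ _)) hAB hZ
    have hα0 : 0 ≤ (1 - s) * (1 - τ) / τ := div_nonneg (mul_nonneg (by linarith) (by linarith)) hτ0.le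
    have hβ0 : 0 ≤ s * (1 - t) / t := div_nonneg (mul_nonneg (by linarith) (by linarith)) ht0.le
    have hαe : (1 - s) * (1 - τ) / τ * τ = (1 - s) * (1 - τ) := by field_simp
    have hβe : s * (1 - t) / t * t = s * (1 - t) := by field_simp
    set α := (1 - s) * (1 - τ) / τ with hα
    set β := s * (1 - t) / t with hβ
    have hab0 : 0 < α + β := by
      rcases hs0.lt_or_eq with h | h
      · have : 0 < β := div_pos (mul_pos h (by linarith)) ht0
        linarith
      · have : 0 < α := by
          rw [hα, ← h]; apply div_pos _ hτ0
          nlinarith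
        linarith
    have hZG : Z - G = - (α • (a - G) + β • (b - G)) := by
      have x1 : Z - G = (1 - s) • (A - G) + s • (B - G) := by
        rw [hZs]; ext <;> simp <;> ring
      have x2 : (1 - s) • (A - G) = - (α • (a - G)) := by
        rw [hG]
        have : (1 - s) • (A - (a + τ • (A - a))) = ((1 - s) * (1 - τ)) • (A - a) := by
          ext <;> simp <;> ring
        rw [this, ← hαe]
        ext <;> simp <;> ring
      have x3 : s • (B - G) = - (β • (b - G)) := by
        rw [hGd]
        have : s • (B - (b + t • (B - b))) = (s * (1 - t)) • (B - b) := by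
          ext <;> simp <;> ring
        rw [this, ← hβe]
        ext <;> simp <;> ring
      rw [x1, x2, x3]; abel
    let z := a + (β / (α + β)) • (b - a)
    have hz : z ∈ segment ℝ a b :=
      mem_seg.2 ⟨_, div_nonneg hβ0 hab0.le, (div_le_one hab0).2 (by linarith), rfl⟩
    have hGz : segment ℝ G z ⊆ U := tri hW (seg_sub hAa hG2 (right_mem_segment _ _ _))
      (seg_sub hBb hG1 (right_mem_segment _ _ _)) habU hz
    refine ⟨z, (os_conv q).segment_subset ha hb hz, ?_⟩
    refine (seg_cover (B := G) z G ?_ ⟨1, by simp⟩ ⟨0, by simp⟩).trans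
      (Set.union_subset (seg_symm hGZ) hGz)
    have hzG : (α + β) • (z - G) = α • (a - G) + β • (b - G) := by
      ext <;> simp [z] <;> field_simp <;> ring
    refine ⟨1 + (α + β), ?_⟩
    have : Z = G - (α + β) • (z - G) := by
      rw [hzG]; have := hZG; rw [sub_eq_iff_eq_add] at this; rw [this]; abel
    rw [this]; ext <;> simp <;> ring

end Beer

open MeasureTheory
open scoped ENNReal
namespace Beer
open Filter Topology

theorem ray {U : Set (ℝ × ℝ)} (hU : IsOpen U) (hb : Bornology.IsBounded U) {X d : ℝ × ℝ}
    (hX : X ∈ U) (hd : d ≠ 0) :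
    ∃ t : ℝ, 0 < t ∧ X + t • d ∉ U ∧ ∀ s, 0 ≤ s → s < t → X + s • d ∈ U := by
  let C : Set ℝ := Set.Ici 0 ∩ (fun t : ℝ => X + t • d) ⁻¹' Uᶜ
  have hC : IsClosed C := isClosed_Ici.inter (hU.isClosed_compl.preimage (by fun_prop))
  have hne : C.Nonempty := by
    obtain ⟨M, hM⟩ := hb.exists_norm_le
    have hd' : 0 < ‖d‖ := norm_pos_iff.2 hd
    have hM0 : 0 ≤ M := (norm_nonneg _).trans (hM X hX)
    refine ⟨(2 * M + 1) / ‖d‖, by simp only [Set.mem_Ici]; positivity, fun h => ?_⟩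
    have h1 := hM _ h
    have h2 : ‖((2 * M + 1) / ‖d‖) • d‖ = 2 * M + 1 := by
      rw [norm_smul, Real.norm_of_nonneg (by positivity)]; field_simp
    have h3 := norm_sub_le (X + ((2 * M + 1) / ‖d‖) • d) X
    rw [add_sub_cancel_left, h2] at h3
    have := hM X hX
    linarith
  have hbd : BddBelow C := ⟨0, fun t ht => ht.1⟩
  have hmem := hC.csInf_mem hne hbd
  have h0 : sInf C ≠ 0 := by
    intro h; rw [h] at hmem; have := hmem.2; simp at this; exact this hX
  refine ⟨sInf C, lt_of_le_of_ne hmem.1 h0.symm, hmem.2, fun s hs hst => ?_⟩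
  by_contra hh
  exact absurd (csInf_le hbd (⟨hs, hh⟩ : s ∈ C)) (not_le.2 hst)

theorem chord_exists {U : Set (ℝ × ℝ)} (hU : IsOpen U) (hb : Bornology.IsBounded U) {X d : ℝ × ℝ}
    (hX : X ∈ U) (hd : d ≠ 0) : ∃ q, IsChord U q ∧ X ∈ os q ∧
      ∃ l : ℝ, 0 < l ∧ q.2 - q.1 = l • d := by
  obtain ⟨t, ht, htU, hts⟩ := ray hU hb hX hd
  obtain ⟨s, hs, hsU, hss⟩ := ray hU hb hX (neg_ne_zero.2 hd)
  have hst : s + t ≠ 0 := by linarith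
  refine ⟨(X + s • (-d), X + t • d), ⟨hsU, htU, ?_⟩, ?_, s + t, by linarith, ?_⟩
  · intro z hz
    obtain ⟨r, hr0, hr1, rfl⟩ := mem_oseg.1 hz
    simp only
    rcases le_total (r * (s + t)) s with h | h
    · have := hss (s - r * (s + t)) (by linarith) (by nlinarith)
      convert this using 1
      ext <;> simp <;> ring
    · have := hts (r * (s + t) - s) (by linarith) (by nlinarith)
      convert this using 1
      ext <;> simp <;> ring
  · refine mem_oseg.2 ⟨s / (s + t), by positivity, by rw [div_lt_one] <;> linarith, ?_⟩
    ext <;> simp <;> field_simp <;> ring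
  · ext <;> simp <;> ring

theorem seg_of_os {q : (ℝ × ℝ) × (ℝ × ℝ)} {U : Set (ℝ × ℝ)} (hq : IsChord U q) {z : ℝ × ℝ}
    (hz : z ∈ segment ℝ q.1 q.2) (hzU : z ∈ U) : z ∈ os q := by
  obtain ⟨t, h0, h1, rfl⟩ := mem_seg.1 hz
  refine mem_oseg.2 ⟨t, lt_of_le_of_ne h0 ?_, lt_of_le_of_ne h1 ?_, rfl⟩
  · rintro rfl; simp at hzU; exact hq.1 hzU
  · rintro rfl; simp at hzU; exact hq.2.1 hzU

theorem RT_convex {U : Set (ℝ × ℝ)} (hW : W2 U) {q : (ℝ × ℝ) × (ℝ × ℝ)} (hq : IsChord U q)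
    {T : Set (ℝ × ℝ)} (hT : Convex ℝ T) (hTU : T ⊆ U) : Convex ℝ (RR U q ∩ T) := by
  rw [convex_iff_segment_subset]
  rintro A ⟨hA, hA'⟩ B ⟨hB, hB'⟩
  have := hT.segment_subset hA' hB'
  exact Set.subset_inter (L3 hW hq (this.trans hTU) hA hB) this

theorem L4 {U : Set (ℝ × ℝ)} (hU : IsOpen U) (hW : W2 U) {q : (ℝ × ℝ) × (ℝ × ℝ)} (hq : IsChord U q)
    {X P : ℝ × ℝ} (hX : X ∈ U) (hXR : X ∉ RR U q) (hXq : X ∉ os q)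
    {C Q : ℕ → ℝ × ℝ} (hC : Tendsto C atTop (𝓝 X)) (hQ : Tendsto Q atTop (𝓝 P))
    (hCR : ∀ k, C k ∈ RR U q) (hQq : ∀ k, Q k ∈ os q) (hCQ : ∀ k, segment ℝ (C k) (Q k) ⊆ U) :
    P ≠ X ∧ ∀ Y, segment ℝ X Y ⊆ U → cr (Y - P) (X - P) = 0 → Y ∈ closure (RR U q) ∧ Y ∉ RR U q := by
  have hcs : IsClosed (segment ℝ q.1 q.2) := by
    rw [segment_eq_image_lineMap]
    exact (isCompact_Icc.image AffineMap.lineMap_continuous).isClosed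
  have hP : P ∈ segment ℝ q.1 q.2 :=
    hcs.mem_of_tendsto hQ (Eventually.of_forall fun k => openSegment_subset_segment _ _ _ (hQq k))
  have hyX : 0 ≤ yy q X :=
    ge_of_tendsto' (((continuous_yy q).tendsto X).comp hC) fun k => (hCR k).1.le
  have hPX : P ≠ X := by
    rintro rfl
    exact hXq (seg_of_os hq hP hX)
  have hcl : ∀ Y, segment ℝ X Y ⊆ U → cr (Y - P) (X - P) = 0 → Y ∈ closure (RR U q) := by
    intro Y hXY hcr
    obtain ⟨l, hl⟩ : ∃ l : ℝ, Y = P + l • (X - P) := by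
      apply line_param _ hPX
      simp only [cr] at hcr ⊢
      simp at hcr ⊢; linarith
    have hl0 : 0 < l := by
      by_contra hl0
      push Not at hl0
      have hPs : P ∈ segment ℝ X Y := by
        refine mem_seg.2 ⟨1 / (1 - l), ?_, ?_, ?_⟩
        · apply div_nonneg <;> linarith
        · rw [div_le_one] <;> linarith
        · have : 1 - l ≠ 0 := by linarith
          rw [hl]; ext <;> simp <;> field_simp <;> ring
      have hPo := seg_of_os hq hP (hXY hPs)
      have hXP : segment ℝ X P ⊆ U := seg_sub hXY (left_mem_segment _ _ _) hPs
      rcases hyX.lt_or_eq with h | h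
      · exact hXR ⟨h, P, hPo, hXP⟩
      · exact hXq (line_lemma hq h.symm hPo hXP)
    obtain ⟨T, hT, hTc, hsT, hTU⟩ := tube hU hXY
    have hY : Tendsto (fun k => Q k + l • (C k - Q k)) atTop (𝓝 Y) := by
      rw [hl]; exact hQ.add ((hC.sub hQ).const_smul l)
    have e1 : ∀ᶠ k in atTop, C k ∈ T := hC.eventually (hT.mem_nhds (hsT (left_mem_segment _ _ _)))
    have e2 : ∀ᶠ k in atTop, Q k + l • (C k - Q k) ∈ T :=
      hY.eventually (hT.mem_nhds (hsT (right_mem_segment _ _ _)))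
    refine mem_closure_of_tendsto hY ?_
    filter_upwards [e1, e2] with k h1 h2
    refine ⟨?_, Q k, hQq k, ?_⟩
    · rw [yy_line, yy_os (hQq k)]
      have := mul_pos hl0 (hCR k).1
      simpa using this
    · refine (seg_cover (B := C k) (Q k) (C k) ⟨l, rfl⟩ ⟨1, by simp⟩ ⟨0, by simp⟩).trans
        (Set.union_subset ((hTc.segment_subset h2 h1).trans hTU) (hCQ k))
  refine ⟨hPX, fun Y hXY hcr => ⟨hcl Y hXY hcr, fun hYR => ?_⟩⟩
  obtain ⟨T, hT, hTc, hsT, hTU⟩ := tube hU hXY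
  have hXT : X ∈ T := hsT (left_mem_segment _ _ _)
  have hYT : Y ∈ T := hsT (right_mem_segment _ _ _)
  obtain ⟨ε, hε, hWT⟩ : ∃ ε : ℝ, 0 < ε ∧ X + ε • (X - Y) ∈ T := by
    have : Tendsto (fun ε : ℝ => X + ε • (X - Y)) (𝓝[>] 0) (𝓝 X) := by
      have h : Continuous (fun ε : ℝ => X + ε • (X - Y)) := by fun_prop
      have := h.tendsto 0
      simp only [zero_smul, add_zero] at this
      exact this.mono_left nhdsWithin_le_nhds
    have h2 := (this.eventually (hT.mem_nhds hXT)).and self_mem_nhdsWithin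
    obtain ⟨ε, h1, h2⟩ := h2.exists
    exact ⟨ε, h2, h1⟩
  have hWc := hcl (X + ε • (X - Y)) ((hTc.segment_subset hXT hWT).trans hTU) (by
    have : cr (X + ε • (X - Y) - P) (X - P) = - ε * cr (Y - P) (X - P) := by simp [cr]; ring
    rw [this, hcr, mul_zero])
  have hWc' : X + ε • (X - Y) ∈ closure (RR U q ∩ T) := by
    rw [Set.inter_comm]
    exact hT.inter_closure ⟨hWT, hWc⟩
  have hop : IsOpen (RR U q ∩ T) := (RR_open hU q).inter hT
  have := (RT_convex hW hq hTc hTU).openSegment_interior_closure_subset_interior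
    (x := Y) (y := X + ε • (X - Y)) (by rw [hop.interior_eq]; exact ⟨hYR, hYT⟩) hWc'
  have hX' := interior_subset (this (mem_oseg.2 ⟨1 / (1 + ε), by positivity, by
    rw [div_lt_one] <;> linarith, (by
      have : 1 + ε ≠ 0 := by linarith
      ext <;> simp <;> field_simp <;> ring : X = Y + (1 / (1 + ε)) • (X + ε • (X - Y) - Y))⟩))
  exact hXR hX'.1

def rev (q : (ℝ × ℝ) × (ℝ × ℝ)) : (ℝ × ℝ) × (ℝ × ℝ) := (q.2, q.1)

theorem os_rev (q : (ℝ × ℝ) × (ℝ × ℝ)) : os (rev q) = os q := openSegment_symm _ _ _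
theorem yy_rev (q : (ℝ × ℝ) × (ℝ × ℝ)) (z : ℝ × ℝ) : yy (rev q) z = - yy q z := by
  simp [yy, rev, cr]; ring
theorem rev_rev (q : (ℝ × ℝ) × (ℝ × ℝ)) : rev (rev q) = q := rfl
theorem IsChord.rev {U : Set (ℝ × ℝ)} {q : (ℝ × ℝ) × (ℝ × ℝ)} (h : IsChord U q) :
    IsChord U (rev q) := ⟨h.2.1, h.1, by rw [os_rev]; exact h.2.2⟩

def Av (U : Set (ℝ × ℝ)) (q : (ℝ × ℝ) × (ℝ × ℝ)) (a b : ℝ × ℝ) : Prop :=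
  segment ℝ a b ⊆ U ∧ Disjoint (segment ℝ a b) (os q)

def HH (U : Set (ℝ × ℝ)) (q : (ℝ × ℝ) × (ℝ × ℝ)) : Set (ℝ × ℝ) :=
  {z | ∃ c ∈ RR U q, Relation.ReflTransGen (Av U q) c z}

theorem Av.symm {U : Set (ℝ × ℝ)} {q : (ℝ × ℝ) × (ℝ × ℝ)} {a b : ℝ × ℝ} (h : Av U q a b) :
    Av U q b a := by
  unfold Av; rw [segment_symm]; exact h

noncomputable def phi (q : (ℝ × ℝ) × (ℝ × ℝ)) (z : ℝ × ℝ) : ℝ := ang z q.2 q.1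

theorem coe_ang {e A B : ℝ × ℝ} (hA : A ≠ e) (hB : B ≠ e) :
    (ang e A B : Real.Angle) = (Complex.arg ⟨(B - e).1, (B - e).2⟩ : Real.Angle)
      - (Complex.arg ⟨(A - e).1, (A - e).2⟩ : Real.Angle) := by
  have h : ∀ u : ℝ × ℝ, u ≠ 0 → (⟨u.1, u.2⟩ : ℂ) ≠ 0 := by
    intro u hu h
    apply hu
    have h1 := congrArg Complex.re h
    have h2 := congrArg Complex.im h
    exact Prod.ext h1 h2
  have e1 : (⟨dt (A - e) (B - e), cr (A - e) (B - e)⟩ : ℂ) =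
      ⟨(B - e).1, (B - e).2⟩ * (starRingEnd ℂ) ⟨(A - e).1, (A - e).2⟩ := by
    apply Complex.ext <;> simp [dt, cr] <;> ring
  rw [ang, e1, Complex.arg_mul_coe_angle (h _ (sub_ne_zero.2 hB)), Complex.arg_conj_coe_angle,
    ← sub_eq_add_neg]
  simpa using h _ (sub_ne_zero.2 hA)

theorem slit {e A B : ℝ × ℝ} (h : e ∉ segment ℝ A B) :
    (⟨dt (A - e) (B - e), cr (A - e) (B - e)⟩ : ℂ) ∈ Complex.slitPlane := by
  rw [Complex.mem_slitPlane_iff]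
  by_contra hh
  push Not at hh
  simp only at hh
  obtain ⟨h1, h2⟩ := hh
  apply h
  by_cases hAB : A = B
  · subst hAB
    have : dt (A - e) (A - e) = 0 := le_antisymm h1 (by unfold dt; nlinarith [mul_self_nonneg (A - e).1, mul_self_nonneg (A - e).2])
    have := (add_eq_zero_iff_of_nonneg (mul_self_nonneg (A - e).1) (mul_self_nonneg (A - e).2)).1 this
    simp at this
    have : e = A := by ext <;> linarith
    rw [this]; exact left_mem_segment _ _ _
  · obtain ⟨s, hs⟩ := line_param h2 hAB
    have hd : 0 < dt (B - A) (B - A) := by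
      unfold dt
      by_contra hc
      apply hAB
      have hz := (add_eq_zero_iff_of_nonneg (mul_self_nonneg (B - A).1) (mul_self_nonneg (B - A).2)).1
        (by nlinarith [mul_self_nonneg (B - A).1, mul_self_nonneg (B - A).2])
      simp at hz
      ext <;> linarith
    have : dt (A - e) (B - e) = - (s * (1 - s)) * dt (B - A) (B - A) := by
      rw [hs]; simp [dt]; ring
    rw [this] at h1
    have : 0 ≤ s * (1 - s) := by
      by_contra hc; push Not at hc; nlinarith
    refine mem_seg.2 ⟨s, ?_, ?_, hs⟩
    · by_contra hc; push Not at hc; nlinarith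
    · by_contra hc; push Not at hc; nlinarith

theorem cont_ang {α : Type*} [TopologicalSpace α] {e A B : α → ℝ × ℝ} {s : Set α}
    (he : ContinuousOn e s) (hA : ContinuousOn A s) (hB : ContinuousOn B s)
    (h : ∀ x ∈ s, e x ∉ segment ℝ (A x) (B x)) : ContinuousOn (fun x => ang (e x) (A x) (B x)) s := by
  intro x hx
  have h1 : ContinuousWithinAt (fun x => (⟨dt (A x - e x) (B x - e x), cr (A x - e x) (B x - e x)⟩ : ℂ)) s x := by
    have : (fun x => (⟨dt (A x - e x) (B x - e x), cr (A x - e x) (B x - e x)⟩ : ℂ)) =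
      fun x => (dt (A x - e x) (B x - e x) : ℂ) + (cr (A x - e x) (B x - e x) : ℂ) * Complex.I := by
      funext y; apply Complex.ext <;> simp
    rw [this]
    have he := he x hx
    have hA := hA x hx
    have hB := hB x hx
    unfold dt cr
    fun_prop
  exact ContinuousAt.comp_continuousWithinAt (g := Complex.arg)
    (Complex.continuousAt_arg (slit (h x hx))) h1

theorem phi_step {U : Set (ℝ × ℝ)} {q : (ℝ × ℝ) × (ℝ × ℝ)} (hq : IsChord U q) {A B : ℝ × ℝ}
    (h : Av U q A B) : ang q.1 A B - ang q.2 A B = phi q B - phi q A := by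
  let z : ℝ → ℝ × ℝ := fun t => A + t • (B - A)
  let g : ℝ → ℝ := fun t => ang q.1 A (z t) - ang q.2 A (z t) - (phi q (z t) - phi q (z 0))
  have hzc : Continuous z := by fun_prop
  have hz0 : z 0 = A := by simp [z]
  have hz1 : z 1 = B := by simp [z]
  have hz : ∀ t ∈ Set.Icc (0 : ℝ) 1, z t ∈ segment ℝ A B := fun t ht => mem_seg.2 ⟨t, ht.1, ht.2, rfl⟩
  have hzs : ∀ t ∈ Set.Icc (0 : ℝ) 1, segment ℝ A (z t) ⊆ U := fun t ht =>
    seg_sub h.1 (left_mem_segment _ _ _) (hz t ht)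
  have hnq : ∀ t ∈ Set.Icc (0 : ℝ) 1, z t ∉ segment ℝ q.2 q.1 := by
    intro t ht hm
    rw [segment_symm] at hm
    exact Set.disjoint_left.1 h.2 (hz t ht) (seg_of_os hq hm (h.1 (hz t ht)))
  have hg : ContinuousOn g (Set.Icc 0 1) := by
    refine ((cont_ang continuousOn_const continuousOn_const hzc.continuousOn ?_).sub
      (cont_ang continuousOn_const continuousOn_const hzc.continuousOn ?_)).sub
      ((cont_ang hzc.continuousOn continuousOn_const continuousOn_const hnq).sub continuousOn_const)
    · exact fun t ht hm => hq.1 (hzs t ht hm)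
    · exact fun t ht hm => hq.2.1 (hzs t ht hm)
  have hne1 : ∀ {w}, w ∈ U → w ≠ q.1 := fun hw e => hq.1 (e ▸ hw)
  have hne2 : ∀ {w}, w ∈ U → w ≠ q.2 := fun hw e => hq.2.1 (e ▸ hw)
  have harg : ∀ u : ℝ × ℝ, u ≠ 0 → (Complex.arg ⟨(-u).1, (-u).2⟩ : Real.Angle) =
      (Complex.arg ⟨u.1, u.2⟩ : Real.Angle) + (Real.pi : ℝ) := by
    intro u hu
    have : (⟨(-u).1, (-u).2⟩ : ℂ) = - ⟨u.1, u.2⟩ := by apply Complex.ext <;> simp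
    rw [this, Complex.arg_neg_coe_angle]
    intro h
    apply hu
    have h1 := congrArg Complex.re h
    have h2 := congrArg Complex.im h
    exact Prod.ext h1 h2
  have hcos : ∀ t ∈ Set.Icc (0 : ℝ) 1, Real.cos (g t) = 1 := by
    intro t ht
    have hA : A ∈ U := h.1 (left_mem_segment _ _ _)
    have hzU : z t ∈ U := h.1 (hz t ht)
    have : ((g t : ℝ) : Real.Angle) = 0 := by
      simp only [g, phi, Real.Angle.coe_sub, hz0]
      rw [coe_ang (hne1 hA) (hne1 hzU), coe_ang (hne2 hA) (hne2 hzU),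
        coe_ang (hne2 hzU).symm (hne1 hzU).symm, coe_ang (hne2 hA).symm (hne1 hA).symm,
        ← neg_sub (z t) q.1, ← neg_sub (z t) q.2, ← neg_sub A q.1, ← neg_sub A q.2,
        harg _ (sub_ne_zero.2 (hne1 hzU)), harg _ (sub_ne_zero.2 (hne2 hzU)),
        harg _ (sub_ne_zero.2 (hne1 hA)), harg _ (sub_ne_zero.2 (hne2 hA))]
      abel
    have := congrArg Real.Angle.cos this
    simpa using this
  have hg0 : g 0 = 0 := by
    have h1 : ∀ e, e ∉ U → ang e A A = 0 := by
      intro e he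
      have : cr (A - e) (A - e) = 0 := by simp [cr]; ring
      rw [ang, Complex.arg_eq_zero_iff]
      exact ⟨by simp only [dt]; nlinarith [mul_self_nonneg (A - e).1, mul_self_nonneg (A - e).2], this⟩
    simp [g, hz0, h1 _ hq.1, h1 _ hq.2.1]
  have key : g 1 = 0 := by
    by_contra hne
    have hpi := Real.pi_pos
    have hcl : ∀ c, c ≠ 0 → |c| ≤ Real.pi → Real.cos c ≠ 1 := by
      intro c hc0 hc h1
      have := (Real.cos_eq_one_iff_of_lt_of_lt (by linarith [(abs_le.1 hc).1]) (by linarith [(abs_le.1 hc).2])).1 h1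
      exact hc0 this
    rcases lt_or_gt_of_ne hne with hl | hl
    · have hm : max (g 1) (-Real.pi) ∈ Set.Icc (g 1) (g 0) :=
        ⟨le_max_left _ _, by rw [hg0]; exact max_le hl.le (by linarith)⟩
      obtain ⟨t, ht, hgt⟩ := intermediate_value_Icc' zero_le_one hg hm
      refine hcl _ ?_ ?_ (hcos t ht)
      · rw [hgt]; exact (max_lt hl (by linarith)).ne
      · rw [hgt, abs_le]; exact ⟨le_max_right _ _, (max_le hl.le (by linarith)).trans hpi.le⟩
    · have hm : min (g 1) (Real.pi) ∈ Set.Icc (g 0) (g 1) :=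
        ⟨by rw [hg0]; exact le_min hl.le hpi.le, min_le_left _ _⟩
      obtain ⟨t, ht, hgt⟩ := intermediate_value_Icc zero_le_one hg hm
      refine hcl _ ?_ ?_ (hcos t ht)
      · rw [hgt]; exact (lt_min hl hpi).ne'
      · rw [hgt, abs_le]; exact ⟨by linarith [le_min hl.le hpi.le], min_le_right _ _⟩
  simp only [g, hz0, hz1] at key
  linarith

theorem pos_comb {a b t : ℝ} (ha : 0 < a) (hb : 0 < b) (h0 : 0 ≤ t) (h1 : t ≤ 1) :
    0 < a + t * (b - a) := by
  have hm : 0 < min a b := lt_min ha hb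
  have e1 := mul_le_mul_of_nonneg_left (min_le_left a b) (by linarith : 0 ≤ 1 - t)
  have e2 := mul_le_mul_of_nonneg_left (min_le_right a b) h0
  nlinarith

theorem rtg_symm {α : Type*} {r : α → α → Prop} (hr : ∀ a b, r a b → r b a) {a b : α}
    (h : Relation.ReflTransGen r a b) : Relation.ReflTransGen r b a := by
  induction h with
  | refl => exact .refl
  | tail _ h ih => exact .head (hr _ _ h) ih

theorem near_pt {T : Set (ℝ × ℝ)} (hT : IsOpen T) {X : ℝ × ℝ} (hX : X ∈ T) (c : ℝ × ℝ) :
    ∃ ε : ℝ, 0 < ε ∧ ε < 1 ∧ X + ε • (c - X) ∈ T := by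
  have : Tendsto (fun ε : ℝ => X + ε • (c - X)) (𝓝[>] 0) (𝓝 X) := by
    have h : Continuous (fun ε : ℝ => X + ε • (c - X)) := by fun_prop
    have := h.tendsto 0
    simp only [zero_smul, add_zero] at this
    exact this.mono_left nhdsWithin_le_nhds
  have h2 := (this.eventually (hT.mem_nhds hX)).and
    (Ioo_mem_nhdsGT (zero_lt_one (α := ℝ)))
  obtain ⟨ε, h1, h2⟩ := h2.exists
  exact ⟨ε, h2.1, h2.2, h1⟩

theorem SL {U : Set (ℝ × ℝ)} (hU : IsOpen U) (hW : W2 U) {q : (ℝ × ℝ) × (ℝ × ℝ)} (hq : IsChord U q)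
    {c d : ℝ × ℝ} (hc : c ∈ RR U q) (hd : d ∈ RR U (rev q))
    (hcd : Relation.ReflTransGen (Av U q) c d) : False := by
  obtain ⟨θ1, h1⟩ := hW q.1 hq.1
  obtain ⟨θ2, h2⟩ := hW q.2 hq.2.1
  let k : ℝ × ℝ → ℝ := fun z => θ1 z - θ2 z - phi q z
  have hk : ∀ A B, Av U q A B → k A = k B := by
    intro A B h
    have := phi_step hq h
    have a1 := h1 _ _ h.1
    have a2 := h2 _ _ h.1
    simp only [k]; linarith
  have hkcd : k c = k d := by
    clear hd
    induction hcd with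
    | refl => rfl
    | tail _ h ih => rw [ih, hk _ _ h]
  obtain ⟨hyc, X, hX, hcX⟩ := hc
  obtain ⟨hyd, X', hX', hdX⟩ := hd
  rw [yy_rev] at hyd
  rw [os_rev] at hX'
  obtain ⟨T, hT, hTc, hsT, hTU⟩ := tube hU (((os_conv q).segment_subset hX hX').trans hq.2.2)
  obtain ⟨ε, hε0, hε1, hcT⟩ := near_pt hT (hsT (left_mem_segment _ _ _)) c
  obtain ⟨δ, hδ0, hδ1, hdT⟩ := near_pt hT (hsT (right_mem_segment _ _ _)) d
  set c' := X + ε • (c - X) with hc'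
  set d' := X' + δ • (d - X') with hd'
  have yc' : yy q c' = ε * yy q c := by rw [hc', yy_line, yy_os hX]; ring
  have yd' : yy q d' = δ * yy q d := by rw [hd', yy_line, yy_os hX']; ring
  have yc0 : 0 < yy q c' := by rw [yc']; positivity
  have yd0 : yy q d' < 0 := by rw [yd']; nlinarith
  have kc : k c = k c' := by
    refine hk _ _ ⟨seg_sub hcX (left_mem_segment _ _ _) ?_, ?_⟩
    · rw [segment_symm]; exact mem_seg.2 ⟨ε, hε0.le, hε1.le, rfl⟩
    · rw [Set.disjoint_left]
      intro w hw hwq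
      obtain ⟨t, ht0, ht1, rfl⟩ := mem_seg.1 hw
      have := yy_os hwq
      rw [yy_line] at this
      linarith [pos_comb hyc yc0 ht0 ht1]
  have kd : k d = k d' := by
    refine hk _ _ ⟨seg_sub hdX (left_mem_segment _ _ _) ?_, ?_⟩
    · rw [segment_symm]; exact mem_seg.2 ⟨δ, hδ0.le, hδ1.le, rfl⟩
    · rw [Set.disjoint_left]
      intro w hw hwq
      obtain ⟨t, ht0, ht1, rfl⟩ := mem_seg.1 hw
      have := yy_os hwq
      rw [yy_line] at this
      linarith [pos_comb hyd (neg_pos.2 yd0) ht0 ht1]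
  have hcdT : segment ℝ c' d' ⊆ T := hTc.segment_subset hcT hdT
  have hs0 : 0 < yy q c' / (yy q c' - yy q d') := div_pos yc0 (by linarith)
  have hs1 : yy q c' / (yy q c' - yy q d') < 1 := by rw [div_lt_one] <;> linarith
  have hse : yy q c' / (yy q c' - yy q d') * (yy q c' - yy q d') = yy q c' := by
    have : yy q c' - yy q d' ≠ 0 := by linarith
    field_simp
  set s := yy q c' / (yy q c' - yy q d')
  set Z := c' + s • (d' - c') with hZ
  have hZT : Z ∈ T := hcdT (mem_seg.2 ⟨s, hs0.le, hs1.le, rfl⟩)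
  have hZy : yy q Z = 0 := by rw [hZ, yy_line]; linarith
  have hZq : Z ∈ os q := line_lemma hq hZy hX
    ((hTc.segment_subset hZT (hsT (left_mem_segment _ _ _))).trans hTU)
  obtain ⟨σ, hσ0, hσ1, hσ⟩ := mem_oseg.1 hZq
  have f1 : cr (c' - q.1) (d' - q.1) = σ * (yy q d' - yy q c') := by
    have : cr (c' - q.1) (d' - q.1) = cr (Z - q.1) (d' - c') := by
      rw [hZ]; simp [cr]; ring
    rw [this, hσ]; simp [cr, yy]; ring
  have f2 : cr (c' - q.2) (d' - q.2) = (σ - 1) * (yy q d' - yy q c') := by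
    have : cr (c' - q.2) (d' - q.2) = cr (Z - q.2) (d' - c') := by
      rw [hZ]; simp [cr]; ring
    rw [this, hσ]; simp [cr, yy]; ring
  have a1 := h1 _ _ (hcdT.trans hTU)
  have a2 := h2 _ _ (hcdT.trans hTU)
  have b1 : ang q.1 c' d' < 0 := ang_neg (by rw [f1]; nlinarith)
  have b2 : 0 < ang q.2 c' d' := ang_pos (by rw [f2]; nlinarith)
  have hph : ∀ z, cr (q.2 - z) (q.1 - z) = - yy q z := by intro z; simp [cr, yy]; ring
  have b3 : phi q c' < 0 := ang_neg (by rw [hph]; linarith)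
  have b4 : 0 < phi q d' := ang_pos (by rw [hph]; linarith)
  have : k c' = k d' := by rw [← kc, ← kd, hkcd]
  simp only [k] at this
  linarith

section H
variable {U : Set (ℝ × ℝ)} {q : (ℝ × ℝ) × (ℝ × ℝ)}

theorem RR_sub_HH : RR U q ⊆ HH U q := fun z hz => ⟨z, hz, .refl⟩

theorem HH_step {z w : ℝ × ℝ} (hz : z ∈ HH U q) (h : Av U q z w) : w ∈ HH U q := by
  obtain ⟨c, hc, h'⟩ := hz
  exact ⟨c, hc, h'.tail h⟩

theorem RR_not_os {z : ℝ × ℝ} (hz : z ∈ RR U q) : z ∉ os q := fun h => by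
  have := hz.1
  rw [yy_os h] at this; exact lt_irrefl _ this

theorem RR_sub {z : ℝ × ℝ} (hz : z ∈ RR U q) : z ∈ U := by
  obtain ⟨_, P, _, h⟩ := hz
  exact h (left_mem_segment _ _ _)

theorem HH_not_os {z : ℝ × ℝ} (hz : z ∈ HH U q) : z ∉ os q := by
  obtain ⟨c, hc, h⟩ := hz
  cases h with
  | refl => exact RR_not_os hc
  | tail _ h => exact Set.disjoint_left.1 h.2 (right_mem_segment _ _ _)

theorem HH_sub {z : ℝ × ℝ} (hz : z ∈ HH U q) : z ∈ U := by
  obtain ⟨c, hc, h⟩ := hz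
  cases h with
  | refl => exact RR_sub hc
  | tail _ h => exact h.1 (right_mem_segment _ _ _)

theorem HH_sees (hU : IsOpen U) (hW : W2 U) (hq : IsChord U q) {z P : ℝ × ℝ} (hz : z ∈ HH U q)
    (hP : P ∈ os q) (h : segment ℝ z P ⊆ U) : z ∈ RR U q := by
  rcases lt_trichotomy (yy q z) 0 with h0 | h0 | h0
  · obtain ⟨c, hc, h'⟩ := hz
    exact (SL hU hW hq hc ⟨by rw [yy_rev]; linarith, P, by rwa [os_rev], h⟩ h').elim
  · exact absurd (line_lemma hq h0 hP h) (HH_not_os hz)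
  · exact ⟨h0, P, hP, h⟩

theorem HH_disj_seg (hU : IsOpen U) (hW : W2 U) (hq : IsChord U q) {A B : ℝ × ℝ} (hA : A ∈ HH U q)
    (hB : B ∈ HH U q) (h : segment ℝ A B ⊆ U) : Disjoint (segment ℝ A B) (os q) := by
  rw [Set.disjoint_left]
  intro P hP hPq
  have hA' := HH_sees hU hW hq hA hPq (seg_sub h (left_mem_segment _ _ _) hP)
  have hB' := HH_sees hU hW hq hB hPq (seg_sub h (right_mem_segment _ _ _) hP)
  exact RR_not_os (L3 hW hq h hA' hB' hP) hPq

theorem Av_nhds (hU : IsOpen U) (hq : IsChord U q) {z : ℝ × ℝ} (hz : z ∈ U) (hzq : z ∉ os q) :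
    ∀ᶠ w in 𝓝 z, Av U q z w := by
  have hcs : IsClosed (segment ℝ q.1 q.2) := by
    rw [segment_eq_image_lineMap]
    exact (isCompact_Icc.image AffineMap.lineMap_continuous).isClosed
  have : U ∩ (segment ℝ q.1 q.2)ᶜ ∈ 𝓝 z :=
    (hU.inter hcs.isOpen_compl).mem_nhds ⟨hz, fun h => hzq (seg_of_os hq h hz)⟩
  obtain ⟨ε, hε, hb⟩ := Metric.mem_nhds_iff.1 this
  filter_upwards [Metric.ball_mem_nhds z hε] with w hw
  have := ((convex_ball z ε).segment_subset (Metric.mem_ball_self hε) hw).trans hb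
  refine ⟨this.trans Set.inter_subset_left, ?_⟩
  rw [Set.disjoint_left]
  exact fun x hx hxq => (this hx).2 (openSegment_subset_segment _ _ _ hxq)

theorem HH_open (hU : IsOpen U) (hq : IsChord U q) : IsOpen (HH U q) := by
  rw [isOpen_iff_mem_nhds]
  intro z hz
  filter_upwards [Av_nhds hU hq (HH_sub hz) (HH_not_os hz)] with w hw
  exact HH_step hz hw

theorem HH_rev (hU : IsOpen U) (hW : W2 U) (hq : IsChord U q) {z : ℝ × ℝ} (hz : z ∈ HH U q)
    (hz' : z ∈ HH U (rev q)) : False := by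
  obtain ⟨c, hc, h⟩ := hz
  obtain ⟨d, hd, h'⟩ := hz'
  refine SL hU hW hq hc hd (h.trans ?_)
  have e : Av U (rev q) = Av U q := by unfold Av; rw [os_rev]
  rw [e] at h'
  exact rtg_symm (fun _ _ h => Av.symm h) h'
end H

end Beer

open MeasureTheory
open scoped ENNReal
namespace Beer
open Filter Topology

def Child (U : Set (ℝ × ℝ)) (r q : (ℝ × ℝ) × (ℝ × ℝ)) : Prop :=
  IsChord U q ∧ Disjoint (os q) (RR U r) ∧ Disjoint (os q) (os r) ∧
    ∀ Y ∈ os q, ∀ᶠ Z in 𝓝 Y, yy q Z < 0 → Z ∈ RR U r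

section C
variable {U : Set (ℝ × ℝ)} {r q : (ℝ × ℝ) × (ℝ × ℝ)}

theorem near_side (hU : IsOpen U) (hW : W2 U) (hr : IsChord U r) (hq : IsChord U q)
    (hcl : ∀ Y ∈ os q, Y ∈ closure (RR U r)) {X C : ℝ × ℝ} (hX : X ∈ os q)
    (hC : yy q C < 0) (hCR : ∀ s : ℝ, 0 < s → s ≤ 1 → X + s • (C - X) ∈ RR U r)
    {Y : ℝ × ℝ} (hY : Y ∈ os q) : ∀ᶠ Z in 𝓝 Y, yy q Z < 0 → Z ∈ RR U r := by
  obtain ⟨T, hT, hTc, hsT, hTU⟩ := tube hU (((os_conv q).segment_subset hX hY).trans hq.2.2)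
  obtain ⟨ε, hε0, hε1, hcT⟩ := near_pt hT (hsT (left_mem_segment _ _ _)) C
  have hc1 := hCR ε hε0 hε1.le
  have hyc : yy q (X + ε • (C - X)) < 0 := by
    rw [yy_line, yy_os hX]; nlinarith
  set C' := X + ε • (C - X)
  have hYT : Y ∈ T := hsT (right_mem_segment _ _ _)
  let g : ℝ × ℝ → ℝ × ℝ := fun Z => C' + (yy q C' / (yy q C' - yy q Z)) • (Z - C')
  have hgY : g Y = Y := by
    simp only [g, yy_os hY, sub_zero, div_self hyc.ne]
    simp
  have hgc : ContinuousAt g Y := by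
    have : yy q C' - yy q Y ≠ 0 := by rw [yy_os hY]; linarith
    have h1 : ContinuousAt (yy q) Y := (continuous_yy q).continuousAt
    simp only [g]
    exact continuousAt_const.add
      (((continuousAt_const).div (continuousAt_const.sub h1) this).smul (continuousAt_id.sub continuousAt_const))
  have e1 : ∀ᶠ Z in 𝓝 Y, g Z ∈ T := hgc.eventually (by rw [hgY]; exact hT.mem_nhds hYT)
  have e2 : ∀ᶠ Z in 𝓝 Y, yy q C' < yy q Z :=
    ((continuous_yy q).tendsto Y).eventually (lt_mem_nhds (by rw [yy_os hY]; exact hyc))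
  filter_upwards [e1, e2] with Z h1 h2 h3
  have hd : 0 < yy q Z - yy q C' := by linarith
  have hyg : yy q (g Z) = 0 := by
    simp only [g]; rw [yy_line]
    have : yy q C' - yy q Z ≠ 0 := by linarith
    field_simp; ring
  have hgq : g Z ∈ os q := line_lemma hq hyg hY ((hTc.segment_subset h1 hYT).trans hTU)
  have hgcl : g Z ∈ closure (RR U r ∩ T) := by
    rw [Set.inter_comm]
    exact hT.inter_closure ⟨h1, hcl _ hgq⟩
  have hop : IsOpen (RR U r ∩ T) := (RR_open hU r).inter hT
  have := (RT_convex hW hr hTc hTU).openSegment_interior_closure_subset_interior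
    (x := C') (y := g Z) (by rw [hop.interior_eq]; exact ⟨hc1, hcT⟩) hgcl
  refine (interior_subset (this (mem_oseg.2 ⟨(yy q C' - yy q Z) / yy q C', ?_, ?_, ?_⟩))).1
  · exact div_pos_of_neg_of_neg (by linarith) hyc
  · rw [div_lt_one_of_neg hyc]; linarith
  · have h4 : yy q C' - yy q Z ≠ 0 := by linarith
    have h5 := hyc.ne
    simp only [g]
    ext <;> simp <;> field_simp <;> ring

theorem frontier_line (hU : IsOpen U) (hW : W2 U) (hr : IsChord U r) {X C : ℝ × ℝ}
    (hX : X ∈ U) (hXR : X ∉ RR U r) (hXr : X ∉ os r)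
    (hCR : ∀ s : ℝ, 0 < s → s ≤ 1 → X + s • (C - X) ∈ RR U r) :
    ∃ (s : ℕ → ℝ) (Q : ℕ → ℝ × ℝ) (P : ℝ × ℝ), (∀ k, 0 < s k ∧ s k ≤ 1) ∧
      Tendsto s atTop (𝓝 0) ∧ Tendsto Q atTop (𝓝 P) ∧
      (∀ k, Q k ∈ os r ∧ segment ℝ (X + s k • (C - X)) (Q k) ⊆ U) ∧ P ≠ X ∧
      ∀ Y, segment ℝ X Y ⊆ U → cr (Y - P) (X - P) = 0 → Y ∈ closure (RR U r) ∧ Y ∉ RR U r := by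
  let s0 : ℕ → ℝ := fun k => 1 / ((k : ℝ) + 1)
  have hs0 : ∀ k, 0 < s0 k ∧ s0 k ≤ 1 := fun k => ⟨by positivity, by
    simp only [s0]; rw [div_le_one (by positivity)]; linarith [k.cast_nonneg (α := ℝ)]⟩
  have hs0t : Tendsto s0 atTop (𝓝 0) := tendsto_one_div_add_atTop_nhds_zero_nat
  have hex : ∀ k, ∃ Q, Q ∈ os r ∧ segment ℝ (X + s0 k • (C - X)) Q ⊆ U := by
    intro k
    obtain ⟨_, Q, h1, h2⟩ := hCR _ (hs0 k).1 (hs0 k).2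
    exact ⟨Q, h1, h2⟩
  choose Q0 hQ0 using hex
  have hcs : IsCompact (segment ℝ r.1 r.2) := by
    rw [segment_eq_image_lineMap]
    exact (isCompact_Icc.image AffineMap.lineMap_continuous)
  obtain ⟨P, -, φ, hφ, hP⟩ := hcs.tendsto_subseq
    (fun k => openSegment_subset_segment _ _ _ (hQ0 k).1)
  have ht : Tendsto (s0 ∘ φ) atTop (𝓝 0) := hs0t.comp hφ.tendsto_atTop
  have hC : Tendsto (fun k => X + (s0 ∘ φ) k • (C - X)) atTop (𝓝 X) := by
    have := (ht.smul_const (C - X)).const_add X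
    simpa using this
  refine ⟨s0 ∘ φ, Q0 ∘ φ, P, fun k => hs0 _, ht, hP, fun k => hQ0 _, ?_⟩
  exact L4 hU hW hr hX hXR hXr hC hP (fun k => hCR _ (hs0 _).1 (hs0 _).2)
    (fun k => (hQ0 _).1) (fun k => (hQ0 _).2)

theorem L6 (hU : IsOpen U) (hb : Bornology.IsBounded U) (hW : W2 U) (hr : IsChord U r) {C B : ℝ × ℝ}
    (hC : C ∈ RR U r) (hCB : Av U r C B) (hB : B ∉ RR U r) :
    ∃ q, Child U r q ∧ (B ∈ os q ∨ B ∈ RR U q) := by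
  let f : ℝ → ℝ × ℝ := fun t => C + t • (B - C)
  have hf : Continuous f := by fun_prop
  let D : Set ℝ := Set.Icc 0 1 ∩ f ⁻¹' (RR U r)ᶜ
  have hD : IsClosed D := isClosed_Icc.inter ((RR_open hU r).isClosed_compl.preimage hf)
  have hDne : D.Nonempty := ⟨1, ⟨by norm_num, le_rfl⟩, by simpa [f] using hB⟩
  have hDb : BddBelow D := ⟨0, fun t ht => ht.1.1⟩
  have hm := hD.csInf_mem hDne hDb
  set t0 := sInf D with ht0
  have hlt : ∀ t, 0 ≤ t → t < t0 → f t ∈ RR U r := by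
    intro t h1 h2
    by_contra h
    exact absurd (csInf_le hDb (⟨⟨h1, by linarith [hm.1.2]⟩, h⟩ : t ∈ D)) (not_le.2 h2)
  have ht0p : 0 < t0 := by
    refine lt_of_le_of_ne hm.1.1 fun h => ?_
    have := hm.2; rw [← h] at this; simp [f] at this; exact this hC
  set X := f t0 with hXd
  have hXs : X ∈ segment ℝ C B := mem_seg.2 ⟨t0, hm.1.1, hm.1.2, rfl⟩
  have hXU : X ∈ U := hCB.1 hXs
  have hXr : X ∉ os r := Set.disjoint_left.1 hCB.2 hXs
  have hXR : X ∉ RR U r := hm.2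
  have hCR : ∀ s : ℝ, 0 < s → s ≤ 1 → X + s • (C - X) ∈ RR U r := by
    intro s h1 h2
    have := hlt (t0 * (1 - s)) (mul_nonneg hm.1.1 (by linarith)) (by nlinarith)
    convert this using 1
    simp only [X, f]; ext <;> simp <;> ring
  obtain ⟨s, Q, P, hs, hst, hQ, hQr, hPX, hL⟩ := frontier_line hU hW hr hXU hXR hXr hCR
  have hyX : 0 ≤ yy r X := by
    have : Tendsto (fun k => yy r (X + s k • (C - X))) atTop (𝓝 (yy r X)) := by
      have h1 := (hst.smul_const (C - X)).const_add X
      simp only [zero_smul, add_zero] at h1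
      exact ((continuous_yy r).tendsto X).comp h1
    exact ge_of_tendsto' this fun k => (hCR _ (hs k).1 (hs k).2).1.le
  obtain ⟨q0, hq0, hXq0, l, hl, hql⟩ := chord_exists hU hb hXU (sub_ne_zero.2 hPX.symm)
  have hyC0 : yy q0 C ≠ 0 := by
    intro h0
    obtain ⟨σ, -, -, hσ⟩ := mem_oseg.1 hXq0
    have : yy q0 C = l * cr (X - P) (C - X) := by
      have e : yy q0 C = cr (q0.2 - q0.1) (C - X) := by
        rw [hσ]; simp [yy, cr]; ring
      rw [e, hql]; simp [cr]; ring
    rw [this] at h0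
    have h1 : cr (X - P) (C - X) = 0 := by
      rcases mul_eq_zero.1 h0 with h | h
      · linarith
      · exact h
    exact (hL C (seg_sub hCB.1 hXs (left_mem_segment _ _ _)) (by
      have : cr (C - P) (X - P) = - cr (X - P) (C - X) := by simp [cr]; ring
      rw [this, h1, neg_zero])).2 hC
  have hcol0 : ∀ Y ∈ os q0, cr (Y - P) (X - P) = 0 := by
    intro Y hY
    obtain ⟨σ, -, -, hσ⟩ := mem_oseg.1 hXq0
    obtain ⟨τ, -, -, hτ⟩ := mem_oseg.1 hY
    have : Y = X + (τ - σ) • (q0.2 - q0.1) := by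
      rw [hσ, hτ]; ext <;> simp <;> ring
    rw [this, hql]
    simp [cr]; ring
  obtain ⟨q, hq, hXq, hyC, hcol⟩ : ∃ q, IsChord U q ∧ X ∈ os q ∧ yy q C < 0 ∧
      ∀ Y ∈ os q, cr (Y - P) (X - P) = 0 := by
    rcases lt_or_gt_of_ne hyC0 with h | h
    · exact ⟨q0, hq0, hXq0, h, hcol0⟩
    · exact ⟨rev q0, hq0.rev, by rwa [os_rev], by rw [yy_rev]; linarith, by rwa [os_rev]⟩
  have hXY : ∀ Y ∈ os q, segment ℝ X Y ⊆ U := fun Y hY =>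
    ((os_conv q).segment_subset hXq hY).trans hq.2.2
  refine ⟨q, ⟨hq, ?_, ?_, ?_⟩, ?_⟩
  · exact Set.disjoint_left.2 fun Y hY => (hL Y (hXY Y hY) (hcol Y hY)).2
  · refine Set.disjoint_left.2 fun Y hY hYr => ?_
    rcases hyX.lt_or_eq with h | h
    · exact hXR ⟨h, Y, hYr, hXY Y hY⟩
    · exact hXr (line_lemma hr h.symm hYr (hXY Y hY))
  · intro Y hY
    exact near_side hU hW hr hq (fun Y hY => (hL Y (hXY Y hY) (hcol Y hY)).1) hXq hyC hCR hY
  · rcases hm.1.2.lt_or_eq with h | h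
    · right
      refine ⟨?_, X, hXq, seg_sub hCB.1 (right_mem_segment _ _ _) hXs⟩
      have := yy_os hXq
      simp only [X, f] at this
      rw [yy_line] at this
      nlinarith
    · left
      have : X = B := by simp [X, f, h]
      rwa [this] at hXq

end C
end Beer

open MeasureTheory
open scoped ENNReal
namespace Beer
open Filter Topology

section C
variable {U : Set (ℝ × ℝ)} {r q : (ℝ × ℝ) × (ℝ × ℝ)}

theorem os_nonempty (q : (ℝ × ℝ) × (ℝ × ℝ)) : ∃ Y, Y ∈ os q :=
  ⟨q.1 + (1/2 : ℝ) • (q.2 - q.1), mem_oseg.2 ⟨1/2, by norm_num, by norm_num, rfl⟩⟩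

/-- points just off the chord, on the chosen side -/
theorem off_pt (hq : IsChord U q) {Y : ℝ × ℝ} (hY : Y ∈ os q) {p : ℝ × ℝ → Prop}
    (hp : ∀ᶠ Z in 𝓝 Y, p Z) : (∃ Z, p Z ∧ yy q Z < 0) ∧ (∃ Z, p Z ∧ 0 < yy q Z) := by
  let d : ℝ × ℝ := (-(q.2 - q.1).2, (q.2 - q.1).1)
  have hd : 0 < cr (q.2 - q.1) d := by
    have h1 := hq.ne
    simp only [cr, d]
    by_contra hc
    apply h1
    have hz := (add_eq_zero_iff_of_nonneg (mul_self_nonneg (q.2 - q.1).1) (mul_self_nonneg (q.2 - q.1).2)).1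
      (by nlinarith [mul_self_nonneg (q.2 - q.1).1, mul_self_nonneg (q.2 - q.1).2])
    simp at hz
    ext <;> linarith
  have hy : ∀ t : ℝ, yy q (Y + t • d) = t * cr (q.2 - q.1) d := by
    intro t
    have : yy q (Y + t • d) = yy q Y + t * cr (q.2 - q.1) d := by simp [yy, cr]; ring
    rw [this, yy_os hY, zero_add]
  have ht : Tendsto (fun t : ℝ => Y + t • d) (𝓝 0) (𝓝 Y) := by
    have h : Continuous (fun t : ℝ => Y + t • d) := by fun_prop
    have := h.tendsto 0
    simpa using this
  constructor
  · obtain ⟨t, h1, h2⟩ := (((ht.mono_left nhdsWithin_le_nhds).eventually hp).and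
      (self_mem_nhdsWithin : Set.Iio (0 : ℝ) ∈ 𝓝[<] 0)).exists
    exact ⟨_, h1, by rw [hy]; exact mul_neg_of_neg_of_pos h2 hd⟩
  · obtain ⟨t, h1, h2⟩ := (((ht.mono_left nhdsWithin_le_nhds).eventually hp).and
      (self_mem_nhdsWithin : Set.Ioi (0 : ℝ) ∈ 𝓝[>] 0)).exists
    exact ⟨_, h1, by rw [hy]; exact mul_pos h2 hd⟩

theorem vis_nhds (hU : IsOpen U) {Y : ℝ × ℝ} (hY : Y ∈ U) : ∀ᶠ Z in 𝓝 Y, segment ℝ Z Y ⊆ U := by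
  obtain ⟨ε, hε, hb⟩ := Metric.mem_nhds_iff.1 (hU.mem_nhds hY)
  filter_upwards [Metric.ball_mem_nhds Y hε] with w hw
  exact ((convex_ball Y ε).segment_subset hw (Metric.mem_ball_self hε)).trans hb

theorem RR_seg {z P w : ℝ × ℝ} (hz : 0 < yy r z) (hP : P ∈ os r) (h : segment ℝ z P ⊆ U)
    (hw : w ∈ segment ℝ z P) : w ∈ RR U r ∪ os r := by
  obtain ⟨t, h0, h1, rfl⟩ := mem_seg.1 hw
  rcases h1.lt_or_eq with h2 | h2
  · left
    refine ⟨by rw [yy_line, yy_os hP]; nlinarith, P, hP, seg_sub h hw (right_mem_segment _ _ _)⟩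
  · right; subst h2; simpa using hP

theorem child_back (hU : IsOpen U) (hr : IsChord U r) (hc : Child U r q) :
    RR U r ∪ os r ⊆ HH U (rev q) := by
  obtain ⟨hq, h1, h2, h3⟩ := hc
  obtain ⟨Y, hY⟩ := os_nonempty q
  obtain ⟨⟨Z, ⟨hZ1, hZ2⟩, hZ3⟩, -⟩ := off_pt hq hY ((h3 Y hY).and (vis_nhds hU (hq.2.2 hY)))
  have hZR := hZ1 hZ3
  have hZH : Z ∈ HH U (rev q) := RR_sub_HH ⟨by rw [yy_rev]; linarith, Y, by rwa [os_rev], hZ2⟩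
  have hdis : ∀ w ∈ RR U r ∪ os r, w ∉ os (rev q) := by
    intro w hw hwq
    rw [os_rev] at hwq
    rcases hw with hw | hw
    · exact Set.disjoint_left.1 h1 hwq hw
    · exact Set.disjoint_left.1 h2 hwq hw
  have hstep : ∀ z P, 0 < yy r z → P ∈ os r → segment ℝ z P ⊆ U → Av U (rev q) z P := by
    intro z P hz hP h
    exact ⟨h, Set.disjoint_left.2 fun w hw => hdis w (RR_seg hz hP h hw)⟩
  obtain ⟨hZy, P', hP', hZP⟩ := hZR
  have hP'H : P' ∈ HH U (rev q) := HH_step hZH (hstep _ _ hZy hP' hZP)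
  have hosH : ∀ P ∈ os r, P ∈ HH U (rev q) := by
    intro P hP
    have hs := (os_conv r).segment_subset hP' hP
    exact HH_step hP'H ⟨hs.trans hr.2.2, Set.disjoint_left.2 fun w hw => hdis w (Or.inr (hs hw))⟩
  rintro z (hz | hz)
  · obtain ⟨hy, P, hP, h⟩ := hz
    exact HH_step (hosH P hP) (hstep _ _ hy hP h).symm
  · exact hosH z hz

theorem child_HH_RR (hU : IsOpen U) (hW : W2 U) (hr : IsChord U r) (hc : Child U r q) {z : ℝ × ℝ}
    (hz : z ∈ HH U q) (h : z ∈ RR U r ∪ os r) : False :=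
  HH_rev hU hW hc.1 hz (child_back hU hr hc h)

theorem child_os_HH (hU : IsOpen U) (hr : IsChord U r) (hc : Child U r q) : os q ⊆ HH U r := by
  intro Y hY
  obtain ⟨⟨Z, ⟨hZ1, hZ2⟩, hZ3⟩, -⟩ := off_pt hc.1 hY ((hc.2.2.2 Y hY).and
    (Av_nhds hU hr (hc.1.2.2 hY) (Set.disjoint_left.1 hc.2.2.1 hY)))
  exact HH_step (RR_sub_HH (hZ1 hZ3)) hZ2.symm

theorem Av_mem {a b w : ℝ × ℝ} (h : Av U q a b) (hw : w ∈ segment ℝ a b) : Av U q a w := by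
  have := (convex_segment a b).segment_subset (left_mem_segment _ _ _) hw
  exact ⟨this.trans h.1, h.2.mono_left this⟩

theorem HH_transfer {p : (ℝ × ℝ) × (ℝ × ℝ)} (hd : ∀ z ∈ HH U q, z ∉ os p) {c z : ℝ × ℝ}
    (hcq : c ∈ HH U q) (hcp : c ∈ HH U p)
    (h : Relation.ReflTransGen (Av U q) c z) : z ∈ HH U p := by
  have : z ∈ HH U q ∧ z ∈ HH U p := by
    induction h with
    | refl => exact ⟨hcq, hcp⟩
    | tail _ h ih =>
      refine ⟨HH_step ih.1 h, HH_step ih.2 ⟨h.1, ?_⟩⟩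
      exact Set.disjoint_left.2 fun w hw => hd w (HH_step ih.1 (Av_mem h hw))
  exact this.2

theorem child_HH (hU : IsOpen U) (hW : W2 U) (hr : IsChord U r) (hc : Child U r q) :
    HH U q ⊆ HH U r := by
  intro z hz
  obtain ⟨c, hcR, h⟩ := hz
  have hd : ∀ z ∈ HH U q, z ∉ os r := fun z hz hz' => child_HH_RR hU hW hr hc hz (Or.inr hz')
  refine HH_transfer hd (RR_sub_HH hcR) ?_ h
  obtain ⟨hy, X, hX, hcX⟩ := hcR
  have : Av U r c X := by
    refine ⟨hcX, Set.disjoint_left.2 fun w hw => ?_⟩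
    rcases RR_seg hy hX hcX hw with h | h
    · exact hd w (RR_sub_HH h)
    · exact Set.disjoint_left.1 hc.2.2.1 h
  exact HH_step (child_os_HH hU hr hc hX) this.symm

theorem cross_child (hU : IsOpen U) (hc : Child U r q)
    {X w : ℝ × ℝ} (hX : X ∈ os q) (hXw : segment ℝ X w ⊆ U) (hw : yy q w < 0) :
    ∃ Z ∈ segment ℝ X w, Z ∈ RR U r := by
  have := hc.2.2.2 X hX
  obtain ⟨T, hTs, hT, hXT⟩ := mem_nhds_iff.1 this
  obtain ⟨ε, h0, h1, h2⟩ := near_pt hT hXT w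
  refine ⟨_, mem_seg.2 ⟨ε, h0.le, h1.le, rfl⟩, hTs h2 ?_⟩
  rw [yy_line, yy_os hX]; nlinarith

theorem step_lemma (hU : IsOpen U) (hb : Bornology.IsBounded U) (hW : W2 U) (hr : IsChord U r)
    {z : ℝ × ℝ} (hz : z ∈ HH U r) :
    z ∈ RR U r ∨ ∃ q, Child U r q ∧ (z ∈ os q ∨ z ∈ HH U q) := by
  obtain ⟨c, hcR, h⟩ := hz
  have key : ∀ {z w}, z ∈ RR U r → Av U r z w →
      w ∈ RR U r ∨ ∃ q, Child U r q ∧ (w ∈ os q ∨ w ∈ HH U q) := by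
    intro z w hz h
    by_cases hw : w ∈ RR U r
    · exact Or.inl hw
    · obtain ⟨q, hq, h'⟩ := L6 hU hb hW hr hz h hw
      exact Or.inr ⟨q, hq, h'.imp id fun h => RR_sub_HH h⟩
  induction h with
  | refl => exact Or.inl hcR
  | @tail z w _ h ih =>
    rcases ih with hz | ⟨q, hq, hz⟩
    · exact key hz h
    · by_cases hd : Disjoint (segment ℝ z w) (os q)
      · rcases hz with hz | hz
        · exact (Set.disjoint_left.1 hd (left_mem_segment _ _ _) hz).elim
        · exact Or.inr ⟨q, hq, Or.inr (HH_step hz ⟨h.1, hd⟩)⟩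
      · obtain ⟨X, hXs, hXq⟩ := Set.not_disjoint_iff.1 hd
        have hXw : segment ℝ X w ⊆ U := seg_sub h.1 hXs (right_mem_segment _ _ _)
        rcases lt_trichotomy (yy q w) 0 with h0 | h0 | h0
        · obtain ⟨Z, hZs, hZR⟩ := cross_child hU hq hXq hXw h0
          refine key hZR ?_
          have hsub : segment ℝ Z w ⊆ segment ℝ z w :=
            (convex_segment z w).segment_subset
              ((convex_segment z w).segment_subset hXs (right_mem_segment _ _ _) hZs)
              (right_mem_segment _ _ _)
          exact ⟨hsub.trans h.1, h.2.mono_left hsub⟩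
        · exact Or.inr ⟨q, hq, Or.inl (line_lemma hq.1 h0 hXq (seg_symm hXw))⟩
        · exact Or.inr ⟨q, hq, Or.inr (RR_sub_HH ⟨h0, X, hXq, seg_symm hXw⟩)⟩

theorem chord_param {q' : (ℝ × ℝ) × (ℝ × ℝ)} (hq : IsChord U q) (hq' : IsChord U q')
    {Y : ℝ × ℝ} (hY : Y ∈ os q) (hY' : Y ∈ os q') (h1 : yy q q'.1 = 0) (h2 : yy q q'.2 = 0) :
    q' = q ∨ q' = rev q := by
  have hsub : os q' ⊆ os q := by
    intro z hz
    refine line_lemma hq ?_ hY (((os_conv q').segment_subset hz hY').trans hq'.2.2)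
    obtain ⟨t, -, -, rfl⟩ := mem_oseg.1 hz
    rw [yy_line, h1, h2]; ring
  have hcl : ∀ p : (ℝ × ℝ) × (ℝ × ℝ), p.1 ∈ closure (os p) ∧ p.2 ∈ closure (os p) := by
    intro p
    rw [os, closure_openSegment]
    exact ⟨left_mem_segment _ _ _, right_mem_segment _ _ _⟩
  have hm := closure_mono hsub
  have hend : ∀ x, x ∈ segment ℝ q.1 q.2 → x ∉ U → x = q.1 ∨ x = q.2 := by
    intro x hx hxU
    by_contra h
    push Not at h
    apply hxU
    apply hq.2.2
    obtain ⟨t, h0, h1, rfl⟩ := mem_seg.1 hx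
    refine mem_oseg.2 ⟨t, lt_of_le_of_ne h0 ?_, lt_of_le_of_ne h1 ?_, rfl⟩
    · rintro rfl; simp at h
    · rintro rfl; simp at h
  have a1 := hm (hcl q').1
  have a2 := hm (hcl q').2
  rw [show closure (os q) = segment ℝ q.1 q.2 from closure_openSegment _ _] at a1 a2
  have hne := hq'.ne
  rcases hend _ a1 hq'.1 with e1 | e1 <;> rcases hend _ a2 hq'.2.1 with e2 | e2
  · exact absurd (e1.trans e2.symm) hne
  · left; exact Prod.ext e1 e2
  · right; exact Prod.ext e1 e2
  · exact absurd (e1.trans e2.symm) hne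

theorem sibling (hU : IsOpen U) (hW : W2 U) (hr : IsChord U r) {q' : (ℝ × ℝ) × (ℝ × ℝ)}
    (hc : Child U r q) (hc' : Child U r q') {z : ℝ × ℝ} (hz : z ∈ HH U q) (hz' : z ∈ HH U q') :
    q = q' := by
  by_cases hd : Disjoint (os q) (os q')
  · exfalso
    have aux : ∀ q q', Child U r q → Child U r q' → Disjoint (os q) (os q') →
        ∀ w ∈ HH U q, w ∉ os q' := by
      intro q q' hc hc' hd w hw hw'
      obtain ⟨⟨Z, ⟨hZ1, hZ2⟩, hZ3⟩, -⟩ := off_pt hc'.1 hw' ((hc'.2.2.2 w hw').and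
        (Av_nhds hU hc.1.rev (hc'.1.2.2 hw') (by
          rw [os_rev]; exact fun h => Set.disjoint_left.1 hd h hw')))
      exact HH_rev hU hW hc.1 hw (HH_step (child_back hU hr hc (Or.inl (hZ1 hZ3))) hZ2.symm)
    have hd1 := aux q q' hc hc' hd
    have hd2 := aux q' q hc' hc hd.symm
    have hsub : HH U q ⊆ HH U q' := by
      intro w hw
      obtain ⟨c, hcR, h⟩ := hz
      obtain ⟨c', hcR', h'⟩ := hw
      have hcc : c ∈ HH U q' := HH_transfer hd1 ⟨c, hcR, h⟩ hz' (rtg_symm (fun _ _ h => Av.symm h) h)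
      obtain ⟨hy, X, hX, hcX⟩ := hcR
      obtain ⟨hy', X', hX', hcX'⟩ := hcR'
      have hXav : ∀ c X, 0 < yy q c → X ∈ os q → segment ℝ c X ⊆ U → Av U q' c X := by
        intro c X hy hX hcX
        refine ⟨hcX, Set.disjoint_left.2 fun w hw => ?_⟩
        rcases RR_seg hy hX hcX hw with h | h
        · exact hd1 w (RR_sub_HH h)
        · exact Set.disjoint_left.1 hd h
      have h1 : X ∈ HH U q' := HH_step hcc (hXav _ _ hy hX hcX)
      exact (hd2 X h1 hX).elim
    obtain ⟨Y, hY⟩ := os_nonempty q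
    obtain ⟨-, ⟨Z, ⟨hZ1, hZ2⟩, hZ3⟩⟩ := off_pt hc.1 hY ((vis_nhds hU (hc.1.2.2 hY)).and
        (Av_nhds hU hc'.1 (hc.1.2.2 hY) (Set.disjoint_left.1 hd hY)))
    have : Z ∈ HH U q' := hsub (RR_sub_HH ⟨hZ3, Y, hY, hZ1⟩)
    exact hd2 Y (HH_step this hZ2.symm) hY
  · obtain ⟨Y, hY, hY'⟩ := Set.not_disjoint_iff.1 hd
    have hno : ∀ Z ∈ os q', ¬ yy q Z < 0 := by
      intro Z hZ h0
      obtain ⟨W, hWs, hWR⟩ := cross_child hU hc hY (((os_conv q').segment_subset hY' hZ).trans hc'.1.2.2) h0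
      exact Set.disjoint_left.1 hc'.2.1 ((os_conv q').segment_subset hY' hZ hWs) hWR
    have hdir : yy q q'.1 = 0 ∧ yy q q'.2 = 0 := by
      obtain ⟨t, h0, h1, hYt⟩ := mem_oseg.1 hY'
      have e := yy_os hY
      rw [hYt, yy_line] at e
      have c1 := hno (q'.1 + (t/2) • (q'.2 - q'.1)) (mem_oseg.2 ⟨_, by linarith, by linarith, rfl⟩)
      have c2 := hno (q'.1 + ((1+t)/2) • (q'.2 - q'.1)) (mem_oseg.2 ⟨_, by linarith, by linarith, rfl⟩)
      rw [yy_line] at c1 c2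
      have : yy q q'.2 - yy q q'.1 = 0 := by
        apply le_antisymm
        · by_contra h; apply c1; nlinarith
        · by_contra h; apply c2; nlinarith
      rw [this] at e
      constructor <;> linarith
    rcases chord_param hc.1 hc'.1 hY hY' hdir.1 hdir.2 with h | h
    · exact h.symm
    · rw [h] at hz'
      exact (HH_rev hU hW hc.1 hz hz').elim

end C
end Beer

open MeasureTheory
open scoped ENNReal
namespace Beer
open Filter Topology

def Lk (U : Set (ℝ × ℝ)) (r : (ℝ × ℝ) × (ℝ × ℝ)) : ℕ → Set (ℝ × ℝ)
  | 0 => os r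
  | k + 1 => {z | ∃ w ∈ Lk U r k, segment ℝ z w ⊆ U}

def TT (U : Set (ℝ × ℝ)) (l : (ℝ × ℝ) × (ℝ × ℝ)) : ℕ → Set ((ℝ × ℝ) × (ℝ × ℝ))
  | 0 => {l, rev l}
  | n + 1 => {q | ∃ r ∈ TT U l n, Child U r q}

def E1 (U : Set (ℝ × ℝ)) (q : (ℝ × ℝ) × (ℝ × ℝ)) (B A : ℝ × ℝ) : Prop :=
  segment ℝ B A ⊆ U ∧ B ∈ RR U q ∧ A ∉ HH U q ∧ -3 * yy q B ≤ yy q A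
def E2 (U : Set (ℝ × ℝ)) (r : (ℝ × ℝ) × (ℝ × ℝ)) (B A : ℝ × ℝ) : Prop :=
  segment ℝ B A ⊆ U ∧ B ∈ RR U r ∧ A + (1/4 : ℝ) • (B - A) ∈ RR U r ∧ yy r A ≤ yy r B
def E3 (U : Set (ℝ × ℝ)) (r q : (ℝ × ℝ) × (ℝ × ℝ)) (B A : ℝ × ℝ) : Prop :=
  segment ℝ B A ⊆ U ∧ B ∈ RR U q ∧ A + (1/4 : ℝ) • (B - A) ∈ RR U r ∧
    B + (1/4 : ℝ) • (A - B) ∈ RR U r ∧ yy r A ≤ yy r B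

def Ch (U : Set (ℝ × ℝ)) (l : (ℝ × ℝ) × (ℝ × ℝ)) (B A : ℝ × ℝ) : Prop :=
  ∃ n, ∃ q ∈ TT U l n, E1 U q B A ∨ E2 U q B A ∨ ∃ q', Child U q q' ∧ E3 U q q' B A

section C
variable {U : Set (ℝ × ℝ)} {r q l : (ℝ × ℝ) × (ℝ × ℝ)}

theorem Lk_sub (hr : IsChord U r) : ∀ k, Lk U r k ⊆ U
  | 0 => hr.2.2
  | k + 1 => by rintro z ⟨w, _, h⟩; exact h (left_mem_segment _ _ _)

theorem Lk_succ (hr : IsChord U r) (k : ℕ) : Lk U r k ⊆ Lk U r (k + 1) := fun z hz =>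
  ⟨z, hz, by simpa using Lk_sub hr k hz⟩

theorem Lk_mono (hr : IsChord U r) (k : ℕ) : Lk U r 0 ⊆ Lk U r k := by
  induction k with
  | zero => exact subset_rfl
  | succ k ih => exact ih.trans (Lk_succ hr k)

theorem Lk_one (hr : IsChord U r) (k : ℕ) : Lk U r 1 ⊆ Lk U r (k + 1) := by
  induction k with
  | zero => exact subset_rfl
  | succ k ih => exact ih.trans (Lk_succ hr (k + 1))

theorem Lk_child (hU : IsOpen U) (hW : W2 U) (hr : IsChord U r) (hc : Child U r q) (k : ℕ) :
    ∀ z, (z ∈ os q ∨ z ∈ HH U q) → z ∈ Lk U r (k + 1) → z ∈ Lk U q k := by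
  induction k with
  | zero =>
    rintro z hz ⟨P, hP, h⟩
    rcases hz with hz | hz
    · exact hz
    · exact (child_HH_RR hU hW hr hc hz
        (Or.inl (HH_sees hU hW hr (child_HH hU hW hr hc hz) hP h))).elim
  | succ k ih =>
    rintro z hz ⟨w, hw, h⟩
    rcases hz with hz | hz
    · exact Lk_mono hc.1 _ hz
    · by_cases hwq : w ∈ os q ∨ w ∈ HH U q
      · exact ⟨w, ih w hwq hw, h⟩
      · push Not at hwq
        have : ¬ Disjoint (segment ℝ z w) (os q) := fun hd => hwq.2 (HH_step hz ⟨h, hd⟩)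
        obtain ⟨X, hXs, hXq⟩ := Set.not_disjoint_iff.1 this
        exact Lk_one hc.1 _ ⟨X, hXq, seg_sub h (left_mem_segment _ _ _) hXs⟩

theorem TT_chord (hl : IsChord U l) : ∀ n, ∀ q ∈ TT U l n, IsChord U q
  | 0 => by
    rintro q (rfl | rfl)
    · exact hl
    · exact hl.rev
  | n + 1 => by rintro q ⟨r, _, h⟩; exact h.1

theorem TT_uniq (hU : IsOpen U) (hW : W2 U) (hl : IsChord U l) : ∀ n, ∀ q ∈ TT U l n,
    ∀ q' ∈ TT U l n, ∀ z, z ∈ HH U q → z ∈ HH U q' → q = q'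
  | 0 => by
    rintro q (rfl | rfl) q' (rfl | rfl) z h1 h2
    · rfl
    · exact (HH_rev hU hW hl h1 h2).elim
    · exact (HH_rev hU hW hl h2 h1).elim
    · rfl
  | n + 1 => by
    rintro q ⟨r, hr, hc⟩ q' ⟨r', hr', hc'⟩ z h1 h2
    have hrc := TT_chord hl n r hr
    have hrc' := TT_chord hl n r' hr'
    have : r = r' := TT_uniq hU hW hl n r hr r' hr' z (child_HH hU hW hrc hc h1)
      (child_HH hU hW hrc' hc' h2)
    subst this
    exact sibling hU hW hrc hc hc' h1 h2

theorem TT_anc (hU : IsOpen U) (hW : W2 U) (hl : IsChord U l) (n k : ℕ) :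
    ∀ q ∈ TT U l (n + k + 1), ∃ p ∈ TT U l n, HH U q ⊆ HH U p ∧ ∀ z ∈ HH U q, z ∉ RR U p := by
  induction k with
  | zero =>
    rintro q ⟨p, hp, hc⟩
    have hpc := TT_chord hl n p hp
    exact ⟨p, hp, child_HH hU hW hpc hc, fun z hz hz' => child_HH_RR hU hW hpc hc hz (Or.inl hz')⟩
  | succ k ih =>
    rintro q ⟨p', hp', hc⟩
    obtain ⟨p, hp, h1, h2⟩ := ih p' hp'
    have hs := child_HH hU hW (TT_chord hl _ p' hp') hc
    exact ⟨p, hp, hs.trans h1, fun z hz => h2 z (hs hz)⟩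

theorem TT_level (hU : IsOpen U) (hW : W2 U) (hl : IsChord U l) {n n' : ℕ} {q q'}
    (hq : q ∈ TT U l n) (hq' : q' ∈ TT U l n') {z} (h : z ∈ RR U q) (h' : z ∈ RR U q') : n = n' := by
  wlog hlt : n < n' generalizing n n' q q'
  · rcases lt_trichotomy n n' with h1 | h1 | h1
    · exact this hq hq' h h' h1
    · exact h1
    · exact (this hq' hq h' h h1).symm
  exfalso
  obtain ⟨k, rfl⟩ := Nat.exists_eq_add_of_lt hlt
  obtain ⟨p, hp, h1, h2⟩ := TT_anc hU hW hl n k q' hq'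
  have : q = p := TT_uniq hU hW hl n q hq p hp z (RR_sub_HH h) (h1 (RR_sub_HH h'))
  subst this
  exact h2 z (RR_sub_HH h') h

theorem TT_eq (hU : IsOpen U) (hW : W2 U) (hl : IsChord U l) {n n' : ℕ} {q q'}
    (hq : q ∈ TT U l n) (hq' : q' ∈ TT U l n') {z} (h : z ∈ RR U q) (h' : z ∈ RR U q') : q = q' := by
  have := TT_level hU hW hl hq hq' h h'
  subst this
  exact TT_uniq hU hW hl n q hq q' hq' z (RR_sub_HH h) (RR_sub_HH h')

theorem TT_parent (hU : IsOpen U) (hW : W2 U) (hl : IsChord U l) {n n' : ℕ} {r r' q}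
    (hr : r ∈ TT U l n) (hr' : r' ∈ TT U l n') (hc : Child U r q) (hc' : Child U r' q)
    {z} (h : z ∈ RR U q) : r = r' := by
  have : n + 1 = n' + 1 := TT_level hU hW hl (q := q) (q' := q) ⟨r, hr, hc⟩ ⟨r', hr', hc'⟩ h h
  obtain rfl : n = n' := by omega
  exact TT_uniq hU hW hl n r hr r' hr' z
    (child_HH hU hW (TT_chord hl _ _ hr) hc (RR_sub_HH h))
    (child_HH hU hW (TT_chord hl _ _ hr') hc' (RR_sub_HH h))

theorem RR_nonempty (hU : IsOpen U) (hq : IsChord U q) : (RR U q).Nonempty := by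
  obtain ⟨Y, hY⟩ := os_nonempty q
  obtain ⟨-, Z, h1, h2⟩ := off_pt hq hY (vis_nhds hU (hq.2.2 hY))
  exact ⟨Z, h2, Y, hY, h1⟩

theorem TT_countable (hU : IsOpen U) (hW : W2 U) (hl : IsChord U l) (n : ℕ) :
    (TT U l n).Countable := by
  refine Set.PairwiseDisjoint.countable_of_isOpen (s := fun q => HH U q) ?_ ?_ ?_
  · intro q hq q' hq' hne
    exact Set.disjoint_left.2 fun z h1 h2 => hne (TT_uniq hU hW hl n q hq q' hq' z h1 h2)
  · exact fun q hq => HH_open hU (TT_chord hl n q hq)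
  · exact fun q hq => (RR_nonempty hU (TT_chord hl n q hq)).mono RR_sub_HH

theorem pair_lemma (hU : IsOpen U) (hb : Bornology.IsBounded U) (hW : W2 U) (hl : IsChord U l)
    {A B : ℝ × ℝ} (hA : ∀ n, ∀ q ∈ TT U l n, A ∉ os q)
    (hB : ∀ n, ∀ q ∈ TT U l n, B ∉ os q) (hAB : segment ℝ A B ⊆ U) (k : ℕ) :
    ∀ n, ∀ r ∈ TT U l n, A ∈ HH U r → B ∈ HH U r → A ∈ Lk U r k →
      ∃ n, ∃ r ∈ TT U l n, A ∈ HH U r ∧ B ∈ HH U r ∧ ∃ Z ∈ segment ℝ A B, Z ∈ RR U r := by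
  induction k with
  | zero => intro n r _ h1 _ h3; exact (HH_not_os h1 h3).elim
  | succ k ih =>
    intro n r hr h1 h2 h3
    by_cases hZ : ∃ Z ∈ segment ℝ A B, Z ∈ RR U r
    · exact ⟨n, r, hr, h1, h2, hZ⟩
    push Not at hZ
    have hrc := TT_chord hl n r hr
    rcases step_lemma hU hb hW hrc h1 with h | ⟨q, hc, hq⟩
    · exact (hZ A (left_mem_segment _ _ _) h).elim
    have hqT : q ∈ TT U l (n + 1) := ⟨r, hr, hc⟩
    have hAq : A ∈ HH U q := hq.resolve_left (hA _ _ hqT)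
    refine ih (n + 1) q hqT hAq ?_ (Lk_child hU hW hrc hc k A hq h3)
    by_contra hBq
    have : ¬ Disjoint (segment ℝ A B) (os q) := fun hd => hBq (HH_step hAq ⟨hAB, hd⟩)
    obtain ⟨X, hXs, hXq⟩ := Set.not_disjoint_iff.1 this
    have hXB : segment ℝ X B ⊆ U := seg_sub hAB hXs (right_mem_segment _ _ _)
    rcases lt_trichotomy (yy q B) 0 with h0 | h0 | h0
    · obtain ⟨Z, hZs, hZR⟩ := cross_child hU hc hXq hXB h0
      exact hZ Z ((convex_segment A B).segment_subset hXs (right_mem_segment _ _ _) hZs) hZR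
    · exact hB _ _ hqT (line_lemma hc.1 h0 hXq (seg_symm hXB))
    · exact hBq (RR_sub_HH ⟨h0, X, hXq, seg_symm hXB⟩)

/-- data on one side -/
theorem side (hU : IsOpen U) (hW : W2 U) (hr : IsChord U r) (hc : Child U r q)
    {A B Z : ℝ × ℝ} (hAB : segment ℝ A B ⊆ U) (hA : A ∈ HH U q) (hZs : Z ∈ segment ℝ A B)
    (hZ : Z ∈ RR U r) : A ∈ RR U q ∧ B ∉ HH U q ∧
      ∀ w : ℝ, 0 ≤ w → w ≤ 1 → yy q (A + w • (B - A)) < 0 →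
        ∃ t : ℝ, 0 ≤ t ∧ t ≤ w ∧ A + t • (B - A) ∈ RR U r := by
  have hZq : Z ∉ HH U q := fun h => child_HH_RR hU hW hr hc h (Or.inl hZ)
  have hAZ : segment ℝ A Z ⊆ U := seg_sub hAB (left_mem_segment _ _ _) hZs
  obtain ⟨X, hXs, hXq⟩ := Set.not_disjoint_iff.1 fun hd => hZq (HH_step hA ⟨hAZ, hd⟩)
  have hXs' : X ∈ segment ℝ A B :=
    (convex_segment A B).segment_subset (left_mem_segment _ _ _) hZs hXs
  have hAR : A ∈ RR U q := HH_sees hU hW hc.1 hA hXq (seg_sub hAZ (left_mem_segment _ _ _) hXs)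
  refine ⟨hAR, fun hB => Set.disjoint_left.1 (HH_disj_seg hU hW hc.1 hA hB hAB) hXs' hXq, ?_⟩
  intro w hw0 hw1 hw
  obtain ⟨t, ht0, ht1, hXt⟩ := mem_seg.1 hXs'
  have hyX := yy_os hXq
  rw [hXt, yy_line] at hyX
  have hyA := hAR.1
  have htw : t < w := by
    rw [yy_line] at hw
    by_contra h; push Not at h
    have h1 : yy q B - yy q A < 0 := by
      by_contra h'; push Not at h'; nlinarith
    nlinarith
  have hW1 : segment ℝ X (A + w • (B - A)) ⊆ U :=
    seg_sub hAB hXs' (mem_seg.2 ⟨w, hw0, hw1, rfl⟩)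
  obtain ⟨Z', hZ's, hZ'R⟩ := cross_child hU hc hXq hW1 hw
  obtain ⟨s, hs0, hs1, hZ'⟩ := mem_seg.1 hZ's
  refine ⟨t + s * (w - t), by nlinarith, by nlinarith, ?_⟩
  convert hZ'R using 1
  rw [hZ', hXt]; ext <;> simp <;> ring

def MM (U : Set (ℝ × ℝ)) (O : ℝ × ℝ) : Set (ℝ × ℝ) :=
  {z | Relation.ReflTransGen (fun a b => segment ℝ a b ⊆ U) O z}

theorem MM_Lk (hl : IsChord U l) {O z : ℝ × ℝ} (hO : O ∈ os l) (hz : z ∈ MM U O) : ∃ k, z ∈ Lk U l k := by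
  induction hz with
  | refl => exact ⟨0, hO⟩
  | tail _ h ih =>
    obtain ⟨k, hk⟩ := ih
    exact ⟨k + 1, _, hk, seg_symm h⟩

theorem Lk_rev (k : ℕ) : Lk U (rev l) k = Lk U l k := by
  induction k with
  | zero => exact os_rev l
  | succ k ih => simp only [Lk, ih]

theorem MM_cover (hl : IsChord U l) {O z : ℝ × ℝ} (hO : O ∈ os l) (hz : z ∈ MM U O) :
    z ∈ os l ∨ z ∈ HH U l ∨ z ∈ HH U (rev l) := by
  induction hz with
  | refl => exact Or.inl hO
  | @tail z w _ h ih =>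
    by_cases hd : Disjoint (segment ℝ z w) (os l)
    · rcases ih with h1 | h1 | h1
      · exact (Set.disjoint_left.1 hd (left_mem_segment _ _ _) h1).elim
      · exact Or.inr (Or.inl (HH_step h1 ⟨h, hd⟩))
      · exact Or.inr (Or.inr (HH_step h1 ⟨h, by rwa [os_rev]⟩))
    · obtain ⟨X, hXs, hXq⟩ := Set.not_disjoint_iff.1 hd
      have hXw : segment ℝ w X ⊆ U := seg_sub h (right_mem_segment _ _ _) hXs
      rcases lt_trichotomy (yy l w) 0 with h0 | h0 | h0
      · exact Or.inr (Or.inr (RR_sub_HH ⟨by rw [yy_rev]; linarith, X, by rwa [os_rev], hXw⟩))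
      · exact Or.inl (line_lemma hl h0 hXq hXw)
      · exact Or.inr (Or.inl (RR_sub_HH ⟨h0, X, hXq, hXw⟩))

theorem cross_cover (hU : IsOpen U) (hW : W2 U) (hl : IsChord U l) {A B : ℝ × ℝ}
    (hAB : segment ℝ A B ⊆ U) (hA : A ∈ HH U l) (hB : B ∈ HH U (rev l)) :
    Ch U l A B ∨ Ch U l B A := by
  have hBl : B ∉ HH U l := fun h => HH_rev hU hW hl h hB
  have hAl : A ∉ HH U (rev l) := fun h => HH_rev hU hW hl hA h
  obtain ⟨X, hXs, hXq⟩ := Set.not_disjoint_iff.1 fun hd => hBl (HH_step hA ⟨hAB, hd⟩)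
  have hAR := HH_sees hU hW hl hA hXq (seg_sub hAB (left_mem_segment _ _ _) hXs)
  have hBR := HH_sees hU hW hl.rev hB (by rwa [os_rev]) (seg_sub hAB (right_mem_segment _ _ _) hXs)
  have hyB := hBR.1
  have hyA := hAR.1
  rw [yy_rev] at hyB
  by_cases h : -3 * yy l A ≤ yy l B
  · exact Or.inl ⟨0, l, Or.inl rfl, Or.inl ⟨hAB, hAR, hBl, h⟩⟩
  · exact Or.inr ⟨0, rev l, Or.inr rfl, Or.inl ⟨seg_symm hAB, hBR, hAl, by
      rw [yy_rev, yy_rev]; linarith⟩⟩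

theorem coverage (hU : IsOpen U) (hb : Bornology.IsBounded U) (hW : W2 U) (hl : IsChord U l)
    {O A B : ℝ × ℝ} (hO : O ∈ os l) (hAM : A ∈ MM U O) (hBM : B ∈ MM U O)
    (hA : ∀ n, ∀ q ∈ TT U l n, A ∉ os q)
    (hB : ∀ n, ∀ q ∈ TT U l n, B ∉ os q) (hAB : segment ℝ A B ⊆ U) :
    Ch U l A B ∨ Ch U l B A := by
  have main : (∃ n, ∃ r ∈ TT U l n, A ∈ HH U r ∧ B ∈ HH U r ∧ ∃ Z ∈ segment ℝ A B, Z ∈ RR U r) →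
      Ch U l A B ∨ Ch U l B A := by
    rintro ⟨n, r, hr, hAr, hBr, Z, hZs, hZR⟩
    have hrc := TT_chord hl n r hr
    have hBA := seg_symm hAB
    by_contra hcon
    push Not at hcon
    obtain ⟨hc1, hc2⟩ := hcon
    have sideA : ∀ A B : ℝ × ℝ, (∀ n, ∀ q ∈ TT U l n, A ∉ os q) → segment ℝ A B ⊆ U → A ∈ HH U r →
        Z ∈ segment ℝ A B → ¬ Ch U l A B →
        (A ∈ RR U r ∨ ∃ q, Child U r q ∧ A ∈ RR U q) ∧
        ∀ w : ℝ, 1/4 ≤ w → w ≤ 1 → ∃ t : ℝ, 0 ≤ t ∧ t ≤ w ∧ A + t • (B - A) ∈ RR U r := by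
      intro A B hA hAB hAr hZs hch
      rcases step_lemma hU hb hW hrc hAr with h | ⟨q, hc, hq⟩
      · exact ⟨Or.inl h, fun w h0 h1 => ⟨0, le_rfl, by linarith, by simpa using h⟩⟩
      · have hAq : A ∈ HH U q := hq.resolve_left (hA (n+1) _ ⟨r, hr, hc⟩)
        obtain ⟨s1, s2, s3⟩ := side hU hW hrc hc hAB hAq hZs hZR
        refine ⟨Or.inr ⟨q, hc, s1⟩, fun w h0 h1 => s3 w (by linarith) h1 ?_⟩
        have hlt : yy q B < -3 * yy q A := by
          by_contra h; push Not at h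
          exact hch ⟨n + 1, q, ⟨r, hr, hc⟩, Or.inl ⟨hAB, s1, s2, h⟩⟩
        rw [yy_line]
        have := s1.1
        nlinarith
    obtain ⟨a1, a2⟩ := sideA A B hA hAB hAr hZs hc1
    obtain ⟨b1, b2⟩ := sideA B A hB hBA hBr (by rwa [segment_symm]) hc2
    have hin : ∀ w : ℝ, 1/4 ≤ w → w ≤ 3/4 → A + w • (B - A) ∈ RR U r := by
      intro w h0 h1
      obtain ⟨t, ht0, ht1, ht⟩ := a2 w h0 (by linarith)
      obtain ⟨s, hs0, hs1, hs⟩ := b2 (1 - w) (by linarith) (by linarith)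
      have e : B + s • (A - B) = A + (1 - s) • (B - A) := by ext <;> simp <;> ring
      rw [e] at hs
      have hseg : segment ℝ (A + t • (B - A)) (A + (1 - s) • (B - A)) ⊆ U :=
        seg_sub hAB (mem_seg.2 ⟨t, ht0, by linarith, rfl⟩) (mem_seg.2 ⟨1 - s, by linarith, by linarith, rfl⟩)
      apply L3 hW hrc hseg ht hs
      rcases eq_or_lt_of_le (show t ≤ 1 - s by linarith) with h | h
      · have : w = t := by linarith
        rw [this]; exact left_mem_segment _ _ _
      · refine mem_seg.2 ⟨(w - t) / (1 - s - t), div_nonneg (by linarith) (by linarith), ?_, ?_⟩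
        · rw [div_le_one (by linarith)]; linarith
        · have : 1 - s - t ≠ 0 := by linarith
          ext <;> simp <;> field_simp <;> ring
    have hA' : A + (1/4 : ℝ) • (B - A) ∈ RR U r := hin _ le_rfl (by norm_num)
    have hB' : B + (1/4 : ℝ) • (A - B) ∈ RR U r := by
      have := hin (3/4) (by norm_num) le_rfl
      convert this using 1
      ext <;> simp <;> ring
    rcases le_total (yy r A) (yy r B) with h | h
    · apply hc2
      rcases b1 with b | ⟨q, hq, b⟩
      · exact ⟨n, r, hr, Or.inr (Or.inl ⟨hBA, b, hA', h⟩)⟩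
      · exact ⟨n, r, hr, Or.inr (Or.inr ⟨q, hq, hBA, b, hA', hB', h⟩)⟩
    · apply hc1
      rcases a1 with b | ⟨q, hq, b⟩
      · exact ⟨n, r, hr, Or.inr (Or.inl ⟨hAB, b, hB', h⟩)⟩
      · exact ⟨n, r, hr, Or.inr (Or.inr ⟨q, hq, hAB, b, hB', hA', h⟩)⟩
  have hA0 := hA 0 l (Or.inl rfl)
  have hB0 := hB 0 l (Or.inl rfl)
  obtain ⟨k, hk⟩ := MM_Lk hl hO hAM
  rcases (MM_cover hl hO hAM).resolve_left hA0 with ha | ha <;>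
    rcases (MM_cover hl hO hBM).resolve_left hB0 with hb' | hb'
  · exact main (pair_lemma hU hb hW hl hA hB hAB k 0 l (Or.inl rfl) ha hb' hk)
  · exact cross_cover hU hW hl hAB ha hb'
  · exact (cross_cover hU hW hl (seg_symm hAB) hb' ha).symm
  · exact main (pair_lemma hU hb hW hl hA hB hAB k 0 (rev l) (Or.inr rfl) ha hb' (by rwa [Lk_rev]))

end C
end Beer

open MeasureTheory
open scoped ENNReal
namespace Beer
open Filter Topology

section D
variable {U : Set (ℝ × ℝ)} {r q l : (ℝ × ℝ) × (ℝ × ℝ)} {m : ℝ}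

theorem E1_bound (hm : MB U m) (hW : W2 U) (hq : IsChord U q) (B : ℝ × ℝ) :
    volume {A | E1 U q B A} ≤ ENNReal.ofReal (16 * m) := by
  set s : Set (ℝ × ℝ) := {X | X ∈ os q ∧ segment ℝ B X ⊆ U} with hs
  have hsc : Convex ℝ s := by
    rw [convex_iff_segment_subset]
    rintro X ⟨hX, hX'⟩ Y ⟨hY, hY'⟩ Z hZ
    have h1 : segment ℝ X Y ⊆ os q := (os_conv q).segment_subset hX hY
    exact ⟨h1 hZ, tri hW hX' hY' (h1.trans hq.2.2) hZ⟩
  set J := convexJoin ℝ {B} s with hJ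
  have hJc : Convex ℝ J := (convex_singleton B).convexJoin hsc
  have hJU : J ⊆ U := by
    intro z hz
    obtain ⟨b, hb, X, hX, hz'⟩ := mem_convexJoin.1 hz
    simp at hb; subst hb
    exact hX.2 hz'
  have hsub : {A | E1 U q B A} ⊆ AffineMap.homothety B (4:ℝ) '' J := by
    rintro A ⟨hBA, hB, hA, hy⟩
    have : ¬ Disjoint (segment ℝ B A) (os q) := fun hd => hA (HH_step (RR_sub_HH hB) ⟨hBA, hd⟩)
    obtain ⟨X, hXs, hXq⟩ := Set.not_disjoint_iff.1 this
    have hBX : segment ℝ B X ⊆ U := seg_sub hBA (left_mem_segment _ _ _) hXs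
    obtain ⟨t, ht0, ht1, rfl⟩ := mem_seg.1 hXs
    have h0 := yy_os hXq
    rw [yy_line] at h0
    have hB0 : 0 < yy q B := hB.1
    have ht : 1/4 ≤ t := by
      by_contra hlt
      push Not at hlt
      nlinarith
    refine ⟨B + (1/4:ℝ) • (A - B), ?_, ?_⟩
    · refine mem_convexJoin.2 ⟨B, rfl, _, ⟨hXq, hBX⟩, mem_seg.2 ⟨1/(4*t), by positivity, ?_, ?_⟩⟩
      · rw [div_le_one (by positivity)]; linarith
      · have : t ≠ 0 := by linarith
        ext <;> simp <;> field_simp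
    · simp [AffineMap.homothety_apply]
  refine (measure_mono hsub).trans ?_
  rw [Measure.addHaar_image_homothety]
  have h2 : Module.finrank ℝ (ℝ × ℝ) = 2 := by simp
  rw [h2, ENNReal.ofReal_mul (by norm_num)]
  norm_num
  gcongr
  exact hm J hJU hJc

theorem box (p p' u d : ℝ × ℝ) {a b : ℝ} (ha : 0 ≤ a) (hb : 0 ≤ b) (h : cr d u ≠ 0) :
    volume {z : ℝ × ℝ | |cr (z - p) u| ≤ a ∧ -(b/3) ≤ cr d (z - p') ∧ cr d (z - p') ≤ b} ≤
      ENNReal.ofReal (8/3 * a * b / |cr d u|) := by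
  set f : (ℝ × ℝ) →ₗ[ℝ] (ℝ × ℝ) := Matrix.toLin (Module.Basis.finTwoProd ℝ) (Module.Basis.finTwoProd ℝ)
    !![u.2, -u.1; -d.2, d.1] with hf
  have hdet : LinearMap.det f = cr d u := by
    rw [hf, LinearMap.det_toLin, Matrix.det_fin_two_of]; simp [cr]; ring
  have hfz : ∀ z, f z = (cr z u, cr d z) := by
    intro z
    rw [hf, Matrix.toLin_finTwoProd_apply]
    simp [cr]; constructor <;> ring
  have hsub : {z : ℝ × ℝ | |cr (z - p) u| ≤ a ∧ -(b/3) ≤ cr d (z - p') ∧ cr d (z - p') ≤ b} ⊆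
      f ⁻¹' (Set.Icc (cr p u - a) (cr p u + a) ×ˢ Set.Icc (cr d p' - b/3) (cr d p' + b)) := by
    rintro z ⟨h1, h2, h3⟩
    rw [abs_le] at h1
    have e1 : cr (z - p) u = cr z u - cr p u := by simp [cr]; ring
    have e2 : cr d (z - p') = cr d z - cr d p' := by simp [cr]; ring
    rw [Set.mem_preimage, hfz, Set.mem_prod, Set.mem_Icc, Set.mem_Icc]
    refine ⟨⟨?_, ?_⟩, ?_, ?_⟩ <;> simp only <;> linarith
  refine (measure_mono hsub).trans ?_
  rw [Measure.addHaar_preimage_linearMap _ (by rw [hdet]; exact h), hdet, Measure.volume_eq_prod,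
    Measure.prod_prod, Real.volume_Icc, Real.volume_Icc, ← ENNReal.ofReal_mul (by linarith),
    ← ENNReal.ofReal_mul (by positivity)]
  apply ENNReal.ofReal_le_ofReal
  rw [abs_inv]
  apply le_of_eq
  field_simp
  ring

theorem E2_bound (hm : MB U m) (hm0 : 0 ≤ m) (hW : W2 U) (hr : IsChord U r) (B : ℝ × ℝ) :
    volume {A | E2 U r B A} ≤ ENNReal.ofReal (24 * m) := by
  by_cases hB : B ∈ RR U r
  swap
  · have : {A | E2 U r B A} = ∅ := by ext A; simp [E2, hB]
    rw [this]; simp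
  obtain ⟨hB0, P, hP, hBP⟩ := id hB
  have hPd : cr (r.2 - r.1) (B - P) = yy r B := by
    have h1 := yy_os hP
    simp only [yy, cr, Prod.fst_sub, Prod.snd_sub] at h1 ⊢; linarith
  have hsub : {A | E2 U r B A} ⊆ {z : ℝ × ℝ | |cr (z - P) (B - P)| ≤ 16/3 * m ∧
      -(yy r B/3) ≤ cr (r.2 - r.1) (z - r.1) ∧ cr (r.2 - r.1) (z - r.1) ≤ yy r B} := by
    rintro A ⟨hBA, _, hA, hy⟩
    have hA'0 : 0 < yy r (A + (1/4 : ℝ) • (B - A)) := hA.1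
    rw [yy_line] at hA'0
    have hA's : A + (1/4 : ℝ) • (B - A) ∈ segment ℝ A B := mem_seg.2 ⟨1/4, by norm_num, by norm_num, rfl⟩
    have hA'B : segment ℝ (A + (1/4 : ℝ) • (B - A)) B ⊆ U :=
      seg_sub (seg_symm hBA) hA's (right_mem_segment _ _ _)
    have hG := lemmaG hm hm0 hW hr hA'B hA hP hBP (by rw [yy_line]; linarith)
    have e : cr (A + (1/4 : ℝ) • (B - A) - P) (B - P) = 3/4 * cr (A - P) (B - P) := by
      simp [cr]; ring
    rw [e, abs_mul] at hG
    norm_num at hG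
    refine ⟨by linarith, ?_, hy⟩
    change _ ≤ yy r A
    linarith
  refine (measure_mono hsub).trans ((box _ _ _ _ (by positivity) hB0.le (by rw [hPd]; exact hB0.ne')).trans ?_)
  apply ENNReal.ofReal_le_ofReal
  rw [hPd, abs_of_pos hB0, div_le_iff₀ hB0]
  nlinarith [mul_nonneg hm0 hB0.le]

theorem E3_core (hU : IsOpen U) (hm : MB U m) (hm0 : 0 ≤ m) (hW : W2 U) (hr : IsChord U r)
    (hc : Child U r q) {A B : ℝ × ℝ} (h : E3 U r q B A) :
    0 < yy r B ∧ cr (r.2 - r.1) (q.2 - q.1) ≠ 0 ∧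
      |yy q A| * yy r B ≤ 9 * m * |cr (r.2 - r.1) (q.2 - q.1)| ∧ -(yy r B / 3) ≤ yy r A := by
  obtain ⟨hBA, hB, hA', hB', hy⟩ := h
  have hA'0 := hA'.1
  rw [yy_line] at hA'0
  have hB0 : 0 < yy r B := by linarith
  have hlow : -(yy r B / 3) ≤ yy r A := by linarith
  have hq := hc.1
  set B' := B + (1/4 : ℝ) • (A - B) with hB'def
  have hB's : B' ∈ segment ℝ B A := mem_seg.2 ⟨1/4, by norm_num, by norm_num, rfl⟩
  have hBB' : segment ℝ B B' ⊆ U := seg_sub hBA (left_mem_segment _ _ _) hB's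
  have hnd : ¬ Disjoint (segment ℝ B B') (os q) := fun hd =>
    child_HH_RR hU hW hr hc (HH_step (RR_sub_HH hB) ⟨hBB', hd⟩) (Or.inl hB')
  obtain ⟨X, hXs, hXq⟩ := Set.not_disjoint_iff.1 hnd
  have hXR : X ∉ RR U r := fun h => Set.disjoint_left.1 hc.2.1 hXq h
  have hXr : X ∉ os r := fun h => Set.disjoint_left.1 hc.2.2.1 hXq h
  have hXU : X ∈ U := hBB' hXs
  have hXB' : segment ℝ X B' ⊆ U := seg_sub hBB' hXs (right_mem_segment _ _ _)
  have hXA : X ∈ segment ℝ B A := (convex_segment B A).segment_subset (left_mem_segment _ _ _) hB's hXs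
  obtain ⟨τ, hτ0, hτ1, hXe⟩ := mem_seg.1 hXs
  have hX0 := yy_os hXq
  have hyX : yy q X = yy q B + τ * (yy q B' - yy q B) := by rw [hXe, yy_line]
  have hyB' : yy q B' = yy q B + 1/4 * (yy q A - yy q B) := by rw [hB'def, yy_line]
  have hqB : 0 < yy q B := hB.1
  have hB'q : yy q B' < 0 := by
    by_contra hn
    push Not at hn
    have h1 : τ = 1 := by
      by_contra hne
      have : τ < 1 := lt_of_le_of_ne hτ1 hne
      nlinarith
    have : X = B' := by rw [hXe, h1]; simp
    rw [this] at hXR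
    exact hXR hB'
  have hCR : ∀ s : ℝ, 0 < s → s ≤ 1 → X + s • (B' - X) ∈ RR U r := by
    intro s hs0 hs1
    have hWs : X + s • (B' - X) ∈ segment ℝ X B' := mem_seg.2 ⟨s, hs0.le, hs1, rfl⟩
    have hWy : yy q (X + s • (B' - X)) < 0 := by rw [yy_line, hX0]; nlinarith
    obtain ⟨Z, hZ, hZR⟩ := cross_child hU hc hXq (seg_sub hXB' (left_mem_segment _ _ _) hWs) hWy
    obtain ⟨σ, hσ0, hσ1, hZe⟩ := mem_seg.1 hZ
    have hZ' : Z = X + (σ * s) • (B' - X) := by rw [hZe]; simp [mul_smul]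
    have hσs : σ * s ≤ s := by nlinarith
    have hZs : Z ∈ segment ℝ X B' := mem_seg.2 ⟨σ * s, by positivity, by linarith, hZ'⟩
    refine L3 hW hr (seg_sub hXB' hZs (right_mem_segment _ _ _)) hZR hB' ?_
    rw [mem_seg]
    by_cases h1 : σ * s = 1
    · have : s = 1 := by linarith
      exact ⟨1, by norm_num, le_rfl, by rw [this]; simp⟩
    · have h1' : σ * s < 1 := lt_of_le_of_ne (by linarith) h1
      refine ⟨(s - σ * s) / (1 - σ * s), div_nonneg (by linarith) (by linarith), ?_, ?_⟩
      · rw [div_le_one (by linarith)]; linarith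
      · have hne : 1 - σ * s ≠ 0 := by linarith
        have hw : (s - σ * s) / (1 - σ * s) * (1 - σ * s) = s - σ * s := div_mul_cancel₀ _ hne
        generalize (s - σ * s) / (1 - σ * s) = w at hw
        rw [hZ']
        ext
        · simp; linear_combination -(B'.1 - X.1) * hw
        · simp; linear_combination -(B'.2 - X.2) * hw
  obtain ⟨s, Q, P, hs, hs0, hQ, hQs, hPX, hfr⟩ := frontier_line hU hW hr hXU hXR hXr hCR
  have hPq : yy q P = 0 := by
    by_contra hne
    have hev := (vis_nhds hU hXU).and (hc.2.2.2 X hXq)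
    have hcont : Tendsto (fun δ : ℝ => X + (-(yy q P) * δ) • (P - X)) (𝓝[>] 0) (𝓝 X) := by
      have : Continuous (fun δ : ℝ => X + (-(yy q P) * δ) • (P - X)) := by fun_prop
      have := this.tendsto 0
      simp only [mul_zero, zero_smul, add_zero] at this
      exact this.mono_left nhdsWithin_le_nhds
    obtain ⟨δ, ⟨hv, hn⟩, hδ⟩ := ((hcont.eventually hev).and self_mem_nhdsWithin).exists
    have hδ' : 0 < δ := hδ
    have hneg : yy q (X + (-(yy q P) * δ) • (P - X)) < 0 := by
      rw [yy_line, hX0]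
      have : 0 < yy q P * yy q P := mul_self_pos.2 hne
      nlinarith
    exact (hfr _ (seg_symm hv) (by simp [cr]; ring)).2 (hn hneg)
  have hPr : yy r P = 0 := by
    have h1 := ((continuous_yy r).tendsto P).comp hQ
    have h2 : yy r ∘ Q = fun _ => 0 := by ext k; exact yy_os (hQs k).1
    rw [h2] at h1
    exact (tendsto_nhds_unique h1 tendsto_const_nhds)
  set A' := A + (1/4 : ℝ) • (B - A) with hA'def
  have hA's : A' ∈ segment ℝ B A := by
    rw [segment_symm]; exact mem_seg.2 ⟨1/4, by norm_num, by norm_num, rfl⟩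
  have hyA' : yy r A' = yy r A + 1/4 * (yy r B - yy r A) := by rw [hA'def, yy_line]
  have hyB'r : yy r B' = yy r B + 1/4 * (yy r A - yy r B) := by rw [hB'def, yy_line]
  have hyXr : yy r X = yy r B + τ * (yy r B' - yy r B) := by rw [hXe, yy_line]
  have hXr23 : 2/3 * yy r B ≤ yy r X := by nlinarith
  have hG : ∀ k, |cr (A' - Q k) (X + s k • (B' - X) - Q k)| ≤ 4 * m := by
    intro k
    have hCs : X + s k • (B' - X) ∈ segment ℝ X B' := mem_seg.2 ⟨s k, (hs k).1.le, (hs k).2, rfl⟩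
    have hCs' : X + s k • (B' - X) ∈ segment ℝ B A :=
      (convex_segment B A).segment_subset hXA hB's hCs
    refine lemmaG hm hm0 hW hr (seg_sub hBA hA's hCs') hA' (hQs k).1 (hQs k).2 ?_
    rw [yy_line r X B' (s k)]
    have h1 : yy r B' ≤ yy r X := by nlinarith
    have h2 : yy r A' ≤ yy r B' := by linarith
    have h3 := mul_nonneg (sub_nonneg.2 (hs k).2) (sub_nonneg.2 h1)
    linarith
  have hlim : |cr (A' - P) (X - P)| ≤ 4 * m := by
    have hC : Tendsto (fun k => X + s k • (B' - X)) atTop (𝓝 X) := by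
      have := (hs0.smul_const (B' - X)).const_add X
      simpa using this
    have hcr : Continuous fun p : (ℝ × ℝ) × (ℝ × ℝ) => |cr p.1 p.2| := by
      unfold cr; fun_prop
    have := (hcr.tendsto (A' - P, X - P)).comp ((tendsto_const_nhds (x := A')).sub hQ |>.prodMk_nhds (hC.sub hQ))
    exact le_of_tendsto' this hG
  have hkey : yy q A' * yy r X = - (cr (A' - P) (X - P) * cr (r.2 - r.1) (q.2 - q.1)) := by
    simp only [yy, cr, Prod.fst_sub, Prod.snd_sub] at hPq hPr hX0 ⊢
    have hv : (X.1 - P.1) * (q.2.2 - q.1.2) - (X.2 - P.2) * (q.2.1 - q.1.1) = 0 := by linarith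
    linear_combination (((A'.1 - P.1) * (r.2.2 - r.1.2) - (A'.2 - P.2) * (r.2.1 - r.1.1))) * hv + (((r.2.1 - r.1.1) * (X.2 - r.1.2) - (r.2.2 - r.1.2) * (X.1 - r.1.1))) * hPq - ((A'.1 - P.1) * (q.2.2 - q.1.2) - (A'.2 - P.2) * (q.2.1 - q.1.1)) * hPr
  have hyAq' : yy q A' = yy q A + 1/4 * (yy q B - yy q A) := by rw [hA'def, yy_line]
  have hAq : yy q A < 0 := by linarith
  have hrat : -yy q A ≤ -(3/2 * yy q A') := by nlinarith
  have hA'q : yy q A' < 0 := by linarith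
  have habs := congrArg abs hkey
  rw [abs_mul, abs_neg, abs_mul, abs_of_neg hA'q, abs_of_pos (by linarith : 0 < yy r X)] at habs
  refine ⟨hB0, ?_, ?_, hlow⟩
  · intro h0
    rw [h0] at hkey
    have : yy q A' * yy r X < 0 := mul_neg_of_neg_of_pos hA'q (by linarith)
    simp at hkey
    rcases hkey with h | h <;> linarith
  · rw [abs_of_neg hAq]
    have h1 : -yy q A * yy r B ≤ (-(3/2 * yy q A')) * (3/2 * yy r X) := by
      apply mul_le_mul hrat (by linarith) hB0.le (by linarith)
    have h2 : |cr (A' - P) (X - P)| * |cr (r.2 - r.1) (q.2 - q.1)| ≤ 4 * m * |cr (r.2 - r.1) (q.2 - q.1)| := by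
      gcongr
    nlinarith

theorem E3_bound (hU : IsOpen U) (hm : MB U m) (hm0 : 0 ≤ m) (hW : W2 U) (hr : IsChord U r)
    (hc : Child U r q) (B : ℝ × ℝ) :
    volume {A | E3 U r q B A} ≤ ENNReal.ofReal (24 * m) := by
  rcases Set.eq_empty_or_nonempty {A | E3 U r q B A} with h | ⟨A0, hA0⟩
  · rw [h]; simp
  obtain ⟨hB0, hcr, -, -⟩ := E3_core hU hm hm0 hW hr hc hA0
  have hcr0 := abs_pos.2 hcr
  have hsub : {A | E3 U r q B A} ⊆ {z : ℝ × ℝ | |cr (z - q.1) (q.2 - q.1)| ≤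
      9 * m * |cr (r.2 - r.1) (q.2 - q.1)| / yy r B ∧
      -(yy r B/3) ≤ cr (r.2 - r.1) (z - r.1) ∧ cr (r.2 - r.1) (z - r.1) ≤ yy r B} := by
    intro A hA
    obtain ⟨-, -, h1, h2⟩ := E3_core hU hm hm0 hW hr hc hA
    refine ⟨?_, h2, hA.2.2.2.2⟩
    rw [le_div_iff₀ hB0]
    have e : cr (A - q.1) (q.2 - q.1) = - yy q A := by simp [cr, yy]; ring
    rw [e, abs_neg]; exact h1
  refine (measure_mono hsub).trans ((box _ _ _ _ (by positivity) hB0.le hcr).trans ?_)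
  apply ENNReal.ofReal_le_ofReal
  apply le_of_eq
  field_simp
  ring

theorem Ch_bound (hU : IsOpen U) (hm : MB U m) (hm0 : 0 ≤ m) (hW : W2 U) (hl : IsChord U l)
    (B : ℝ × ℝ) : volume {A | Ch U l B A} ≤ ENNReal.ofReal (64 * m) := by
  by_cases hex : ∃ n, ∃ q ∈ TT U l n, B ∈ RR U q
  swap
  · have : {A | Ch U l B A} = ∅ := by
      ext A
      simp only [Set.mem_setOf_eq, Set.mem_empty_iff_false, iff_false]
      rintro ⟨n, q, hq, h | h | ⟨q', hc, h⟩⟩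
      · exact hex ⟨n, q, hq, h.2.1⟩
      · exact hex ⟨n, q, hq, h.2.1⟩
      · exact hex ⟨n + 1, q', ⟨q, hq, hc⟩, h.2.1⟩
    rw [this]; simp
  obtain ⟨n, q, hq, hB⟩ := hex
  have h12 : ∀ A, Ch U l B A → E1 U q B A ∨ E2 U q B A ∨ ∃ n, ∃ r ∈ TT U l n, Child U r q ∧ E3 U r q B A := by
    rintro A ⟨n', q'', hq'', h | h | ⟨q', hc, h⟩⟩
    · rw [TT_eq hU hW hl hq hq'' hB h.2.1]; exact Or.inl h
    · rw [TT_eq hU hW hl hq hq'' hB h.2.1]; exact Or.inr (Or.inl h)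
    · have : q = q' := TT_eq hU hW hl hq (n' := n' + 1) ⟨q'', hq'', hc⟩ hB h.2.1
      subst this
      exact Or.inr (Or.inr ⟨n', q'', hq'', hc, h⟩)
  have h3 : volume {A | ∃ n, ∃ r ∈ TT U l n, Child U r q ∧ E3 U r q B A} ≤ ENNReal.ofReal (24 * m) := by
    by_cases hp : ∃ n, ∃ r ∈ TT U l n, Child U r q
    · obtain ⟨k, r, hr, hc⟩ := hp
      refine (measure_mono ?_).trans (E3_bound hU hm hm0 hW (TT_chord hl k r hr) hc B)
      rintro A ⟨k', r', hr', hc', h⟩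
      rw [TT_parent hU hW hl hr hr' hc hc' hB]
      exact h
    · have : {A | ∃ n, ∃ r ∈ TT U l n, Child U r q ∧ E3 U r q B A} = ∅ := by
        ext A
        simp only [Set.mem_setOf_eq, Set.mem_empty_iff_false, iff_false]
        rintro ⟨k, r, hr, hc, -⟩
        exact hp ⟨k, r, hr, hc⟩
      rw [this]; simp
  have hsub : {A | Ch U l B A} ⊆ {A | E1 U q B A} ∪ ({A | E2 U q B A} ∪
      {A | ∃ n, ∃ r ∈ TT U l n, Child U r q ∧ E3 U r q B A}) := h12
  have hqc := TT_chord hl n q hq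
  calc _ ≤ _ := measure_mono hsub
    _ ≤ _ := (measure_union_le _ _).trans (add_le_add_right (measure_union_le _ _) _)
    _ ≤ ENNReal.ofReal (16 * m) + (ENNReal.ofReal (24 * m) + ENNReal.ofReal (24 * m)) := by
      gcongr
      · exact E1_bound hm hW hqc B
      · exact E2_bound hm hm0 hW hqc B
    _ = _ := by
      rw [← ENNReal.ofReal_add (by positivity) (by positivity),
        ← ENNReal.ofReal_add (by positivity) (by positivity)]
      congr 1; ring

end D
end Beer

open MeasureTheory
open scoped ENNReal
namespace Beer
open Filter Topology

section D8
variable {U : Set (ℝ × ℝ)} {r q l : (ℝ × ℝ) × (ℝ × ℝ)} {m : ℝ}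

theorem meas_seg (hU : IsOpen U) :
    MeasurableSet {p : (ℝ × ℝ) × (ℝ × ℝ) | segment ℝ p.1 p.2 ⊆ U} := (vis_open hU).measurableSet

theorem meas_E1 (hU : IsOpen U) (hq : IsChord U q) :
    MeasurableSet {p : (ℝ × ℝ) × (ℝ × ℝ) | E1 U q p.1 p.2} := by
  have hy := continuous_yy q
  refine (meas_seg hU).inter (((RR_open hU q).preimage continuous_fst).measurableSet.inter
    (((HH_open hU hq).preimage continuous_snd).measurableSet.compl.inter ?_))
  exact (isClosed_le (f := fun p : (ℝ × ℝ) × (ℝ × ℝ) => -3 * yy q p.1) (g := fun p => yy q p.2) (by fun_prop) (by fun_prop)).measurableSet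

theorem meas_E2 (hU : IsOpen U) :
    MeasurableSet {p : (ℝ × ℝ) × (ℝ × ℝ) | E2 U r p.1 p.2} := by
  have hy := continuous_yy r
  have h1 : Continuous fun p : (ℝ × ℝ) × (ℝ × ℝ) => p.2 + (1/4 : ℝ) • (p.1 - p.2) := by fun_prop
  refine (meas_seg hU).inter (((RR_open hU r).preimage continuous_fst).measurableSet.inter
    (((RR_open hU r).preimage h1).measurableSet.inter ?_))
  exact (isClosed_le (f := fun p : (ℝ × ℝ) × (ℝ × ℝ) => yy r p.2) (g := fun p => yy r p.1) (by fun_prop) (by fun_prop)).measurableSet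

theorem meas_E3 (hU : IsOpen U) :
    MeasurableSet {p : (ℝ × ℝ) × (ℝ × ℝ) | E3 U r q p.1 p.2} := by
  have hy := continuous_yy r
  have h1 : Continuous fun p : (ℝ × ℝ) × (ℝ × ℝ) => p.2 + (1/4 : ℝ) • (p.1 - p.2) := by fun_prop
  have h2 : Continuous fun p : (ℝ × ℝ) × (ℝ × ℝ) => p.1 + (1/4 : ℝ) • (p.2 - p.1) := by fun_prop
  refine (meas_seg hU).inter (((RR_open hU q).preimage continuous_fst).measurableSet.inter
    (((RR_open hU r).preimage h1).measurableSet.inter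
      (((RR_open hU r).preimage h2).measurableSet.inter ?_)))
  exact (isClosed_le (f := fun p : (ℝ × ℝ) × (ℝ × ℝ) => yy r p.2) (g := fun p => yy r p.1) (by fun_prop) (by fun_prop)).measurableSet

theorem meas_Ch (hU : IsOpen U) (hW : W2 U) (hl : IsChord U l) :
    MeasurableSet {p : (ℝ × ℝ) × (ℝ × ℝ) | Ch U l p.1 p.2} := by
  have : {p : (ℝ × ℝ) × (ℝ × ℝ) | Ch U l p.1 p.2} = ⋃ n, ⋃ q ∈ TT U l n,
      ({p | E1 U q p.1 p.2} ∪ ({p | E2 U q p.1 p.2} ∪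
        ⋃ q' ∈ {q' | q' ∈ TT U l (n + 1) ∧ Child U q q'}, {p | E3 U q q' p.1 p.2})) := by
    ext p
    simp only [Set.mem_ofPred_eq, Set.mem_iUnion, Set.mem_union, exists_prop]
    constructor
    · rintro ⟨n, q, hq, h | h | ⟨q', hc, h⟩⟩
      · exact ⟨n, q, hq, Or.inl h⟩
      · exact ⟨n, q, hq, Or.inr (Or.inl h)⟩
      · exact ⟨n, q, hq, Or.inr (Or.inr ⟨q', ⟨⟨q, hq, hc⟩, hc⟩, h⟩)⟩
    · rintro ⟨n, q, hq, h | h | ⟨q', hc, h⟩⟩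
      · exact ⟨n, q, hq, Or.inl h⟩
      · exact ⟨n, q, hq, Or.inr (Or.inl h)⟩
      · exact ⟨n, q, hq, Or.inr (Or.inr ⟨q', hc.2, h⟩)⟩
  rw [this]
  refine MeasurableSet.iUnion fun n => MeasurableSet.biUnion (TT_countable hU hW hl n) fun q hq => ?_
  refine (meas_E1 hU (TT_chord hl n q hq)).union ((meas_E2 hU).union ?_)
  exact MeasurableSet.biUnion ((TT_countable hU hW hl (n + 1)).mono fun q' h => h.1) fun q' _ => meas_E3 hU

theorem os_null (hq : q.1 ≠ q.2) : volume (os q) = 0 := by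
  set u := q.2 - q.1 with hu
  have hu0 : 0 < u.2 * u.2 + u.1 * u.1 := by
    rcases (add_nonneg (mul_self_nonneg u.2) (mul_self_nonneg u.1)).lt_or_eq with h | h
    · exact h
    · exfalso
      apply hq
      have h1 := (add_eq_zero_iff_of_nonneg (mul_self_nonneg u.2) (mul_self_nonneg u.1)).1 h.symm
      simp [hu, sub_eq_zero] at h1
      exact Prod.ext h1.2.symm h1.1.symm
  have hcr : cr (u.2, -u.1) u = u.2 * u.2 + u.1 * u.1 := by simp [cr]
  have := box q.1 q.1 u (u.2, -u.1) (a := 0) le_rfl hu0.le (by rw [hcr]; exact hu0.ne')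
  simp only [mul_zero, zero_mul, zero_div, ENNReal.ofReal_zero, nonpos_iff_eq_zero] at this
  refine measure_mono_null ?_ this
  intro z hz
  obtain ⟨t, ht0, ht1, rfl⟩ := mem_oseg.1 hz
  have e : cr (u.2, -u.1) (q.1 + t • (q.2 - q.1) - q.1) = t * (u.2 * u.2 + u.1 * u.1) := by
    rw [← hu]; simp [cr]; ring
  refine ⟨?_, ?_, ?_⟩
  · rw [← hu]; simp [cr]; ring_nf
  · rw [e]
    have := mul_pos ht0 hu0
    linarith
  · rw [e]; nlinarith

theorem MM_open (hU : IsOpen U) {O : ℝ × ℝ} (hO : O ∈ U) : IsOpen (MM U O) ∧ MM U O ⊆ U := by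
  have hsub : MM U O ⊆ U := by
    intro z hz
    induction hz with
    | refl => exact hO
    | tail _ h _ => exact h (right_mem_segment _ _ _)
  refine ⟨?_, hsub⟩
  rw [isOpen_iff_mem_nhds]
  intro z hz
  filter_upwards [vis_nhds hU (hsub hz)] with w hw
  exact Relation.ReflTransGen.tail hz (seg_symm hw)

theorem MM_eq {O z : ℝ × ℝ} (hz : z ∈ MM U O) : MM U z = MM U O := by
  have hz' : Relation.ReflTransGen (fun a b => segment ℝ a b ⊆ U) O z := hz
  ext w
  constructor
  · intro h; exact Relation.ReflTransGen.trans hz' h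
  · intro h; exact Relation.ReflTransGen.trans (rtg_symm (fun a b h => seg_symm h) hz') h

theorem comp_bound (hU : IsOpen U) (hb : Bornology.IsBounded U) (hW : W2 U) (hm : MB U m)
    (hm0 : 0 ≤ m) {O : ℝ × ℝ} (hO : O ∈ U) :
    volume {p : (ℝ × ℝ) × (ℝ × ℝ) | p.1 ∈ MM U O ∧ segment ℝ p.1 p.2 ⊆ U} ≤
      ENNReal.ofReal (128 * m) * volume (MM U O) := by
  obtain ⟨l, hl, hOl, -⟩ := chord_exists hU hb hO (d := (1, 0)) (by simp)
  set N : Set (ℝ × ℝ) := ⋃ n, ⋃ q ∈ TT U l n, os q with hN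
  have hN0 : volume N = 0 := by
    rw [hN, measure_iUnion_null_iff]
    intro n
    rw [measure_biUnion_null_iff (TT_countable hU hW hl n)]
    intro q hq
    exact os_null (TT_chord hl n q hq).ne
  have hNm : ∀ z, z ∉ N → ∀ n, ∀ q ∈ TT U l n, z ∉ os q := by
    intro z hz n q hq h
    exact hz (Set.mem_iUnion.2 ⟨n, Set.mem_iUnion₂.2 ⟨q, hq, h⟩⟩)
  set M := MM U O with hM
  have hMo := MM_open hU hO
  set F1 : Set ((ℝ × ℝ) × (ℝ × ℝ)) := {p | p.1 ∈ M ∧ Ch U l p.1 p.2} with hF1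
  set F2 : Set ((ℝ × ℝ) × (ℝ × ℝ)) := {p | p.2 ∈ M ∧ Ch U l p.2 p.1} with hF2
  have hCh := meas_Ch hU hW hl
  have hF1m : MeasurableSet F1 := (hMo.1.measurableSet.preimage measurable_fst).inter hCh
  have hF2m : MeasurableSet F2 :=
    (hMo.1.measurableSet.preimage measurable_snd).inter (hCh.preimage measurable_swap)
  have hsub : {p : (ℝ × ℝ) × (ℝ × ℝ) | p.1 ∈ M ∧ segment ℝ p.1 p.2 ⊆ U} ⊆
      (N ×ˢ Set.univ ∪ Set.univ ×ˢ N) ∪ (F1 ∪ F2) := by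
    rintro ⟨A, B⟩ ⟨hA, hAB⟩
    simp only at hA hAB
    by_cases h1 : A ∈ N
    · exact Or.inl (Or.inl ⟨h1, trivial⟩)
    by_cases h2 : B ∈ N
    · exact Or.inl (Or.inr ⟨trivial, h2⟩)
    have hBM : B ∈ M := Relation.ReflTransGen.tail hA hAB
    right
    rcases coverage hU hb hW hl hOl hA hBM (hNm A h1) (hNm B h2) hAB with h | h
    · exact Or.inl ⟨hA, h⟩
    · exact Or.inr ⟨hBM, h⟩
  have hb1 : volume F1 ≤ ENNReal.ofReal (64 * m) * volume M := by
    rw [Measure.volume_eq_prod, Measure.prod_apply hF1m]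
    calc _ ≤ ∫⁻ x, M.indicator (fun _ => ENNReal.ofReal (64 * m)) x := by
          apply lintegral_mono
          intro x
          by_cases hx : x ∈ M
          · simp only [Set.indicator_of_mem hx]
            refine (measure_mono ?_).trans (Ch_bound hU hm hm0 hW hl x)
            intro y hy; exact hy.2
          · have : (Prod.mk x ⁻¹' F1) = ∅ := by
              ext y; simp [hF1, hx]
            simp only [this]; simp
      _ = _ := by rw [lintegral_indicator hMo.1.measurableSet]; simp [hM]
  have hb2 : volume F2 ≤ ENNReal.ofReal (64 * m) * volume M := by
    rw [Measure.volume_eq_prod, Measure.prod_apply_symm hF2m]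
    calc _ ≤ ∫⁻ x, M.indicator (fun _ => ENNReal.ofReal (64 * m)) x := by
          apply lintegral_mono
          intro x
          by_cases hx : x ∈ M
          · simp only [Set.indicator_of_mem hx]
            refine (measure_mono ?_).trans (Ch_bound hU hm hm0 hW hl x)
            intro y hy; exact hy.2
          · have : ((fun y => (y, x)) ⁻¹' F2) = ∅ := by
              ext y; simp [hF2, hx]
            simp only [this]; simp
      _ = _ := by rw [lintegral_indicator hMo.1.measurableSet]; simp [hM]
  have hn1 : volume (N ×ˢ (Set.univ : Set (ℝ × ℝ))) = 0 := by
    rw [Measure.volume_eq_prod, Measure.prod_prod, hN0, zero_mul]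
  have hn2 : volume ((Set.univ : Set (ℝ × ℝ)) ×ˢ N) = 0 := by
    rw [Measure.volume_eq_prod, Measure.prod_prod, hN0, mul_zero]
  calc _ ≤ _ := measure_mono hsub
    _ ≤ _ := measure_union_le _ _
    _ ≤ 0 + (volume F1 + volume F2) := by
      gcongr
      · rw [nonpos_iff_eq_zero]; exact measure_union_null hn1 hn2
      · exact measure_union_le _ _
    _ ≤ ENNReal.ofReal (64 * m) * volume M + ENNReal.ofReal (64 * m) * volume M := by
      rw [zero_add]; gcongr
    _ = _ := by
      rw [← add_mul, ← ENNReal.ofReal_add (by positivity) (by positivity)]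
      congr 2; ring

theorem open_bound (hU : IsOpen U) (hb : Bornology.IsBounded U) (hW : W2 U) (hm : MB U m)
    (hm0 : 0 ≤ m) :
    volume {p : (ℝ × ℝ) × (ℝ × ℝ) | segment ℝ p.1 p.2 ⊆ U} ≤
      ENNReal.ofReal (128 * m) * volume U := by
  set C : Set (Set (ℝ × ℝ)) := MM U '' U with hC
  have hCp : C.PairwiseDisjoint id := by
    rintro _ ⟨O, hO, rfl⟩ _ ⟨O', hO', rfl⟩ hne
    rw [Function.onFun, Set.disjoint_left]
    intro z hz hz'
    exact hne ((MM_eq hz).symm.trans (MM_eq hz'))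
  have hCc : C.Countable := by
    refine hCp.countable_of_isOpen ?_ ?_
    · rintro _ ⟨O, hO, rfl⟩; exact (MM_open hU hO).1
    · rintro _ ⟨O, hO, rfl⟩; exact ⟨O, Relation.ReflTransGen.refl⟩
  have hsub : {p : (ℝ × ℝ) × (ℝ × ℝ) | segment ℝ p.1 p.2 ⊆ U} ⊆
      ⋃ M ∈ C, {p : (ℝ × ℝ) × (ℝ × ℝ) | p.1 ∈ M ∧ segment ℝ p.1 p.2 ⊆ U} := by
    intro p hp
    refine Set.mem_iUnion₂.2 ⟨MM U p.1, ⟨p.1, hp (left_mem_segment _ _ _), rfl⟩, ?_, hp⟩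
    exact Relation.ReflTransGen.refl
  calc _ ≤ _ := measure_mono hsub
    _ ≤ _ := measure_biUnion_le _ hCc _
    _ ≤ ∑' M : C, ENNReal.ofReal (128 * m) * volume (M : Set (ℝ × ℝ)) := by
      apply ENNReal.tsum_le_tsum
      rintro ⟨_, O, hO, rfl⟩
      exact comp_bound hU hb hW hm hm0 hO
    _ = ENNReal.ofReal (128 * m) * volume (⋃ M ∈ C, M) := by
      rw [ENNReal.tsum_mul_left, show (⋃ M ∈ C, M) = ⋃ M ∈ C, id M from rfl, measure_biUnion hCc hCp]
      · simp
      · rintro _ ⟨O, hO, rfl⟩; exact (MM_open hU hO).1.measurableSet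
    _ ≤ _ := by
      gcongr
      apply Set.iUnion₂_subset
      rintro _ ⟨O, hO, rfl⟩; exact (MM_open hU hO).2

end D8
end Beer

open MeasureTheory
open scoped ENNReal
namespace Beer
open Filter Topology

theorem lift_fun {X : Type*} [TopologicalSpace X] [SimplyConnectedSpace X] (g : X → ℂ)
    (hg : Continuous g) (hg0 : ∀ x, g x ≠ 0) : ∃ F : X → ℂ, ∀ (x y : X) (γ : Path x y)
      (Γ : C(unitInterval, ℂ)), (∀ t, Complex.exp (Γ t) = g (γ t)) → F y - F x = Γ 1 - Γ 0 := by
  let p : ℂ → {z : ℂ // z ≠ 0} := fun z : ℂ ↦ ⟨_, z.exp_ne_zero⟩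
  have cov : IsCoveringMap p := Complex.isCoveringMap_exp
  let G : C(X, {z : ℂ // z ≠ 0}) := ⟨fun x => ⟨g x, hg0 x⟩, by fun_prop⟩
  obtain ⟨x0⟩ : Nonempty X := inferInstance
  have he : ∀ (y : X) (σ : Path x0 y), (G.comp (σ : C(unitInterval, X))) 0 = p (Complex.log (g x0)) := by
    intro y σ
    apply Subtype.ext
    simp [p, G, Complex.exp_log (hg0 x0)]
  let L : ∀ (y : X) (σ : Path x0 y), C(unitInterval, ℂ) := fun y σ => cov.liftPath _ _ (he y σ)
  let σ : ∀ y : X, Path x0 y := fun y => PathConnectedSpace.somePath x0 y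
  have hLσ : ∀ (y : X) (τ : Path x0 y), L y τ 1 = L y (σ y) 1 := by
    intro y τ
    have h1 := SimplyConnectedSpace.paths_homotopic τ (σ y)
    apply cov.liftPath_apply_one_eq_of_homotopicRel
    exact Nonempty.map (fun H => ContinuousMap.HomotopyRel.compContinuousMap H G) h1
  refine ⟨fun y => L y (σ y) 1, ?_⟩
  intro x y γ Γ hΓ
  have hL : ∀ (y : X) (τ : Path x0 y) t, Complex.exp (L y τ t) = g (τ t) := by
    intro y τ t
    have := congr_fun (cov.liftPath_lifts _ _ (he y τ)) t
    exact congrArg Subtype.val this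
  have hL0 : ∀ (y : X) (τ : Path x0 y), L y τ 0 = Complex.log (g x0) := fun y τ =>
    cov.liftPath_zero _ _ (he y τ)
  have hc : Complex.exp (L x (σ x) 1 - Γ 0) = 1 := by
    rw [Complex.exp_sub, hL, hΓ]; simp [hg0]
  let P1 : Path (Complex.log (g x0)) (L x (σ x) 1) := ⟨L x (σ x), hL0 _ _, rfl⟩
  let P2 : Path (L x (σ x) 1) (Γ 1 + (L x (σ x) 1 - Γ 0)) :=
    ⟨⟨fun t => Γ t + (L x (σ x) 1 - Γ 0), by fun_prop⟩, by simp, by simp⟩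
  have key : ((P1.trans P2 : Path _ _) : C(unitInterval, ℂ)) = L y ((σ x).trans γ) := by
    refine (cov.eq_liftPath_iff' _).2 ⟨?_, by simp⟩
    funext t
    apply Subtype.ext
    simp only [p, G, Function.comp_apply, ContinuousMap.coe_coe, ContinuousMap.comp_apply, Path.trans_apply,
      ContinuousMap.coe_mk]
    split_ifs with h
    · exact hL _ _ _
    · simp only [P2, Path.coe_mk', ContinuousMap.coe_mk]
      change Complex.exp (Γ _ + (L x (σ x) 1 - Γ 0)) = _
      rw [Complex.exp_add, hc, hΓ, mul_one]
  have := congrArg (fun f : C(unitInterval, ℂ) => f 1) key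
  simp only [ContinuousMap.coe_coe, Path.target] at this
  simp only
  rw [← hLσ y ((σ x).trans γ), ← this]
  ring

theorem poly_iff {S : Set (ℝ × ℝ)} {A B : ℝ × ℝ} (hA : A ∈ S) : PolyConn S A B ↔ B ∈ MM S A := by
  constructor
  · rintro ⟨_, _, n, f, h0, hl, hf⟩
    have : ∀ i : Fin (n + 1), f i ∈ MM S A := by
      intro i
      induction i using Fin.induction with
      | zero => rw [h0]; exact Relation.ReflTransGen.refl
      | succ i ih => exact Relation.ReflTransGen.tail ih (hf i)
    rw [← hl]; exact this _
  · intro h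
    induction h with
    | refl => exact ⟨hA, hA, 0, fun _ => A, rfl, rfl, fun i => i.elim0⟩
    | tail _ h ih =>
      obtain ⟨_, _, n, f, h0, hl, hf⟩ := ih
      refine ⟨hA, h (right_mem_segment _ _ _), n + 1, Fin.snoc f _, ?_, Fin.snoc_last _ _, ?_⟩
      · have : (0 : Fin (n + 2)) = Fin.castSucc 0 := rfl
        rw [this, Fin.snoc_castSucc, h0]
      · intro i
        induction i using Fin.lastCases with
        | last =>
          rw [Fin.snoc_castSucc, Fin.succ_last, Fin.snoc_last, hl]
          exact h
        | cast j =>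
          rw [Fin.snoc_castSucc, ← Fin.castSucc_succ, Fin.snoc_castSucc]
          exact hf j

theorem W2_of_psc {S : Set (ℝ × ℝ)}
    (hpsc : ∀ A ∈ S, SimplyConnectedSpace {B : ℝ × ℝ // PolyConn S A B}) : W2 S := by
  intro e he
  let g : ∀ O : ℝ × ℝ, {B : ℝ × ℝ // PolyConn S O B} → ℂ := fun O x => ⟨(x.1 - e).1, (x.1 - e).2⟩
  have hF : ∀ O, ∃ F : ℝ × ℝ → ℝ, O ∈ S → ∀ A B, A ∈ MM S O → segment ℝ A B ⊆ S →
      F B - F A = ang e A B := by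
    intro O
    by_cases hO : O ∈ S
    swap
    · exact ⟨0, fun h => absurd h hO⟩
    haveI := hpsc O hO
    have hgc : Continuous (g O) := by
      have : g O = fun x => Complex.equivRealProdCLM.symm (x.1 - e) := by
        funext x; rfl
      rw [this]
      fun_prop
    obtain ⟨F, hF⟩ := lift_fun (g O) hgc (by
      rintro ⟨x, hx⟩ h
      have h1 := congrArg Complex.re h
      have h2 := congrArg Complex.im h
      simp [g] at h1 h2
      have : x = e := Prod.ext (by linarith) (by linarith)
      exact he (this ▸ hx.2.1))
    classical
    refine ⟨fun B => if h : PolyConn S O B then (F ⟨B, h⟩).im else 0, fun _ A B hA hAB => ?_⟩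
    have hseg : ∀ z ∈ segment ℝ A B, PolyConn S O z := fun z hz => (poly_iff hO).2
      (Relation.ReflTransGen.tail hA (seg_sub hAB (left_mem_segment _ _ _) hz))
    have hA' := hseg A (left_mem_segment _ _ _)
    have hB' := hseg B (right_mem_segment _ _ _)
    simp only [hA', hB', dif_pos]
    have hms : ∀ t : unitInterval, A + (t : ℝ) • (B - A) ∈ segment ℝ A B :=
      fun t => mem_seg.2 ⟨t, t.2.1, t.2.2, rfl⟩
    let γ : Path (⟨A, hA'⟩ : {B : ℝ × ℝ // PolyConn S O B}) ⟨B, hB'⟩ :=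
      ⟨⟨fun t => ⟨A + (t : ℝ) • (B - A), hseg _ (hms t)⟩, by fun_prop⟩, by simp, by simp⟩
    have hAe : A ≠ e := fun h => he (h ▸ hA'.2.1)
    have hne : (⟨(A - e).1, -(A - e).2⟩ : ℂ) ≠ 0 := by
      intro h
      have h1 := congrArg Complex.re h
      have h2 := congrArg Complex.im h
      simp at h1 h2
      exact hAe (Prod.ext (by linarith) (by linarith))
    have hslit : ∀ t : unitInterval, (⟨dt (A - e) (A + (t : ℝ) • (B - A) - e), cr (A - e) (A + (t : ℝ) • (B - A) - e)⟩ : ℂ) ∈ Complex.slitPlane := by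
      intro t
      apply slit
      intro h
      exact he (hAB ((convex_segment A B).segment_subset (left_mem_segment _ _ _) (hms t) h))
    have hprod : ∀ t : unitInterval, (⟨dt (A - e) (A + (t : ℝ) • (B - A) - e), cr (A - e) (A + (t : ℝ) • (B - A) - e)⟩ : ℂ) = g O (γ t) * ⟨(A - e).1, -(A - e).2⟩ := by
      intro t
      apply Complex.ext
      · simp [dt, g, γ]; ring
      · simp [cr, g, γ]; ring
    let Γ : C(unitInterval, ℂ) := ⟨fun t => Complex.log ⟨dt (A - e) (A + (t : ℝ) • (B - A) - e), cr (A - e) (A + (t : ℝ) • (B - A) - e)⟩ - Complex.log ⟨(A - e).1, -(A - e).2⟩, by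
      refine Continuous.sub ?_ continuous_const
      refine Continuous.clog ?_ hslit
      have : (fun t : unitInterval => (⟨dt (A - e) (A + (t : ℝ) • (B - A) - e), cr (A - e) (A + (t : ℝ) • (B - A) - e)⟩ : ℂ)) = fun t : unitInterval => Complex.equivRealProdCLM.symm (dt (A - e) (A + (t : ℝ) • (B - A) - e), cr (A - e) (A + (t : ℝ) • (B - A) - e)) := by
        funext t; rfl
      rw [this]
      unfold dt cr
      fun_prop⟩
    have h1 := hF _ _ γ Γ (by
      intro t
      change Complex.exp (_ - _) = _
      rw [Complex.exp_sub, Complex.exp_log (Complex.slitPlane_ne_zero (hslit t)), Complex.exp_log hne, hprod]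
      field_simp)
    have h2 := congrArg Complex.im h1
    rw [Complex.sub_im] at h2
    rw [h2]
    have hz : Complex.arg (⟨dt (A - e) (A - e), cr (A - e) (A - e)⟩ : ℂ) = 0 := by
      rw [Complex.arg_eq_zero_iff]
      constructor
      · simp [dt]; nlinarith [mul_self_nonneg (A.1 - e.1), mul_self_nonneg (A.2 - e.2)]
      · simp [cr]; ring
    simp [Γ, Complex.log_im, ang, hz]
  choose F hF using hF
  classical
  let rep : ℝ × ℝ → ℝ × ℝ := fun A => if h : (MM S A).Nonempty then h.some else 0
  refine ⟨fun A => F (rep A) A, fun A B hAB => ?_⟩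
  have hBA : B ∈ MM S A := Relation.ReflTransGen.tail Relation.ReflTransGen.refl hAB
  have hrep : rep B = rep A := by
    have := MM_eq hBA
    simp only [rep, this]
  simp only [hrep]
  have hne : (MM S A).Nonempty := ⟨A, Relation.ReflTransGen.refl⟩
  have hr : rep A ∈ MM S A := by
    simp only [rep, hne, dif_pos]; exact hne.some_mem
  have hAS : A ∈ S := hAB (left_mem_segment _ _ _)
  refine hF (rep A) ((poly_iff hAS).2 hr).2.1 A B ?_ hAB
  rw [MM_eq hr]; exact Relation.ReflTransGen.refl
end Beer

open MeasureTheory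
open scoped ENNReal
namespace Beer
open Filter Topology

theorem ang_tendsto {e A B : ℝ × ℝ} (h : e ∉ segment ℝ A B) {x : ℕ → ℝ × ℝ}
    (hx : Tendsto x atTop (𝓝 e)) : Tendsto (fun k => ang (x k) A B) atTop (𝓝 (ang e A B)) := by
  have hcs : IsClosed (segment ℝ A B) := by
    rw [segment_eq_image_lineMap]
    exact (isCompact_Icc.image (by fun_prop)).isClosed
  have h1 : ContinuousOn (fun e => ang e A B) (segment ℝ A B)ᶜ :=
    cont_ang continuousOn_id continuousOn_const continuousOn_const (fun x hx => hx)
  have h2 := h1.continuousAt (hcs.isOpen_compl.mem_nhds h)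
  exact h2.tendsto.comp hx

theorem W2_int {S : Set (ℝ × ℝ)} (hW : W2 S) : W2 (interior S) := by
  intro e he
  by_cases heS : e ∈ S
  swap
  · obtain ⟨θ, hθ⟩ := hW e heS
    exact ⟨θ, fun A B h => hθ A B (h.trans interior_subset)⟩
  have hcl : e ∈ closure Sᶜ := by
    rw [closure_compl]; exact he
  obtain ⟨x, hx, hxe⟩ := mem_closure_iff_seq_limit.1 hcl
  choose θ hθ using fun k => hW (x k) (hx k)
  have hstep : ∀ A B, segment ℝ A B ⊆ interior S →
      Tendsto (fun k => θ k B - θ k A) atTop (𝓝 (ang e A B)) := by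
    intro A B h
    have : (fun k => θ k B - θ k A) = fun k => ang (x k) A B := by
      funext k; exact hθ k A B (h.trans interior_subset)
    rw [this]
    exact ang_tendsto (fun h' => he (h h')) hxe
  have hchain : ∀ O z, z ∈ MM (interior S) O →
      ∃ a, Tendsto (fun k => θ k z - θ k O) atTop (𝓝 a) := by
    intro O z hz
    induction hz with
    | refl => exact ⟨0, by simp⟩
    | @tail b c _ hs ih =>
      obtain ⟨a, ha⟩ := ih
      refine ⟨a + ang e b c, ?_⟩
      refine (ha.add (hstep _ _ hs)).congr (fun k => ?_)
      ring
  classical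
  let rep : ℝ × ℝ → ℝ × ℝ := fun A => if h : (MM (interior S) A).Nonempty then h.some else 0
  refine ⟨fun z => limUnder atTop (fun k => θ k z - θ k (rep z)), fun A B hAB => ?_⟩
  have hBA : B ∈ MM (interior S) A := Relation.ReflTransGen.tail Relation.ReflTransGen.refl hAB
  have hrep : rep B = rep A := by
    have := MM_eq hBA
    simp only [rep, this]
  have hne : (MM (interior S) A).Nonempty := ⟨A, Relation.ReflTransGen.refl⟩
  have hr : rep A ∈ MM (interior S) A := by
    simp only [rep, hne, dif_pos]; exact hne.some_mem
  obtain ⟨a, ha⟩ := hchain (rep A) A (by rw [MM_eq hr]; exact Relation.ReflTransGen.refl)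
  have hb : Tendsto (fun k => θ k B - θ k (rep B)) atTop (𝓝 (a + ang e A B)) := by
    rw [hrep]
    refine (ha.add (hstep _ _ hAB)).congr (fun k => ?_)
    ring
  simp only
  rw [ha.limUnder_eq, hb.limUnder_eq]; ring

theorem W2_inter {S D : Set (ℝ × ℝ)} (hW : W2 S) (hD : IsOpen D) (hc : Convex ℝ D) :
    W2 (S ∩ D) := by
  intro e he
  by_cases heS : e ∈ S
  swap
  · obtain ⟨θ, hθ⟩ := hW e heS
    exact ⟨θ, fun A B h => hθ A B (h.trans Set.inter_subset_left)⟩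
  have heD : e ∉ D := fun h => he ⟨heS, h⟩
  obtain ⟨f, hf⟩ := geometric_hahn_banach_point_open hc hD heD
  let w : ℝ × ℝ := (f (1, 0), f (0, 1))
  have hfw : ∀ z : ℝ × ℝ, f z = dt w z := by
    intro z
    have : z = z.1 • ((1, 0) : ℝ × ℝ) + z.2 • ((0, 1) : ℝ × ℝ) := by ext <;> simp
    conv_lhs => rw [this]
    rw [map_add, map_smul, map_smul]; simp [dt, w]; ring
  have hpos : ∀ z ∈ D, 0 < dt w (z - e) := by
    intro z hz
    rw [← hfw, map_sub]; linarith [hf z hz]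
  refine ⟨fun z => ang e (e + w) z, fun A B h => ?_⟩
  have hA : A ∈ D := (h (left_mem_segment _ _ _)).2
  have hB : B ∈ D := (h (right_mem_segment _ _ _)).2
  have hAe : A ≠ e := fun h => heD (h ▸ hA)
  have hBe : B ≠ e := fun h => heD (h ▸ hB)
  have hw : e + w ≠ e := by
    intro h'
    have hw0 : w = 0 := by simpa using h'
    have := hpos A hA
    rw [hw0] at this; simp [dt] at this
  have hab : ∀ z ∈ D, |ang e (e + w) z| < Real.pi / 2 := by
    intro z hz
    unfold ang
    rw [Complex.abs_arg_lt_pi_div_two_iff]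
    left
    simpa using hpos z hz
  have h1 : ((ang e (e + w) B - ang e (e + w) A : ℝ) : Real.Angle) = (ang e A B : Real.Angle) := by
    rw [Real.Angle.coe_sub, coe_ang hw hBe, coe_ang hw hAe, coe_ang hAe hBe]; abel
  have h2 := abs_lt.1 (hab A hA)
  have h3 := abs_lt.1 (hab B hB)
  have h4 := Real.Angle.toReal_coe_eq_self_iff_mem_Ioc.2
    (show (ang e (e + w) B - ang e (e + w) A) ∈ Set.Ioc (-Real.pi) Real.pi from
      ⟨by linarith, by linarith⟩)
  have h5 := Real.Angle.toReal_coe_eq_self_iff_mem_Ioc.2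
    (show ang e A B ∈ Set.Ioc (-Real.pi) Real.pi from Complex.arg_mem_Ioc _)
  rw [← h4, ← h5, h1]
end Beer

open MeasureTheory
open scoped ENNReal
namespace Beer
open Filter Topology

noncomputable def tau (q q' : (ℝ × ℝ) × (ℝ × ℝ)) : ℝ :=
  cr (q'.1 - q.1) (q'.2 - q'.1) / cr (q.2 - q.1) (q'.2 - q'.1)

noncomputable def ipt (q q' : (ℝ × ℝ) × (ℝ × ℝ)) : ℝ × ℝ := q.1 + tau q q' • (q.2 - q.1)

theorem ipt_comm {q q' : (ℝ × ℝ) × (ℝ × ℝ)} (h : cr (q.2 - q.1) (q'.2 - q'.1) ≠ 0) :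
    ipt q q' = ipt q' q := by
  have h' : cr (q'.2 - q'.1) (q.2 - q.1) = - cr (q.2 - q.1) (q'.2 - q'.1) := by
    simp [cr]; ring
  unfold ipt tau
  rw [h']
  ext
  · simp only [Prod.fst_add, Prod.smul_fst, smul_eq_mul]
    field_simp
    simp [cr]; ring
  · simp only [Prod.snd_add, Prod.smul_snd, smul_eq_mul]
    field_simp
    simp [cr]; ring

theorem ipt_mem {q q' : (ℝ × ℝ) × (ℝ × ℝ)} (h : 0 < tau q q') (h1 : tau q q' < 1) :
    ipt q q' ∈ segment ℝ q.1 q.2 := mem_seg.2 ⟨_, h.le, h1.le, rfl⟩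

theorem tau_cont {q q' : (ℝ × ℝ) × (ℝ × ℝ)} (h : cr (q.2 - q.1) (q'.2 - q'.1) ≠ 0) :
    ContinuousAt (fun p : ((ℝ × ℝ) × (ℝ × ℝ)) × ((ℝ × ℝ) × (ℝ × ℝ)) => tau p.1 p.2) (q, q') := by
  unfold tau
  refine ContinuousAt.div ?_ ?_ h
  · unfold cr; fun_prop
  · unfold cr; fun_prop

theorem ipt_cont {q q' : (ℝ × ℝ) × (ℝ × ℝ)} (h : cr (q.2 - q.1) (q'.2 - q'.1) ≠ 0) :
    ContinuousAt (fun p : ((ℝ × ℝ) × (ℝ × ℝ)) × ((ℝ × ℝ) × (ℝ × ℝ)) => ipt p.1 p.2) (q, q') := by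
  unfold ipt
  have := tau_cont h
  fun_prop

theorem tri_int {P Q R z : ℝ × ℝ} (h1 : 0 < cr (Q - P) (z - P)) (h2 : 0 < cr (R - Q) (z - Q))
    (h3 : 0 < cr (P - R) (z - R)) : z ∈ interior (convexHull ℝ {P, Q, R}) := by
  rw [mem_interior]
  refine ⟨{z | 0 < cr (Q - P) (z - P) ∧ 0 < cr (R - Q) (z - Q) ∧ 0 < cr (P - R) (z - R)},
    ?_, ?_, h1, h2, h3⟩
  · rintro z ⟨h1, h2, h3⟩
    set c1 := cr (Q - P) (z - P) with e1
    set c2 := cr (R - Q) (z - Q) with e2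
    set c3 := cr (P - R) (z - R) with e3
    have hs : 0 < c1 + c2 + c3 := by linarith
    have := (convex_convexHull ℝ {P, Q, R}).sum_mem (t := Finset.univ)
      (w := ![c2 / (c1 + c2 + c3), c3 / (c1 + c2 + c3), c1 / (c1 + c2 + c3)]) (z := ![P, Q, R])
      (by intro i _; fin_cases i <;> simp <;> positivity)
      (by simp [Fin.sum_univ_three]; field_simp; ring)
      (by intro i _; apply subset_convexHull; fin_cases i <;> simp)
    convert this
    rw [Fin.sum_univ_three]
    ext
    · simp; field_simp; rw [e1, e2, e3]; simp [cr]; ring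
    · simp; field_simp; rw [e1, e2, e3]; simp [cr]; ring
  · simp only [cr]
    refine IsOpen.and ?_ (IsOpen.and ?_ ?_) <;>
    exact isOpen_lt (by fun_prop) (by fun_prop)

theorem cr_cont {α : Type*} [TopologicalSpace α] {f g : α → ℝ × ℝ} {x : α} (hf : ContinuousAt f x)
    (hg : ContinuousAt g x) : ContinuousAt (fun y => cr (f y) (g y)) x := by
  unfold cr; fun_prop

/-- open tests for pairs of segments -/
theorem pair_ev {q1 q2 : (ℝ × ℝ) × (ℝ × ℝ)} (h : cr (q1.2 - q1.1) (q2.2 - q2.1) ≠ 0)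
    (h1 : 0 < tau q1 q2) (h2 : tau q1 q2 < 1) (h3 : 0 < tau q2 q1) (h4 : tau q2 q1 < 1) :
    ∀ᶠ p : ((ℝ × ℝ) × (ℝ × ℝ)) × ((ℝ × ℝ) × (ℝ × ℝ)) in 𝓝 (q1, q2),
      ipt p.1 p.2 ∈ segment ℝ p.1.1 p.1.2 ∧ ipt p.1 p.2 ∈ segment ℝ p.2.1 p.2.2 := by
  have h' : cr (q2.2 - q2.1) (q1.2 - q1.1) ≠ 0 := by
    intro h0; apply h; simp [cr] at h0 ⊢; linarith
  have c1 := tau_cont h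
  have c2 : ContinuousAt (fun p : ((ℝ × ℝ) × (ℝ × ℝ)) × ((ℝ × ℝ) × (ℝ × ℝ)) => tau p.2 p.1) (q1, q2) :=
    ContinuousAt.comp (f := Prod.swap) (g := fun p : ((ℝ × ℝ) × (ℝ × ℝ)) × ((ℝ × ℝ) × (ℝ × ℝ)) => tau p.1 p.2)
      (x := (q1, q2)) (tau_cont h') continuous_swap.continuousAt
  have c3 : ContinuousAt (fun p : ((ℝ × ℝ) × (ℝ × ℝ)) × ((ℝ × ℝ) × (ℝ × ℝ)) =>
      cr (p.1.2 - p.1.1) (p.2.2 - p.2.1)) (q1, q2) := by unfold cr; fun_prop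
  filter_upwards [c1.eventually_const_lt h1, c1.eventually_lt_const h2,
    c2.eventually_const_lt h3, c2.eventually_lt_const h4, c3.eventually_ne h] with p a b c d e
  refine ⟨ipt_mem a b, ?_⟩
  rw [ipt_comm e]
  exact ipt_mem c d

theorem model {t : ℝ} (h0 : 0 < t) (h1 : t < 1) : ∃ a1 b1 a2 b2 a3 b3 : ℝ, ∃ ε > 0,
    ∀ q1 q2 q3 : (ℝ × ℝ) × (ℝ × ℝ), dist q1 ((0, a1), (1, b1)) < ε → dist q2 ((0, a2), (1, b2)) < ε →
      dist q3 ((0, a3), (1, b3)) < ε → ∃ P Q R : ℝ × ℝ,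
      P ∈ segment ℝ q1.1 q1.2 ∧ Q ∈ segment ℝ q1.1 q1.2 ∧ P ∈ segment ℝ q2.1 q2.2 ∧
      R ∈ segment ℝ q2.1 q2.2 ∧ Q ∈ segment ℝ q3.1 q3.2 ∧ R ∈ segment ℝ q3.1 q3.2 ∧
      ((t, 0) : ℝ × ℝ) ∈ interior (convexHull ℝ {P, Q, R}) := by
  obtain ⟨d, hd, hdt, hd1⟩ : ∃ d : ℝ, 0 < d ∧ d < t ∧ d < 1 - t :=
    ⟨t * (1 - t) / 2, by have := sub_pos.2 h1; positivity, by nlinarith, by nlinarith⟩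
  refine ⟨-1, -1, 1 - 2 / d * t, 1 + 2 / d * (1 - t), 1 + 2 / d * t, 1 - 2 / d * (1 - t), ?_⟩
  set m1 : (ℝ × ℝ) × (ℝ × ℝ) := ((0, -1), (1, -1)) with e1
  set m2 : (ℝ × ℝ) × (ℝ × ℝ) := ((0, 1 - 2 / d * t), (1, 1 + 2 / d * (1 - t))) with e2
  set m3 : (ℝ × ℝ) × (ℝ × ℝ) := ((0, 1 + 2 / d * t), (1, 1 - 2 / d * (1 - t))) with e3
  have x12 : cr (m1.2 - m1.1) (m2.2 - m2.1) = 2 / d := by simp [cr, m1, m2]; ring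
  have x13 : cr (m1.2 - m1.1) (m3.2 - m3.1) = - (2 / d) := by simp [cr, m1, m3]; ring
  have x23 : cr (m2.2 - m2.1) (m3.2 - m3.1) = - (4 / d) := by simp [cr, m2, m3]; ring
  have x21 : cr (m2.2 - m2.1) (m1.2 - m1.1) = - (2 / d) := by simp [cr, m1, m2]; ring
  have x31 : cr (m3.2 - m3.1) (m1.2 - m1.1) = (2 / d) := by simp [cr, m1, m3]; ring
  have x32 : cr (m3.2 - m3.1) (m2.2 - m2.1) = (4 / d) := by simp [cr, m2, m3]; ring
  have t12 : tau m1 m2 = t - d := by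
    unfold tau; rw [x12]; simp [cr, m1, m2]; field_simp; ring
  have t21 : tau m2 m1 = t - d := by
    unfold tau; rw [x21]; simp [cr, m1, m2]; field_simp; ring
  have t13 : tau m1 m3 = t + d := by
    unfold tau; rw [x13]; simp [cr, m1, m3]; field_simp; ring
  have t31 : tau m3 m1 = t + d := by
    unfold tau; rw [x31]; simp [cr, m1, m3]; field_simp; ring
  have t23 : tau m2 m3 = t := by
    unfold tau; rw [x23]; simp [cr, m2, m3]; field_simp; ring
  have t32 : tau m3 m2 = t := by
    unfold tau; rw [x32]; simp [cr, m2, m3]; field_simp; ring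
  have hd2 : 0 < 2 / d := by positivity
  have hd4 : 0 < 4 / d := by positivity
  have n12 : cr (m1.2 - m1.1) (m2.2 - m2.1) ≠ 0 := by rw [x12]; exact hd2.ne'
  have n13 : cr (m1.2 - m1.1) (m3.2 - m3.1) ≠ 0 := by rw [x13]; exact (neg_neg_of_pos hd2).ne
  have n23 : cr (m2.2 - m2.1) (m3.2 - m3.1) ≠ 0 := by rw [x23]; exact (neg_neg_of_pos hd4).ne
  have p12 : ipt m1 m2 = (t - d, -1) := by
    unfold ipt; rw [t12]; ext <;> simp [m1]
  have p13 : ipt m1 m3 = (t + d, -1) := by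
    unfold ipt; rw [t13]; ext <;> simp [m1]
  have p23 : ipt m2 m3 = (t, 1) := by
    unfold ipt; rw [t23]; ext <;> simp [m2]; ring
  let X := ((ℝ × ℝ) × (ℝ × ℝ)) × ((ℝ × ℝ) × (ℝ × ℝ)) × ((ℝ × ℝ) × (ℝ × ℝ))
  let m : X := (m1, m2, m3)
  have f12 : ContinuousAt (fun x : X => (x.1, x.2.1)) m := by fun_prop
  have f13 : ContinuousAt (fun x : X => (x.1, x.2.2)) m := by fun_prop
  have f23 : ContinuousAt (fun x : X => (x.2.1, x.2.2)) m := by fun_prop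
  have E12 := f12.eventually (pair_ev n12 (by rw [t12]; linarith) (by rw [t12]; linarith) (by rw [t21]; linarith) (by rw [t21]; linarith))
  have E13 := f13.eventually (pair_ev n13 (by rw [t13]; linarith) (by rw [t13]; linarith) (by rw [t31]; linarith) (by rw [t31]; linarith))
  have E23 := f23.eventually (pair_ev n23 (by rw [t23]; linarith) (by rw [t23]; linarith) (by rw [t32]; linarith) (by rw [t32]; linarith))
  have g12 : ContinuousAt (fun x : X => ipt x.1 x.2.1) m := ContinuousAt.comp (f := fun x : X => (x.1, x.2.1)) (x := m) (ipt_cont n12) f12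
  have g13 : ContinuousAt (fun x : X => ipt x.1 x.2.2) m := ContinuousAt.comp (f := fun x : X => (x.1, x.2.2)) (x := m) (ipt_cont n13) f13
  have g23 : ContinuousAt (fun x : X => ipt x.2.1 x.2.2) m := ContinuousAt.comp (f := fun x : X => (x.2.1, x.2.2)) (x := m) (ipt_cont n23) f23
  have k1 : ContinuousAt (fun x : X => cr (ipt x.1 x.2.2 - ipt x.1 x.2.1) (((t, 0) : ℝ × ℝ) - ipt x.1 x.2.1)) m :=
    cr_cont (g13.sub g12) (continuousAt_const.sub g12)
  have k2 : ContinuousAt (fun x : X => cr (ipt x.2.1 x.2.2 - ipt x.1 x.2.2) (((t, 0) : ℝ × ℝ) - ipt x.1 x.2.2)) m :=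
    cr_cont (g23.sub g13) (continuousAt_const.sub g13)
  have k3 : ContinuousAt (fun x : X => cr (ipt x.1 x.2.1 - ipt x.2.1 x.2.2) (((t, 0) : ℝ × ℝ) - ipt x.2.1 x.2.2)) m :=
    cr_cont (g12.sub g23) (continuousAt_const.sub g23)
  have K1 := k1.eventually_const_lt (u := 0) (by simp only [m]; rw [p12, p13]; simp [cr]; linarith)
  have K2 := k2.eventually_const_lt (u := 0) (by simp only [m]; rw [p23, p13]; simp [cr]; linarith)
  have K3 := k3.eventually_const_lt (u := 0) (by simp only [m]; rw [p23, p12]; simp [cr]; linarith)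
  obtain ⟨ε, hε, hh⟩ := Metric.eventually_nhds_iff.1 (E12.and (E13.and (E23.and (K1.and (K2.and K3)))))
  refine ⟨ε, hε, fun q1 q2 q3 d1 d2 d3 => ?_⟩
  have := @hh (q1, q2, q3) (by
    rw [Prod.dist_eq, Prod.dist_eq]
    exact max_lt d1 (max_lt d2 d3))
  obtain ⟨⟨a1, a2⟩, ⟨a3, a4⟩, ⟨a5, a6⟩, a7, a8, a9⟩ := this
  exact ⟨ipt q1 q2, ipt q1 q3, ipt q2 q3, a1, a3, a2, a5, a4, a6, tri_int a7 a8 a9⟩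
end Beer

open MeasureTheory
open scoped ENNReal
namespace Beer
open Filter Topology

def SG (U : Set (ℝ × ℝ)) : Set ((ℝ × ℝ) × (ℝ × ℝ)) := {p | segment ℝ p.1 p.2 ⊆ U}

def Good (T : Set ((ℝ × ℝ) × (ℝ × ℝ))) (p : (ℝ × ℝ) × (ℝ × ℝ)) : Prop :=
  ∀ (v : (ℝ × ℝ) × (ℝ × ℝ)) (ε : ℝ), 0 < ε →
    ∀ᶠ r : ℝ in 𝓝[>] 0, (T ∩ Metric.closedBall (p + r • v) (r * ε)).Nonempty

instance haar2 : (volume : Measure (ℝ × ℝ)).IsAddHaarMeasure :=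
  inferInstanceAs ((volume : Measure ℝ).prod (volume : Measure ℝ)).IsAddHaarMeasure

instance haar4 : (volume : Measure ((ℝ × ℝ) × (ℝ × ℝ))).IsAddHaarMeasure :=
  inferInstanceAs ((volume : Measure (ℝ × ℝ)).prod (volume : Measure (ℝ × ℝ))).IsAddHaarMeasure

theorem dens (T : Set ((ℝ × ℝ) × (ℝ × ℝ))) : ∀ᵐ p ∂(volume.restrict T), Good T p := by
  have h : ∀ᵐ p ∂((volume : Measure ((ℝ × ℝ) × (ℝ × ℝ))).restrict T), ∀ K : ℕ, _ :=
    ae_all_iff.2 fun K : ℕ =>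
    IsUnifLocDoublingMeasure.ae_tendsto_measure_inter_div (volume : Measure ((ℝ × ℝ) × (ℝ × ℝ))) T (K : ℝ)
  filter_upwards [h] with p hp v ε hε
  obtain ⟨K, hK⟩ := exists_nat_ge (‖v‖ / ε)
  have hl : Tendsto (fun r : ℝ => r * ε) (𝓝[>] 0) (𝓝[>] 0) := by
    refine tendsto_nhdsWithin_iff.2 ⟨?_, ?_⟩
    · have : Tendsto (fun r : ℝ => r * ε) (𝓝 0) (𝓝 (0 * ε)) := by
        exact Continuous.tendsto (by fun_prop) 0
      rw [zero_mul] at this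
      exact this.mono_left nhdsWithin_le_nhds
    · filter_upwards [self_mem_nhdsWithin] with r hr
      exact mul_pos hr hε
  have h2 := hp K (fun r : ℝ => p + r • v) (fun r : ℝ => r * ε) hl (by
    filter_upwards [self_mem_nhdsWithin] with r hr
    have hr : 0 < r := hr
    rw [mem_closedBall_iff_norm]
    simp only [sub_add_cancel_left, norm_neg, norm_smul, Real.norm_eq_abs, abs_of_pos hr]
    rw [div_le_iff₀ hε] at hK
    nlinarith)
  filter_upwards [h2.eventually_ne one_ne_zero] with r hr
  by_contra hne
  rw [Set.not_nonempty_iff_eq_empty] at hne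
  rw [hne] at hr
  simp at hr

theorem good_int {S : Set (ℝ × ℝ)} (hW : W2 S) {p : (ℝ × ℝ) × (ℝ × ℝ)} (hg : Good (SG S) p)
    (hne : p.1 ≠ p.2) : openSegment ℝ p.1 p.2 ⊆ interior S := by
  intro z hz
  obtain ⟨t, h0, h1, hzt⟩ := mem_oseg.1 hz
  obtain ⟨a1, b1, a2, b2, a3, b3, ε, hε, hmod⟩ := model h0 h1
  obtain ⟨A, B⟩ := p
  simp only at hne hzt
  set u : ℝ × ℝ := B - A with hu
  set n : ℝ × ℝ := (-u.2, u.1) with hn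
  have hu0 : u ≠ 0 := sub_ne_zero.2 hne.symm
  have hD : 0 < dt u u := by
    have : 0 ≤ dt u u := by exact add_nonneg (mul_self_nonneg _) (mul_self_nonneg _)
    refine lt_of_le_of_ne this fun h => hu0 ?_
    simp only [dt] at h
    have h1 : u.1 = 0 := by nlinarith
    have h2 : u.2 = 0 := by nlinarith
    exact Prod.ext h1 h2
  set D := dt u u with hDd
  set M := |u.1| + |u.2| with hM
  have hM0 : 0 ≤ M := by positivity
  let η : ℝ := ε * D / (M + 1) / 2
  have hη : 0 < η := by positivity
  have hηM : M * η / D < ε := by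
    simp only [η]
    rw [div_lt_iff₀ hD]
    have : M * (ε * D / (M + 1) / 2) = ε * D * (M / (M + 1)) / 2 := by field_simp
    rw [this]
    have h3 : M / (M + 1) < 1 := by rw [div_lt_one (by linarith)]; linarith
    have : 0 < ε * D := by positivity
    nlinarith
  have hev : ∀ᶠ r : ℝ in 𝓝[>] 0, r < 1 := by
    filter_upwards [nhdsWithin_le_nhds (Iio_mem_nhds (show (0:ℝ) < 1 by norm_num))] with r hr using hr
  have hpos : ∀ᶠ r : ℝ in 𝓝[>] 0, (0 : ℝ) < r := by
    filter_upwards [self_mem_nhdsWithin] with r hr using hr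
  obtain ⟨r, hr1, hr0, ⟨q1, hq1, hd1⟩, ⟨q2, hq2, hd2⟩, ⟨q3, hq3, hd3⟩⟩ :=
    (hev.and (hpos.and ((hg (a1 • n, b1 • n) η hη).and ((hg (a2 • n, b2 • n) η hη).and
      (hg (a3 • n, b3 • n) η hη))))).exists
  let Ψ : ℝ × ℝ → ℝ × ℝ := fun x => (dt u (x - A) / D, dt n (x - A) / (r * D))
  let Φ : (ℝ × ℝ) →ᵃ[ℝ] (ℝ × ℝ) :=
    ((LinearMap.fst ℝ ℝ ℝ).smulRight u + (LinearMap.snd ℝ ℝ ℝ).smulRight (r • n)).toAffineMap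
      + AffineMap.const ℝ (ℝ × ℝ) A
  have hΦ : ∀ x, Φ x = x.1 • u + x.2 • (r • n) + A := fun x => rfl
  have hDe : D = u.1 * u.1 + u.2 * u.2 := rfl
  have hΦΨ : ∀ x, Φ (Ψ x) = x := by
    intro x
    rw [hΦ]
    ext
    · simp [Ψ, dt, n]; field_simp; rw [hDe]; ring
    · simp [Ψ, dt, n]; field_simp; rw [hDe]; ring
  have hΨc : Continuous Ψ := by
    simp only [Ψ, dt]; fun_prop
  have hΨz : Ψ z = (t, 0) := by
    rw [hzt]
    simp only [Ψ]
    ext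
    · simp [dt]; field_simp; rw [hDe]; ring
    · simp [dt, n]; left; ring
  have hest : ∀ (x c : ℝ × ℝ) (s a : ℝ), c = A + s • u + (r * a) • n → dist x c ≤ r * η →
      dist (Ψ x) (s, a) < ε := by
    intro x c s a hc hx
    rw [dist_eq_norm, Prod.norm_def] at hx
    have hx1 := (le_max_left _ _).trans hx
    have hx2 := (le_max_right _ _).trans hx
    rw [Real.norm_eq_abs] at hx1 hx2
    set ρ := x - c with hρ
    have hxA : x - A = s • u + (r * a) • n + ρ := by rw [hρ, hc]; abel
    have hrη : 0 ≤ r * η := by positivity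
    have hb1 : |dt u ρ| ≤ M * (r * η) := by
      calc |dt u ρ| ≤ |u.1 * ρ.1| + |u.2 * ρ.2| := abs_add_le _ _
        _ = |u.1| * |ρ.1| + |u.2| * |ρ.2| := by rw [abs_mul, abs_mul]
        _ ≤ |u.1| * (r * η) + |u.2| * (r * η) := by gcongr
        _ = _ := by rw [hM]; ring
    have hb2 : |dt n ρ| ≤ M * (r * η) := by
      calc |dt n ρ| ≤ |n.1 * ρ.1| + |n.2 * ρ.2| := abs_add_le _ _
        _ = |u.2| * |ρ.1| + |u.1| * |ρ.2| := by rw [abs_mul, abs_mul]; simp [n]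
        _ ≤ |u.2| * (r * η) + |u.1| * (r * η) := by gcongr
        _ = _ := by rw [hM]; ring
    have e1 : (Ψ x).1 - s = dt u ρ / D := by
      simp only [Ψ, hxA]
      have : dt u (s • u + (r * a) • n + ρ) = s * D + dt u ρ := by
        rw [hDe]; simp [dt, n]; ring
      rw [this]; field_simp; ring
    have e2 : (Ψ x).2 - a = dt n ρ / (r * D) := by
      simp only [Ψ, hxA]
      have : dt n (s • u + (r * a) • n + ρ) = r * a * D + dt n ρ := by
        rw [hDe]; simp [dt, n]; ring
      rw [this]; field_simp; ring
    rw [Prod.dist_eq, Real.dist_eq, Real.dist_eq]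
    refine max_lt ?_ ?_
    · change |(Ψ x).1 - s| < ε
      rw [e1, abs_div, abs_of_pos hD]
      refine lt_of_le_of_lt ?_ hηM
      gcongr
      nlinarith [mul_nonneg hM0 hη.le]
    · change |(Ψ x).2 - a| < ε
      rw [e2, abs_div, abs_of_pos (mul_pos hr0 hD)]
      refine lt_of_le_of_lt ?_ hηM
      rw [div_le_div_iff₀ (by positivity) hD]
      nlinarith [mul_le_mul_of_nonneg_right hb2 hD.le]
  have hest2 : ∀ (q : (ℝ × ℝ) × (ℝ × ℝ)) (a b : ℝ),
      q ∈ Metric.closedBall ((A, B) + r • ((a • n, b • n) : (ℝ × ℝ) × (ℝ × ℝ))) (r * η) →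
      dist ((Ψ q.1, Ψ q.2) : (ℝ × ℝ) × (ℝ × ℝ)) ((0, a), (1, b)) < ε := by
    intro q a b hq
    rw [Metric.mem_closedBall, Prod.dist_eq] at hq
    rw [Prod.dist_eq]
    refine max_lt (hest _ _ _ _ ?_ ((le_max_left _ _).trans hq)) (hest _ _ _ _ ?_ ((le_max_right _ _).trans hq))
    · simp [smul_smul]
    · simp [smul_smul, hu]
  obtain ⟨P, Q, R, k1, k2, k3, k4, k5, k6, k7⟩ := hmod _ _ _ (hest2 _ _ _ hd1) (hest2 _ _ _ hd2) (hest2 _ _ _ hd3)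
  have hmap : ∀ (q : (ℝ × ℝ) × (ℝ × ℝ)) (x : ℝ × ℝ), x ∈ segment ℝ (Ψ q.1) (Ψ q.2) →
      Φ x ∈ segment ℝ q.1 q.2 := by
    intro q x hx
    have := Set.mem_image_of_mem Φ hx
    rw [image_segment, hΦΨ, hΦΨ] at this
    exact this
  have hhull : convexHull ℝ {Φ P, Φ Q, Φ R} ⊆ S :=
    tri_hull hW (seg_sub hq1 (hmap _ _ k1) (hmap _ _ k2)) (seg_sub hq2 (hmap _ _ k3) (hmap _ _ k4))
      (seg_sub hq3 (hmap _ _ k5) (hmap _ _ k6))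
  rw [mem_interior]
  refine ⟨Ψ ⁻¹' interior (convexHull ℝ {P, Q, R}), ?_, isOpen_interior.preimage hΨc, ?_⟩
  · intro x hx
    have hx' := Set.mem_image_of_mem Φ (interior_subset hx)
    rw [AffineMap.image_convexHull, hΦΨ] at hx'
    apply hhull
    simpa [Set.image_insert_eq] using hx'
  · simp only [Set.mem_preimage]; rw [hΨz]; exact k7

theorem diag_null : volume {p : (ℝ × ℝ) × (ℝ × ℝ) | p.1 = p.2} = 0 := by
  have h := Measure.addHaar_submodule (volume : Measure ((ℝ × ℝ) × (ℝ × ℝ)))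
    (LinearMap.eqLocus (LinearMap.fst ℝ (ℝ × ℝ) (ℝ × ℝ)) (LinearMap.snd ℝ (ℝ × ℝ) (ℝ × ℝ))) (by
      intro h
      have : (((1, 0), (0, 0)) : (ℝ × ℝ) × (ℝ × ℝ)) ∈ (⊤ : Submodule ℝ ((ℝ × ℝ) × (ℝ × ℝ))) := trivial
      rw [← h, LinearMap.mem_eqLocus] at this
      simp at this)
  exact h

theorem ae_oseg {S : Set (ℝ × ℝ)} (hW : W2 S) (hm : MeasurableSet (SG S)) :
    ∀ᵐ p : (ℝ × ℝ) × (ℝ × ℝ), p ∈ SG S → openSegment ℝ p.1 p.2 ⊆ interior S := by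
  have h1 := (ae_restrict_iff' hm).1 (dens (SG S))
  have h2 : ∀ᵐ p : (ℝ × ℝ) × (ℝ × ℝ), p.1 ≠ p.2 := by
    rw [ae_iff]; simpa using diag_null
  filter_upwards [h1, h2] with p hp hne hs
  exact good_int hW (hp hs) hne
end Beer

open MeasureTheory
open scoped ENNReal
namespace Beer
open Filter Topology

theorem meas_os {U : Set (ℝ × ℝ)} (hU : IsOpen U) :
    MeasurableSet {p : (ℝ × ℝ) × (ℝ × ℝ) | openSegment ℝ p.1 p.2 ⊆ U} := by
  have h : {p : (ℝ × ℝ) × (ℝ × ℝ) | openSegment ℝ p.1 p.2 ⊆ U} =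
      ⋂ n : ℕ, (fun p : (ℝ × ℝ) × (ℝ × ℝ) => (p.1 + (1 / ((n : ℝ) + 2)) • (p.2 - p.1),
        p.1 + (1 - 1 / ((n : ℝ) + 2)) • (p.2 - p.1))) ⁻¹' {p | segment ℝ p.1 p.2 ⊆ U} := by
    ext ⟨A, B⟩
    simp only [Set.mem_iInter, Set.mem_preimage, Set.mem_ofPred_eq]
    constructor
    · intro h n
      have hn : (0 : ℝ) < 1 / ((n : ℝ) + 2) := by positivity
      have hn' : 1 / ((n : ℝ) + 2) < 1 := by
        rw [div_lt_one (by positivity)]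
        have : (0 : ℝ) ≤ n := n.cast_nonneg
        linarith
      refine ((convex_openSegment A B).segment_subset ?_ ?_).trans h
      · exact mem_oseg.2 ⟨_, hn, hn', rfl⟩
      · exact mem_oseg.2 ⟨_, by linarith, by linarith, rfl⟩
    · intro h z hz
      obtain ⟨t, h0, h1, rfl⟩ := mem_oseg.1 hz
      have hmin : 0 < min t (1 - t) := lt_min h0 (by linarith)
      obtain ⟨n, hn⟩ := exists_nat_one_div_lt hmin
      have hn2 : 1 / ((n : ℝ) + 2) < min t (1 - t) := by
        refine lt_of_le_of_lt ?_ hn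
        gcongr; norm_num
      have hlt := hn2.trans_le (min_le_left _ _)
      have hlt' := hn2.trans_le (min_le_right _ _)
      apply h n
      set a := 1 / ((n : ℝ) + 2) with ha
      have hpos : 0 < 1 - 2 * a := by linarith
      refine mem_seg.2 ⟨(t - a) / (1 - 2 * a), by apply div_nonneg <;> linarith,
        by rw [div_le_one hpos]; linarith, ?_⟩
      have hs : (t - a) / (1 - 2 * a) * (1 - 2 * a) = t - a := div_mul_cancel₀ _ hpos.ne'
      set s := (t - a) / (1 - 2 * a)
      have ht : t = a + s * (1 - 2 * a) := by linarith
      rw [ht]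
      module
  rw [h]
  refine MeasurableSet.iInter fun n => ?_
  exact ((vis_open hU).preimage (by fun_prop)).measurableSet

theorem sec_null {U : Set (ℝ × ℝ)} (hU : IsOpen U) (hv : volume U ≠ ⊤) (B : ℝ × ℝ) :
    volume {A | openSegment ℝ A B ⊆ U ∧ A ∉ U} = 0 := by
  set E := {A | openSegment ℝ A B ⊆ U ∧ A ∉ U} with hE
  have hEm : MeasurableSet E := by
    have h1 : MeasurableSet ((fun A : ℝ × ℝ => (A, B)) ⁻¹' {p : (ℝ × ℝ) × (ℝ × ℝ) | openSegment ℝ p.1 p.2 ⊆ U}) :=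
      (meas_os hU).preimage (by fun_prop)
    exact h1.inter hU.measurableSet.compl
  let r : ℕ → ℝ := fun k => 1 - 1 / ((k : ℝ) + 2)
  have hr : ∀ k, 1 / 2 ≤ r k ∧ r k < 1 := by
    intro k
    have hk : (0 : ℝ) ≤ k := k.cast_nonneg
    have h1 : 1 / ((k : ℝ) + 2) ≤ 1 / 2 := by gcongr; linarith
    have h2 : 0 < 1 / ((k : ℝ) + 2) := by positivity
    simp only [r]; constructor <;> linarith
  have hri : StrictMono r := by
    intro j k hjk
    have : (j : ℝ) < k := by exact_mod_cast hjk
    simp only [r]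
    gcongr
  let F : ℕ → Set (ℝ × ℝ) := fun k => AffineMap.homothety B (r k) '' E
  have hval : ∀ k A, AffineMap.homothety B (r k) A = r k • (A - B) + B := by
    intro k A; simp [AffineMap.homothety_apply]
  have hFm : ∀ k, MeasurableSet (F k) := by
    intro k
    refine hEm.image_of_continuousOn_injOn ?_ ?_
    · refine Continuous.continuousOn ?_
      have : (AffineMap.homothety B (r k) : ℝ × ℝ → ℝ × ℝ) = fun A => r k • (A - B) + B := by
        funext A; exact hval k A
      rw [this]; fun_prop
    · intro x _ y _ hxy
      rw [hval, hval] at hxy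
      have h1 := add_right_cancel hxy
      have h2 := smul_right_injective (ℝ × ℝ) (show r k ≠ 0 by linarith [(hr k).1]) h1
      exact sub_left_injective h2
  have hFU : ∀ k, F k ⊆ U := by
    rintro k _ ⟨A, hA, rfl⟩
    apply hA.1
    rw [hval]
    refine mem_oseg.2 ⟨1 - r k, by linarith [(hr k).2], by linarith [(hr k).1], ?_⟩
    module
  have hdis : ∀ j k, j < k → Disjoint (F j) (F k) := by
    intro j k hjk
    rw [Set.disjoint_left]
    rintro z ⟨A, hA, rfl⟩ ⟨A', hA', h⟩
    rw [hval, hval] at h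
    have h1 := add_right_cancel h
    have hlt := hri hjk
    have hk := (hr k).1
    have hj := (hr j).1
    apply hA'.2
    apply hA.1
    refine mem_oseg.2 ⟨1 - r j / r k, ?_, ?_, ?_⟩
    · rw [sub_pos, div_lt_one (by linarith)]; exact hlt
    · have : 0 < r j / r k := by apply div_pos <;> linarith
      linarith
    · have hk0 : r k ≠ 0 := by linarith
      have h2 : A' - B = (r j / r k) • (A - B) := by
        rw [div_eq_inv_mul, mul_smul, ← h1, smul_smul, inv_mul_cancel₀ hk0, one_smul]
      have h3 : A' = (r j / r k) • (A - B) + B := by rw [← h2]; abel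
      rw [h3]; module
  have hpd : Pairwise (Function.onFun Disjoint F) := by
    intro j k hjk
    rcases lt_or_gt_of_ne hjk with h | h
    · exact hdis _ _ h
    · exact (hdis _ _ h).symm
  have hsum := measure_iUnion (μ := volume) hpd hFm
  by_contra hne
  have hge : ∀ k, ENNReal.ofReal (1 / 4) * volume E ≤ volume (F k) := by
    intro k
    simp only [F]
    rw [Measure.addHaar_image_homothety]
    gcongr
    simp only [Module.finrank_prod, Module.finrank_self]
    rw [abs_of_nonneg (pow_nonneg (by linarith [(hr k).1]) _)]
    nlinarith [(hr k).1]
  have htop : ∑' k, volume (F k) = ⊤ := by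
    rw [eq_top_iff]
    calc ⊤ = ∑' _ : ℕ, ENNReal.ofReal (1 / 4) * volume E :=
          (ENNReal.tsum_const_eq_top_of_ne_zero (mul_ne_zero (by simp) hne)).symm
      _ ≤ _ := ENNReal.tsum_le_tsum hge
  rw [htop] at hsum
  exact hv (top_le_iff.1 (hsum ▸ measure_mono (Set.iUnion_subset hFU)))

theorem end_null {U : Set (ℝ × ℝ)} (hU : IsOpen U) (hv : volume U ≠ ⊤) :
    volume {p : (ℝ × ℝ) × (ℝ × ℝ) | openSegment ℝ p.1 p.2 ⊆ U ∧ ¬ segment ℝ p.1 p.2 ⊆ U} = 0 := by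
  have h1 : volume {p : (ℝ × ℝ) × (ℝ × ℝ) | openSegment ℝ p.1 p.2 ⊆ U ∧ p.1 ∉ U} = 0 := by
    rw [Measure.volume_eq_prod, Measure.prod_apply_symm]
    · rw [lintegral_eq_zero_of_ae_eq_zero]
      exact Eventually.of_forall fun B => sec_null hU hv B
    · exact (meas_os hU).inter (hU.measurableSet.compl.preimage measurable_fst)
  have h2 : volume {p : (ℝ × ℝ) × (ℝ × ℝ) | openSegment ℝ p.1 p.2 ⊆ U ∧ p.2 ∉ U} = 0 := by
    rw [Measure.volume_eq_prod, Measure.prod_apply]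
    · rw [lintegral_eq_zero_of_ae_eq_zero]
      refine Eventually.of_forall fun A => ?_
      have := sec_null hU hv A
      simp only [openSegment_symm ℝ _ A] at this
      exact this
    · exact (meas_os hU).inter (hU.measurableSet.compl.preimage measurable_snd)
  refine measure_mono_null (t := _ ∪ _) ?_ (measure_union_null h1 h2)
  rintro p ⟨ho, hs⟩
  by_contra hn
  simp only [Set.mem_union, Set.mem_ofPred_eq, not_or, not_and, not_not] at hn
  apply hs
  rw [← insert_endpoints_openSegment]
  intro z hz
  rcases hz with rfl | rfl | hz
  · exact hn.1 ho
  · exact hn.2 ho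
  · exact ho hz

theorem SG_int {S : Set (ℝ × ℝ)} (hW : W2 S) (hm : MeasurableSet (SG S)) (hv : volume S ≠ ⊤) :
    volume (SG S) ≤ volume (SG (interior S)) := by
  have h1 := ae_oseg hW hm
  have hv' : volume (interior S) ≠ ⊤ := ne_top_of_le_ne_top hv (measure_mono interior_subset)
  have h2 := end_null isOpen_interior hv'
  have h3 : ∀ᵐ p : (ℝ × ℝ) × (ℝ × ℝ), ¬ (openSegment ℝ p.1 p.2 ⊆ interior S ∧ ¬ segment ℝ p.1 p.2 ⊆ interior S) := by
    rw [ae_iff]; simpa using h2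
  refine measure_mono_ae ?_
  filter_upwards [h1, h3] with p hp hq hs
  by_contra hn
  exact hq ⟨hp hs, hn⟩

theorem main {S : Set (ℝ × ℝ)} (hW : W2 S) (hm : MeasurableSet (SG S)) (hv : volume S ≠ ⊤) :
    volume (SG S) ≤ 128 * (⨆ (K : Set (ℝ × ℝ)) (_ : K ⊆ S ∧ Convex ℝ K), volume K) * volume S := by
  set c := ⨆ (K : Set (ℝ × ℝ)) (_ : K ⊆ S ∧ Convex ℝ K), volume K with hc
  have hcle : c ≤ volume S := iSup₂_le fun K hK => measure_mono hK.1
  have hctop : c ≠ ⊤ := ne_top_of_le_ne_top hv hcle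
  refine (SG_int hW hm hv).trans ?_
  have hU : SG (interior S) = ⋃ n : ℕ, SG (interior S ∩ Metric.ball 0 n) := by
    ext p
    simp only [Set.mem_iUnion, SG, Set.mem_ofPred_eq]
    constructor
    · intro h
      obtain ⟨n, hn⟩ := exists_nat_gt (max ‖p.1‖ ‖p.2‖)
      refine ⟨n, Set.subset_inter h ((convex_ball 0 (n : ℝ)).segment_subset ?_ ?_)⟩
      · rw [mem_ball_zero_iff]; exact (le_max_left _ _).trans_lt hn
      · rw [mem_ball_zero_iff]; exact (le_max_right _ _).trans_lt hn
    · rintro ⟨n, hn⟩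
      exact hn.trans Set.inter_subset_left
  have hmono : Monotone fun n : ℕ => SG (interior S ∩ Metric.ball 0 n) := by
    intro a b hab p hp
    refine Set.Subset.trans hp ?_
    gcongr
  rw [hU, hmono.measure_iUnion]
  refine iSup_le fun n => ?_
  have hb := open_bound (U := interior S ∩ Metric.ball 0 n) (m := c.toReal)
    (isOpen_interior.inter Metric.isOpen_ball) (Metric.isBounded_ball.subset Set.inter_subset_right)
    (W2_inter (W2_int hW) Metric.isOpen_ball (convex_ball _ _))
    (by
      intro K hK hKc
      rw [ENNReal.ofReal_toReal hctop]
      exact le_iSup₂ (f := fun (K : Set (ℝ × ℝ)) (_ : K ⊆ S ∧ Convex ℝ K) => volume K) K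
        ⟨hK.trans (Set.inter_subset_left.trans interior_subset), hKc⟩)
    ENNReal.toReal_nonneg
  refine hb.trans ?_
  rw [ENNReal.ofReal_mul (by norm_num), ENNReal.ofReal_toReal hctop]
  gcongr
  · simp
  · exact Set.inter_subset_left.trans interior_subset
end Beer

/-- Every p-componentwise simply connected set `S ⊆ ℝ²` whose Beer index
is defined satisfies `b(S) ≤ 180 · c(S)`. -/
theorem beer_le_180_convexity_ratio (S : Set (ℝ × ℝ))
    (h0 : volume S ≠ 0) (htop : volume S ≠ ⊤)
    (hseg : MeasurableSet {p : (ℝ × ℝ) × (ℝ × ℝ) |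
      p.1 ∈ S ∧ p.2 ∈ S ∧ segment ℝ p.1 p.2 ⊆ S})
    (hpsc : ∀ A ∈ S, SimplyConnectedSpace {B : ℝ × ℝ // PolyConn S A B}) :
    volume {p : (ℝ × ℝ) × (ℝ × ℝ) |
        p.1 ∈ S ∧ p.2 ∈ S ∧ segment ℝ p.1 p.2 ⊆ S} / volume S ^ 2 ≤
      180 * ((⨆ (K : Set (ℝ × ℝ)) (_ : K ⊆ S ∧ Convex ℝ K), volume K) / volume S) := by
  have hs : {p : (ℝ × ℝ) × (ℝ × ℝ) | p.1 ∈ S ∧ p.2 ∈ S ∧ segment ℝ p.1 p.2 ⊆ S} = Beer.SG S := by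
    ext p
    exact ⟨fun h => h.2.2, fun h => ⟨h (left_mem_segment _ _ _), h (right_mem_segment _ _ _), h⟩⟩
  rw [hs] at hseg ⊢
  have := Beer.main (Beer.W2_of_psc hpsc) hseg htop
  set c := ⨆ (K : Set (ℝ × ℝ)) (_ : K ⊆ S ∧ Convex ℝ K), volume K
  rw [ENNReal.div_le_iff (pow_ne_zero 2 h0) (ENNReal.pow_ne_top htop)]
  refine this.trans ?_
  have e : 180 * (c / volume S) * volume S ^ 2 = 180 * c * volume S := by
    rw [pow_two, ← mul_assoc, mul_assoc 180, ENNReal.div_mul_cancel h0 htop]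
  rw [e]
  gcongr
  norm_num
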